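/- Let λ ∈ ℂ with 0 < |λ| < 1, let ω ∈ ℝ be irrational, and let k ≥ 2 be an integer. For x ∈ ℝ define α_{x,n} = e(x)·λ·e(ω·n^k) for n ∈ ℕ, and let 𝒞_x be the associated half-line CMV operator. Then for Lebesgue-almost every x ∈ [0,1), there exists a Hilbert basis (complete orthonormal system) of ℓ²(ℕ, ℂ) consisting of eigenvectors of 𝒞_x. -/

import Mathlib

open scoped ComplexConjugate

noncomputable section

/-- `e t = exp(2πi t)`. -/
def e (t : ℝ) : ℂ := Complex.exp (2 * Real.pi * Complex.I * t)

/-- `ρ n = (1 - |α n|^2)^{1/2}`, as a complex number. -/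
def rhoN (α : ℕ → ℂ) (n : ℕ) : ℂ := ((1 - ‖α n‖ ^ 2).sqrt : ℝ)

lemma e_add (s t : ℝ) : e (s + t) = e s * e t := by
  rw [e, e, e, ← Complex.exp_add]; push_cast; ring_nf

lemma e_zero : e 0 = 1 := by simp [e]

lemma e_neg_mul_self (t : ℝ) : e (-t) * e t = 1 := by
  rw [← e_add, neg_add_cancel, e_zero]

lemma e_eq_exp_mul_I (t : ℝ) : e t = Complex.exp ((2 * Real.pi * t : ℝ) * Complex.I) := by
  rw [e]; push_cast; ring_nf

lemma norm_e (t : ℝ) : ‖e t‖ = 1 := by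
  rw [e_eq_exp_mul_I, Complex.norm_exp_ofReal_mul_I]

lemma conj_e (t : ℝ) : conj (e t) = e (-t) := by
  rw [e_eq_exp_mul_I, e_eq_exp_mul_I, ← Complex.exp_conj, map_mul,
    Complex.conj_ofReal, Complex.conj_I]
  push_cast; ring_nf

lemma e_int (m : ℤ) : e m = 1 := by
  rw [e, show (2 * Real.pi * Complex.I * ((m : ℝ) : ℂ) : ℂ) = m * (2 * Real.pi * Complex.I) by
    push_cast; ring]
  exact Complex.exp_int_mul_two_pi_mul_I m

lemma e_natCast_mul (n : ℕ) (t : ℝ) : e (n * t) = e t ^ n := by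
  rw [e, e, ← Complex.exp_nat_mul]; push_cast; ring_nf

lemma e_eq_one_iff (t : ℝ) : e t = 1 ↔ ∃ n : ℤ, t = n := by
  rw [e, Complex.exp_eq_one_iff]
  constructor
  · rintro ⟨n, hn⟩
    refine ⟨n, ?_⟩
    have h : (2 * Real.pi * Complex.I : ℂ) ≠ 0 := Complex.two_pi_I_ne_zero
    have : (t : ℂ) = n := mul_left_cancel₀ h (by rw [hn]; ring)
    exact_mod_cast this
  · rintro ⟨n, rfl⟩
    exact ⟨n, by push_cast; ring⟩

lemma continuous_e : Continuous e := by unfold e; fun_prop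

lemma norm_e_sub_e (s t : ℝ) : ‖e s - e t‖ ≤ 2 * Real.pi * |s - t| := by
  have h : e s - e t = e t * (e (s - t) - 1) := by
    rw [mul_sub, ← e_add]; ring_nf
  rw [h, norm_mul, norm_e, one_mul, e_eq_exp_mul_I, mul_comm _ Complex.I]
  refine (Real.norm_exp_I_mul_ofReal_sub_one_le).trans ?_
  rw [Real.norm_eq_abs, abs_mul, abs_of_pos (by positivity : 0 < 2 * Real.pi)]

lemma norm_e_sub_one (t : ℝ) : ‖e t - 1‖ = 2 * |Real.sin (Real.pi * t)| := by
  rw [e_eq_exp_mul_I, mul_comm _ Complex.I, Complex.norm_exp_I_mul_ofReal_sub_one]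
  rw [norm_mul, Real.norm_eq_abs, Real.norm_eq_abs, abs_two]; congr 3; ring

lemma four_mul_dist_round_le (t : ℝ) : 4 * |t - round t| ≤ ‖e t - 1‖ := by
  have h1 : e t = e (t - round t) := by
    have := e_add (t - round t) (round t : ℤ)
    rw [e_int, mul_one] at this
    rw [← this]; ring_nf
  rw [h1, norm_e_sub_one]
  have h2 := abs_sub_round t
  set u := t - round t
  have h3 : |Real.sin (Real.pi * u)| = Real.sin (Real.pi * |u|) := by
    have hu : 0 ≤ Real.sin (Real.pi * |u|) :=
      Real.sin_nonneg_of_nonneg_of_le_pi (by positivity) (by nlinarith [Real.pi_pos, abs_nonneg u])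
    rcases abs_cases u with ⟨h, _⟩ | ⟨h, _⟩
    · rw [h] at hu ⊢; exact abs_of_nonneg hu
    · rw [h] at hu ⊢
      rw [mul_neg, Real.sin_neg] at hu ⊢
      exact abs_of_nonpos (by linarith)
  rw [h3]
  have := Real.mul_le_sin (x := Real.pi * |u|) (by positivity) (by nlinarith [Real.pi_pos])
  have h4 : 2 / Real.pi * (Real.pi * |u|) = 2 * |u| := by
    field_simp
  linarith

lemma norm_sum_e_linear (θ c : ℝ) (n : ℕ) :
    |θ - round θ| * ‖∑ j ∈ Finset.range n, e (θ * j + c)‖ ≤ 1 / 2 := by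
  have h1 : (e θ - 1) * ∑ j ∈ Finset.range n, e (θ * j + c) = e c * (e θ ^ n - 1) := by
    rw [← mul_geom_sum, Finset.mul_sum, Finset.mul_sum, Finset.mul_sum]
    refine Finset.sum_congr rfl fun j _ => ?_
    rw [e_add, mul_comm θ, e_natCast_mul]; ring
  have h2 : ‖(e θ - 1) * ∑ j ∈ Finset.range n, e (θ * j + c)‖ ≤ 2 := by
    rw [h1, norm_mul, norm_e, one_mul]
    refine (norm_sub_le _ _).trans ?_
    rw [norm_pow, norm_e]; norm_num
  rw [norm_mul] at h2
  have := four_mul_dist_round_le θ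
  nlinarith [norm_nonneg (∑ j ∈ Finset.range n, e (θ * j + c)), abs_nonneg (θ - round θ)]

lemma exists_nat_mul_near_int {β ε : ℝ} {n W : ℕ} (hW : 1 ≤ W) (hn : 2 * W < n)
    (hε0 : 0 ≤ ε) (hε : ε * (32 * W) ≤ 1) (G : Finset ℕ) (hG : ∀ h ∈ G, h < n)
    (hcard : n ≤ G.card * W) (hβ : ∀ h ∈ G, ∃ p : ℤ, |h * β - p| ≤ ε) :
    ∃ q : ℕ, 1 ≤ q ∧ q ≤ 2 * W ∧ ∃ p : ℤ, |q * β - p| * n ≤ 16 * W ^ 2 * ε := by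
  obtain ⟨h1, hh1, h2, hh2, hlt, hcell⟩ : ∃ h1 ∈ G, ∃ h2 ∈ G, h1 < h2 ∧
      h1 / (2 * W) = h2 / (2 * W) := by
    have : ∃ x ∈ G, ∃ y ∈ G, x ≠ y ∧ x / (2 * W) = y / (2 * W) := by
      apply Finset.exists_ne_map_eq_of_card_lt_of_maps_to
        (t := Finset.range (n / (2 * W) + 1))
      · rw [Finset.card_range]
        by_contra! hcon
        have h1 : G.card * W ≤ (n / (2 * W) + 1) * W := Nat.mul_le_mul_right _ hcon
        have h2 : n / (2 * W) * (2 * W) ≤ n := Nat.div_mul_le_self _ _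
        nlinarith
      · intro h hh
        simp only [Finset.coe_range, Set.mem_Iio]
        exact Nat.lt_succ_of_le (Nat.div_le_div_right (hG h hh).le)
    obtain ⟨x, hx, y, hy, hxy, hc⟩ := this
    rcases lt_or_gt_of_ne hxy with h | h
    · exact ⟨x, hx, y, hy, h, hc⟩
    · exact ⟨y, hy, x, hx, h, hc.symm⟩
  obtain ⟨p1, hp1⟩ := hβ h1 hh1
  obtain ⟨p2, hp2⟩ := hβ h2 hh2
  obtain ⟨q, rfl⟩ : ∃ q, h2 = h1 + q := ⟨h2 - h1, by omega⟩
  have hq1 : 1 ≤ q := by omega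
  have hq2 : q ≤ 2 * W := by
    have e1 := Nat.div_add_mod h1 (2 * W)
    have e2 := Nat.div_add_mod (h1 + q) (2 * W)
    have l2 := Nat.mod_lt (h1 + q) (show 0 < 2 * W by omega)
    rw [← hcell] at e2
    omega
  refine ⟨q, hq1, hq2, p2 - p1, ?_⟩
  set a : ℤ := p2 - p1 with ha
  set κ := |(q : ℝ) * β - a| with hκ
  have hWR : (1 : ℝ) ≤ W := by exact_mod_cast hW
  have hκε : κ ≤ 2 * ε := by
    have : (q : ℝ) * β - a = (((h1 + q : ℕ) : ℝ) * β - p2) - (h1 * β - p1) := by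
      rw [ha]; push_cast; ring
    rw [hκ, this]
    exact (abs_sub _ _).trans (by linarith)
  have hε32 : ε ≤ 1 / 32 := by nlinarith
  rcases (abs_nonneg _ : 0 ≤ κ).eq_or_lt with h0 | hpos
  · rw [show κ = 0 from h0.symm, zero_mul]; positivity
  have key : ∀ h ∈ G, ∀ i : ℕ, h + q * i ∈ G → i * κ ≤ 1 / 2 → i * κ ≤ 2 * ε := by
    intro h hh i hi hik
    obtain ⟨r1, hr1⟩ := hβ h hh
    obtain ⟨r2, hr2⟩ := hβ _ hi
    have h3 : |(i : ℝ) * (q * β - a) - ((r2 - r1 - i * a : ℤ) : ℝ)| ≤ 2 * ε := by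
      have : (i : ℝ) * (q * β - a) - ((r2 - r1 - i * a : ℤ) : ℝ)
          = (((h + q * i : ℕ) : ℝ) * β - r2) - (h * β - r1) := by push_cast; ring
      rw [this]
      exact (abs_sub _ _).trans (by linarith)
    set r := (r2 - r1 - i * a : ℤ)
    have h4 : |(i : ℝ) * (q * β - a)| = i * κ := by rw [abs_mul, Nat.abs_cast]
    have hr : r = 0 := by
      by_contra hr
      have : (1 : ℝ) ≤ |(r : ℝ)| := by exact_mod_cast Int.one_le_abs hr
      have h5 := abs_sub_abs_le_abs_sub (r : ℝ) ((i : ℝ) * (q * β - a))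
      rw [abs_sub_comm] at h5
      linarith
    rw [hr] at h3
    rw [← h4]; simpa using h3
  set I := ⌊1 / (2 * κ)⌋₊ with hI
  have hI1 : 1 ≤ I := Nat.le_floor (by
    rw [Nat.cast_one, le_div_iff₀ (by positivity)]; linarith)
  have hIle : (I : ℝ) * (2 * κ) ≤ 1 := by
    rw [← le_div_iff₀ (by positivity)]; exact Nat.floor_le (by positivity)
  have hIge : 1 ≤ (I : ℝ) * (4 * κ) := by
    have h6 : 1 / (2 * κ) < I + 1 := Nat.lt_floor_add_one _
    rw [div_lt_iff₀ (by positivity)] at h6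
    have : (1 : ℝ) ≤ I := by exact_mod_cast hI1
    nlinarith
  set F := ⌊2 * ε / κ⌋₊ + 1 with hF
  have hFle : (F : ℝ) * κ ≤ 4 * ε := by
    have : (⌊2 * ε / κ⌋₊ : ℝ) ≤ 2 * ε / κ := Nat.floor_le (by positivity)
    rw [le_div_iff₀ hpos] at this
    rw [hF]; push_cast; nlinarith
  have hcount : G.card ≤ F * (((Finset.range (n / (q * I) + 1)) ×ˢ Finset.range q).card) := by
    apply Finset.card_le_mul_card_image_of_maps_to (f := fun h => (h / (q * I), h % q))
    · intro h hh
      simp only [Finset.mem_product, Finset.mem_range]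
      exact ⟨Nat.lt_succ_of_le (Nat.div_le_div_right (hG h hh).le), Nat.mod_lt _ (by omega)⟩
    · rintro ⟨u, v⟩ -
      by_cases hne : (G.filter fun h => (h / (q * I), h % q) = (u, v)).Nonempty
      · set S := G.filter fun h => (h / (q * I), h % q) = (u, v)
        set h0 := S.min' hne
        have hmem0 := S.min'_mem hne
        have : S ⊆ (Finset.range F).image fun i => h0 + q * i := by
          intro h hh
          have hle : h0 ≤ h := S.min'_le h hh
          have hh' := (Finset.mem_filter.1 hh)
          have hh0' := (Finset.mem_filter.1 hmem0)
          simp only [Prod.mk.injEq] at hh' hh0'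
          have hmod : h0 ≡ h [MOD q] := by
            rw [Nat.ModEq, hh'.2.2, ← hh0'.2.2]
          obtain ⟨i, hi⟩ := (Nat.modEq_iff_dvd' hle).1 hmod
          have hi' : h = h0 + q * i := by omega
          have hiI : i < I := by
            have e1 := Nat.div_add_mod h0 (q * I)
            have e2 := Nat.div_add_mod h (q * I)
            rw [hh'.2.1] at e2
            rw [show h0 / (q * I) = u from hh0'.2.1] at e1
            have l2 := Nat.mod_lt h (show 0 < q * I by positivity)
            have : q * i < q * I := by omega
            exact lt_of_mul_lt_mul_left this (by omega)
          have hik : (i : ℝ) * κ ≤ 1 / 2 := by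
            have : (i : ℝ) ≤ I := by exact_mod_cast hiI.le
            nlinarith
          have := key h0 hh0'.1 i (by rw [← hi']; exact hh'.1) hik
          rw [← le_div_iff₀ hpos] at this
          simp only [Finset.mem_image, Finset.mem_range]
          exact ⟨i, Nat.lt_succ_of_le (Nat.le_floor this), hi'.symm⟩
        calc S.card ≤ _ := Finset.card_le_card this
          _ ≤ _ := Finset.card_image_le
          _ = F := Finset.card_range F
      · rw [Finset.not_nonempty_iff_eq_empty] at hne
        rw [hne]; simp
  rw [Finset.card_product, Finset.card_range, Finset.card_range] at hcount
  have hcR : (G.card : ℝ) ≤ F * ((n / (q * I) + 1) * q) := by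
    have h7 : ((n / (q * I) : ℕ) : ℝ) ≤ n / (q * I) := by
      have := @Nat.cast_div_le ℝ _ _ _ n (q * I); push_cast at this; exact this
    calc (G.card : ℝ) ≤ ((F * ((n / (q * I) + 1) * q) : ℕ) : ℝ) := by exact_mod_cast hcount
      _ = F * ((((n / (q * I) : ℕ) : ℝ) + 1) * q) := by push_cast; ring
      _ ≤ _ := by gcongr
  have hIpos : (0 : ℝ) < I := by exact_mod_cast hI1
  have hqpos : (0 : ℝ) < q := by exact_mod_cast hq1
  have hnI : (n : ℝ) / (q * I) * q ≤ 4 * κ * n := by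
    rw [show (n : ℝ) / (q * I) * q = n / I by field_simp, div_le_iff₀ hIpos]
    have : (0 : ℝ) ≤ n := by positivity
    nlinarith
  have hcard' : (n : ℝ) ≤ G.card * W := by exact_mod_cast hcard
  have hq2R : (q : ℝ) ≤ 2 * W := by exact_mod_cast hq2
  have h8 : (n : ℝ) * κ ≤ 4 * ε * (4 * κ * n + 2 * W) * W := by
    calc (n : ℝ) * κ ≤ (F * ((n / (q * I) + 1) * q)) * W * κ := by
          have := hcard'.trans (mul_le_mul_of_nonneg_right hcR (by positivity : (0 : ℝ) ≤ W))
          exact mul_le_mul_of_nonneg_right this hpos.le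
      _ = (F * κ) * (n / (q * I) * q + q) * W := by ring
      _ ≤ _ := by gcongr
  have h9 : 4 * ε * (4 * κ * n) * W ≤ (κ * n) / 2 := by
    have : 0 ≤ κ * n := by positivity
    nlinarith
  nlinarith

lemma norm_sq_sum_unimodular (a : ℕ → ℂ) (ha : ∀ j, ‖a j‖ = 1) (n : ℕ) :
    ‖∑ j ∈ Finset.range n, a j‖ ^ 2 = n + 2 * (∑ h ∈ Finset.range n,
      ∑ j ∈ Finset.range (n - (h + 1)), a (j + (h + 1)) * conj (a j)).re := by
  induction n with
  | zero => simp
  | succ n ih =>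
    rw [Finset.sum_range_succ]
    have h1 : ∑ h ∈ Finset.range (n + 1),
        ∑ j ∈ Finset.range (n + 1 - (h + 1)), a (j + (h + 1)) * conj (a j)
        = (∑ h ∈ Finset.range n,
          ∑ j ∈ Finset.range (n - (h + 1)), a (j + (h + 1)) * conj (a j))
          + a n * conj (∑ j ∈ Finset.range n, a j) := by
      rw [Finset.sum_range_succ, Nat.sub_self, Finset.sum_range_zero, add_zero, map_sum,
        Finset.mul_sum, ← Finset.sum_range_reflect (fun j => a n * conj (a j)),
        ← Finset.sum_add_distrib]
      refine Finset.sum_congr rfl fun h hh => ?_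
      rw [Finset.mem_range] at hh
      rw [show n + 1 - (h + 1) = (n - (h + 1)) + 1 by omega, Finset.sum_range_succ]
      rw [show n - (h + 1) + (h + 1) = n by omega, show n - 1 - h = n - (h + 1) by omega]
    rw [h1, Complex.add_re, ← Complex.normSq_eq_norm_sq, Complex.normSq_add,
      Complex.normSq_eq_norm_sq, ih, Complex.normSq_eq_norm_sq, ha]
    have h2 : ((∑ j ∈ Finset.range n, a j) * conj (a n)).re
        = (a n * conj (∑ j ∈ Finset.range n, a j)).re := by
      rw [← Complex.conj_re]; simp [mul_comm]
    rw [h2]; push_cast; ring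

lemma norm_sq_sum_unimodular_le (a : ℕ → ℂ) (ha : ∀ j, ‖a j‖ = 1) (n : ℕ) :
    ‖∑ j ∈ Finset.range n, a j‖ ^ 2 ≤ n + 2 * ∑ h ∈ Finset.range n,
      ‖∑ j ∈ Finset.range (n - (h + 1)), a (j + (h + 1)) * conj (a j)‖ := by
  rw [norm_sq_sum_unimodular a ha]
  gcongr
  exact (Complex.re_le_norm _).trans (norm_sum_le _ _)

open Polynomial in
lemma natDegree_taylor_sub_le (P : ℝ[X]) (d : ℕ) (hP : P.natDegree ≤ d + 1) (h : ℝ) :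
    (taylor h P - P).natDegree ≤ d ∧ (taylor h P - P).coeff d = (d + 1) * h * P.coeff (d + 1) := by
  have hc : ∀ i, d ≤ i → (taylor h P).coeff i = P.coeff i + (i + 1) * h * P.coeff (i + 1) := by
    intro i hi
    have hdeg : (hasseDeriv i P).natDegree ≤ 1 :=
      (natDegree_hasseDeriv_le P i).trans (by omega)
    rw [taylor_coeff, eval_eq_sum_range' (n := 2) (by omega)]
    simp only [Finset.sum_range_succ, Finset.sum_range_zero, hasseDeriv_coeff]
    simp [Nat.add_comm 1 i, Nat.choose_succ_self_right]
    ring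
  refine ⟨?_, ?_⟩
  · rw [natDegree_le_iff_coeff_eq_zero]
    intro N hN
    rw [coeff_sub, hc N hN.le, coeff_eq_zero_of_natDegree_lt (n := N + 1) (by omega)]
    ring
  · rw [coeff_sub, hc d le_rfl]; ring

open Polynomial in
theorem weyl_inverse (d : ℕ) : ∃ K A : ℕ, 1 ≤ K ∧ ∀ Q : ℕ, 1 ≤ Q → ∀ n : ℕ, 1 ≤ n →
    ∀ P : ℝ[X], P.natDegree ≤ d + 1 →
    (n : ℝ) ≤ Q * ‖∑ j ∈ Finset.range n, e (P.eval (j : ℝ))‖ →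
    ∃ q : ℕ, 1 ≤ q ∧ q ≤ K * Q ^ A ∧ ∃ p : ℤ,
      |q * P.coeff (d + 1) - p| * (n : ℝ) ^ (d + 1) ≤ K * (Q : ℝ) ^ A := by
  induction d with
  | zero =>
    refine ⟨1, 1, le_rfl, fun Q hQ n hn P hP hS => ⟨1, le_rfl, by simpa using hQ, ?_⟩⟩
    refine ⟨round (P.coeff 1), ?_⟩
    have h1 : ∀ j : ℕ, P.eval (j : ℝ) = P.coeff 1 * j + P.coeff 0 := fun j => by
      conv_lhs => rw [eq_X_add_C_of_natDegree_le_one hP]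
      simp
    simp only [h1] at hS
    have h2 := norm_sum_e_linear (P.coeff 1) (P.coeff 0) n
    have h3 := abs_nonneg (P.coeff 1 - round (P.coeff 1))
    simp only [zero_add, pow_one, Nat.cast_one, one_mul]
    have h4 := mul_le_mul_of_nonneg_left hS h3
    have h5 : (1 : ℝ) ≤ Q := by exact_mod_cast hQ
    nlinarith
  | succ d ih =>
    obtain ⟨K, A, hK, ih⟩ := ih
    set m := 2 * A + d + 2 with hm
    refine ⟨(d + 2) * (32 * K ^ 2 * 8 ^ m) ^ (d + 2), 2 * m * (d + 2),
      Nat.mul_pos (by omega) (by positivity), fun Q hQ n hn P hP hS => ?_⟩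
    set Q' := 8 * Q ^ 2 with hQ'
    set R := K * Q' ^ A with hR
    set B := 32 * Q' * R ^ 2 * Q' ^ (d + 1) with hB
    have hbound : (d + 2) * (32 * K ^ 2 * 8 ^ m) ^ (d + 2) * Q ^ (2 * m * (d + 2))
        = (d + 2) * B ^ (d + 2) := by
      have : B = 32 * K ^ 2 * 8 ^ m * Q ^ (2 * m) := by
        rw [hB, hR, mul_pow, ← pow_mul, show 32 * Q' * (K ^ 2 * Q' ^ (A * 2)) * Q' ^ (d + 1)
          = 32 * K ^ 2 * Q' ^ m by rw [hm]; ring, hQ', mul_pow, ← pow_mul]; ring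
      rw [this, mul_pow _ (Q ^ _), ← pow_mul, mul_assoc]
    have hboundR : (((d + 2) * (32 * K ^ 2 * 8 ^ m) ^ (d + 2) : ℕ) : ℝ)
        * (Q : ℝ) ^ (2 * m * (d + 2))
        = (d + 2) * (B : ℝ) ^ (d + 2) := by exact_mod_cast hbound
    rw [hbound, hboundR]
    have hQ'1 : 1 ≤ Q' := Nat.mul_pos (by norm_num) (by positivity)
    have hR1 : 1 ≤ R := Nat.mul_pos hK (by positivity)
    have hB1 : 1 ≤ B := Nat.mul_pos (Nat.mul_pos (Nat.mul_pos (by norm_num) hQ'1)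
      (pow_pos hR1 _)) (pow_pos hQ'1 _)
    have hBR : (1 : ℝ) ≤ B := by exact_mod_cast hB1
    have hRR : (1 : ℝ) ≤ R := by exact_mod_cast hR1
    have hQR : (1 : ℝ) ≤ Q' := by exact_mod_cast hQ'1
    have hnR : (1 : ℝ) ≤ n := by exact_mod_cast hn
    have hBexp : (B : ℝ) = 32 * Q' * R ^ 2 * Q' ^ (d + 1) := by rw [hB]; push_cast; ring
    rcases lt_or_ge n B with hnB | hnB
    · refine ⟨1, le_rfl, Nat.mul_pos (by omega) (by positivity), round (P.coeff (d + 1 + 1)), ?_⟩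
      rw [Nat.cast_one, one_mul]
      have h1 := abs_sub_round (P.coeff (d + 1 + 1))
      have h2 : (n : ℝ) ^ (d + 2) ≤ (B : ℝ) ^ (d + 2) := by gcongr
      calc _ ≤ 1 * (B : ℝ) ^ (d + 2) := by
            gcongr
            linarith
        _ ≤ _ := by
            gcongr
            have : (0 : ℝ) ≤ d := by positivity
            linarith
    set T : ℕ → ℂ := fun h => ∑ j ∈ Finset.range (n - h),
      e ((taylor (h : ℝ) P - P).eval (j : ℝ)) with hT
    have hTle : ∀ h, ‖T h‖ ≤ (n - h : ℕ) := fun h => by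
      refine (norm_sum_le _ _).trans ?_
      simp [norm_e]
    have hdiff : ‖∑ j ∈ Finset.range n, e (P.eval (j : ℝ))‖ ^ 2
        ≤ n + 2 * ∑ h ∈ Finset.range n, ‖T (h + 1)‖ := by
      refine (norm_sq_sum_unimodular_le _ (fun j => norm_e _) n).trans (le_of_eq ?_)
      congr 2
      refine Finset.sum_congr rfl fun h _ => ?_
      congr 1
      refine Finset.sum_congr rfl fun j _ => ?_
      rw [conj_e, ← e_add, eval_sub, taylor_eval]
      push_cast; ring_nf
    set H := (Finset.range n).filter fun h => (n : ℝ) ≤ Q' * ‖T (h + 1)‖ with hH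
    have hQ'R : (Q' : ℝ) = 8 * (Q : ℝ) ^ 2 := by rw [hQ']; push_cast; ring
    have hHcard : (n : ℝ) ≤ H.card * Q' := by
      have h1 : ∑ h ∈ Finset.range n, ‖T (h + 1)‖ ≤ H.card * n + n * (n / Q') := by
        rw [← Finset.sum_filter_add_sum_filter_not _ (fun h => (n : ℝ) ≤ Q' * ‖T (h + 1)‖)]
        refine add_le_add ?_ ?_
        · rw [← nsmul_eq_mul]
          refine Finset.sum_le_card_nsmul _ _ _ fun h _ => (hTle _).trans ?_
          exact_mod_cast Nat.sub_le _ _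
        · refine (Finset.sum_le_card_nsmul _ _ ((n : ℝ) / Q') fun h hh => ?_).trans ?_
          · have := (Finset.mem_filter.1 hh).2
            rw [le_div_iff₀ (by positivity)]; linarith
          · rw [nsmul_eq_mul]
            gcongr
            exact (Finset.card_filter_le _ _).trans (by simp)
      have h2 : (n : ℝ) ^ 2 ≤ (Q : ℝ) ^ 2 * (n + 2 * (H.card * n + n * (n / Q'))) := by
        calc (n : ℝ) ^ 2 ≤ (Q * ‖∑ j ∈ Finset.range n, e (P.eval (j : ℝ))‖) ^ 2 := by gcongr
          _ ≤ _ := by rw [mul_pow]; gcongr; linarith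
      have h3 : (Q : ℝ) ^ 2 * (n / Q') = n / 8 := by
        rw [hQ'R]
        have : (Q : ℝ) ≠ 0 := by positivity
        field_simp
      have h4 : (n : ℝ) * n ≤ n * (Q ^ 2 + 2 * (H.card * Q ^ 2) + n / 4) := by
        linear_combination h2 + 2 * n * h3
      have h5 := le_of_mul_le_mul_left h4 (by linarith)
      have h6 : (32 : ℝ) * Q' ≤ n := by
        have : (B : ℝ) ≤ n := by exact_mod_cast hnB
        have h7 : (32 : ℝ) * Q' * 1 * 1 ≤ B := by
          rw [hBexp]; gcongr
          · exact one_le_pow₀ hRR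
          · exact one_le_pow₀ hQR
        linarith
      rw [hQ'R] at h6 ⊢
      nlinarith
    have hex : ∀ h ∈ H, ∃ q : ℕ, 1 ≤ q ∧ q ≤ R ∧ ∃ p : ℤ,
        |q * ((d + 1 + 1 : ℝ) * (h + 1) * P.coeff (d + 1 + 1)) - p| * (n : ℝ) ^ (d + 1)
          ≤ R * Q' ^ (d + 1) := by
      intro h hh
      have hgood := (Finset.mem_filter.1 hh).2
      have hn1 : (n : ℝ) ≤ Q' * (n - (h + 1) : ℕ) :=
        hgood.trans (mul_le_mul_of_nonneg_left (hTle _) (by positivity))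
      have hpos : 1 ≤ n - (h + 1) := by
        by_contra hcon
        rw [show n - (h + 1) = 0 by omega] at hn1
        simp at hn1; omega
      obtain ⟨hd1, hd2⟩ := natDegree_taylor_sub_le P (d + 1) hP ((h + 1 : ℕ) : ℝ)
      obtain ⟨q, hq1, hq2, p, hp⟩ := ih Q' hQ'1 (n - (h + 1)) hpos _ hd1
        (le_trans (by exact_mod_cast Nat.sub_le _ _) hgood)
      refine ⟨q, hq1, hq2, p, ?_⟩
      rw [hd2] at hp
      push_cast at hp
      have hRcast : (R : ℝ) = K * Q' ^ A := by rw [hR]; push_cast; ring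
      calc _ ≤ |q * ((d + 1 + 1 : ℝ) * (h + 1) * P.coeff (d + 1 + 1)) - p|
              * (Q' * (n - (h + 1) : ℕ)) ^ (d + 1) := by gcongr
        _ = _ * ((n - (h + 1) : ℕ) : ℝ) ^ (d + 1) * Q' ^ (d + 1) := by rw [mul_pow]; ring
        _ ≤ _ := by rw [hRcast]; gcongr
    choose! qf hqf using hex
    obtain ⟨q0, hq0, hfib⟩ : ∃ q0 ∈ Finset.Icc 1 R,
        H.card ≤ R * (H.filter fun h => qf h = q0).card := by
      by_contra! hcon
      have hmaps : ∀ h ∈ H, qf h ∈ Finset.Icc 1 R := fun h hh =>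
        Finset.mem_Icc.2 ⟨(hqf h hh).1, (hqf h hh).2.1⟩
      have h1 := Finset.card_eq_sum_card_fiberwise hmaps
      have h2 : ∑ b ∈ Finset.Icc 1 R, R * (H.filter fun h => qf h = b).card
          < ∑ b ∈ Finset.Icc 1 R, H.card :=
        Finset.sum_lt_sum_of_nonempty (Finset.nonempty_Icc.2 hR1) hcon
      rw [← Finset.mul_sum, ← h1, Finset.sum_const, Nat.card_Icc] at h2
      simp at h2
    set G := (H.filter fun h => qf h = q0).image (· + 1) with hGdef
    have hGcard : G.card = (H.filter fun h => qf h = q0).card :=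
      Finset.card_image_of_injective _ (add_left_injective 1)
    have hq0' := Finset.mem_Icc.1 hq0
    have hnpos : (0 : ℝ) < (n : ℝ) ^ (d + 1) := by positivity
    have hBn : (B : ℝ) ≤ n := by exact_mod_cast hnB
    have hnpow : (n : ℝ) ≤ (n : ℝ) ^ (d + 1) := le_self_pow₀ hnR (by omega)
    obtain ⟨q, hq1, hq2, p, hp⟩ := exists_nat_mul_near_int (n := n) (W := Q' * R)
      (β := q0 * ((d + 1 + 1 : ℝ) * P.coeff (d + 1 + 1)))
      (ε := R * Q' ^ (d + 1) / (n : ℝ) ^ (d + 1))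
      (Nat.mul_pos hQ'1 hR1) (by
        refine lt_of_lt_of_le ?_ hnB
        have h1 : 1 ≤ R := hR1
        have h2 : 1 ≤ Q' ^ (d + 1) := Nat.one_le_pow _ _ hQ'1
        calc 2 * (Q' * R) < 32 * (Q' * R) := by
              have : 0 < Q' * R := Nat.mul_pos hQ'1 hR1
              omega
          _ = 32 * Q' * (R * 1) * 1 := by ring
          _ ≤ 32 * Q' * (R * R) * Q' ^ (d + 1) := by gcongr
          _ = B := by rw [hB]; ring)
      (by positivity) (by
        rw [div_mul_eq_mul_div, div_le_one hnpos]
        push_cast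
        calc _ = (B : ℝ) := by rw [hBexp]; ring
          _ ≤ _ := hBn.trans hnpow)
      G (by
        intro h hh
        obtain ⟨h', hh', rfl⟩ := Finset.mem_image.1 hh
        have hh'' := (Finset.mem_filter.1 hh').1
        have hgood := (Finset.mem_filter.1 hh'').2
        by_contra hcon
        have : T (h' + 1) = 0 := by
          rw [hT]; simp only; rw [show n - (h' + 1) = 0 by omega]; simp
        rw [this] at hgood
        simp at hgood; omega) (by
        rw [hGcard]
        have h1 : n ≤ H.card * Q' := by exact_mod_cast hHcard
        calc n ≤ H.card * Q' := h1
          _ ≤ (R * (H.filter fun h => qf h = q0).card) * Q' := Nat.mul_le_mul_right _ hfib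
          _ = _ := by ring) (by
        intro h hh
        obtain ⟨h', hh', rfl⟩ := Finset.mem_image.1 hh
        obtain ⟨hh'', hq'⟩ := Finset.mem_filter.1 hh'
        obtain ⟨p, hp⟩ := (hqf h' hh'').2.2
        refine ⟨p, ?_⟩
        rw [le_div_iff₀ hnpos]
        rw [hq'] at hp
        refine le_trans (le_of_eq ?_) hp
        push_cast; ring_nf)
    refine ⟨q * q0 * (d + 2), Nat.mul_pos (Nat.mul_pos hq1 hq0'.1) (by omega), ?_, p, ?_⟩
    · calc q * q0 * (d + 2) ≤ (2 * (Q' * R)) * R * (d + 2) := by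
            gcongr; exact hq0'.2
        _ = (d + 2) * (2 * Q' * R ^ 2 * 1) := by ring
        _ ≤ (d + 2) * (32 * Q' * R ^ 2 * Q' ^ (d + 1)) := by
            gcongr
            · norm_num
            · exact Nat.one_le_pow _ _ hQ'1
        _ = (d + 2) * B ^ 1 := by rw [hB, pow_one]
        _ ≤ _ := by gcongr; omega
    · rw [mul_div_assoc', le_div_iff₀ hnpos] at hp
      push_cast at hp ⊢
      calc _ = |q * (q0 * ((d + 1 + 1 : ℝ) * P.coeff (d + 1 + 1))) - p| * n * n ^ (d + 1) := by
            rw [pow_succ (n : ℝ) (d + 1)]; ring_nf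
        _ ≤ _ := hp
        _ = 16 * Q' ^ 2 * R ^ 3 * Q' ^ (d + 1) * 1 := by ring
        _ ≤ 1024 * Q' ^ 2 * R ^ 4 * Q' ^ (d + 1) * Q' ^ (d + 1) := by
            gcongr <;> first | exact one_le_pow₀ hQR | assumption | norm_num
        _ = (B : ℝ) ^ 2 := by rw [hBexp]; ring
        _ ≤ 1 * (B : ℝ) ^ (d + 2) := by rw [one_mul]; gcongr; omega
        _ ≤ _ := by
            gcongr
            have : (0 : ℝ) ≤ d := by positivity
            linarith

open MeasureTheory

/-- One step of the (unnormalized) Szegő recursion. -/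
def szegoStep (α z : ℂ) : Matrix (Fin 2) (Fin 2) ℂ := !![z, -conj α; -α * z, 1]

/-- Products of Szegő steps. -/
def szegoProd (β : ℕ → ℂ) (z : ℂ) : ℕ → Matrix (Fin 2) (Fin 2) ℂ
  | 0 => 1
  | n + 1 => szegoStep (β n) z * szegoProd β z n

lemma szegoProd_add (β : ℕ → ℂ) (z : ℂ) (m n : ℕ) :
    szegoProd β z (m + n) = szegoProd (fun j => β (m + j)) z n * szegoProd β z m := by
  induction n with
  | zero => simp [szegoProd]
  | succ n ih => rw [← add_assoc, szegoProd, ih, szegoProd, Matrix.mul_assoc]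

lemma szegoProd_succ' (β : ℕ → ℂ) (z : ℂ) (n : ℕ) :
    szegoProd β z (n + 1) = szegoProd (fun j => β (j + 1)) z n * szegoStep (β 0) z := by
  rw [add_comm n 1, szegoProd_add]
  simp [szegoProd, add_comm 1]

lemma szegoProd_succ_apply_zero (β : ℕ → ℂ) (z : ℂ) (n : ℕ) (i : Fin 2) :
    szegoProd β z (n + 1) 0 i
      = z * szegoProd β z n 0 i - conj (β n) * szegoProd β z n 1 i := by
  simp [szegoProd, szegoStep, Matrix.mul_apply, Fin.sum_univ_two]; ring

lemma szegoProd_succ_apply_one (β : ℕ → ℂ) (z : ℂ) (n : ℕ) (i : Fin 2) :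
    szegoProd β z (n + 1) 1 i
      = szegoProd β z n 1 i - β n * z * szegoProd β z n 0 i := by
  simp [szegoProd, szegoStep, Matrix.mul_apply, Fin.sum_univ_two]; ring

lemma szegoProd_succ'_one_zero (β : ℕ → ℂ) (z : ℂ) (n : ℕ) :
    szegoProd β z (n + 1) 1 0 = z * (szegoProd (fun j => β (j + 1)) z n 1 0
      - β 0 * szegoProd (fun j => β (j + 1)) z n 1 1) := by
  simp [szegoProd_succ', szegoStep, Matrix.mul_apply, Fin.sum_univ_two]; ring

lemma szegoProd_succ'_one_one (β : ℕ → ℂ) (z : ℂ) (n : ℕ) :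
    szegoProd β z (n + 1) 1 1 = szegoProd (fun j => β (j + 1)) z n 1 1
      - conj (β 0) * szegoProd (fun j => β (j + 1)) z n 1 0 := by
  simp [szegoProd_succ', szegoStep, Matrix.mul_apply, Fin.sum_univ_two]; ring

lemma normSq_sub_conj_mul (α f g : ℂ) :
    ‖g - α * f‖ ^ 2 - ‖f - conj α * g‖ ^ 2 = (1 - ‖α‖ ^ 2) * (‖g‖ ^ 2 - ‖f‖ ^ 2) := by
  simp only [← Complex.normSq_eq_norm_sq, Complex.normSq_apply]
  simp; ring

section column
variable {β : ℕ → ℂ} {a : ℝ} (hβ : ∀ j, ‖β j‖ = a)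
include hβ

lemma norm_sq_column_eq {z : ℂ} (hz : ‖z‖ = 1) (i : Fin 2) (n : ℕ) :
    ‖szegoProd β z n 1 i‖ ^ 2 - ‖szegoProd β z n 0 i‖ ^ 2
      = (1 - a ^ 2) ^ n * (‖(1 : Matrix (Fin 2) (Fin 2) ℂ) 1 i‖ ^ 2
        - ‖(1 : Matrix (Fin 2) (Fin 2) ℂ) 0 i‖ ^ 2) := by
  induction n with
  | zero => simp [szegoProd]
  | succ n ih =>
    rw [szegoProd_succ_apply_zero, szegoProd_succ_apply_one, mul_assoc, normSq_sub_conj_mul, hβ,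
      norm_mul, hz, one_mul, ih]; ring

lemma norm_sq_col_one_eq {z : ℂ} (hz : ‖z‖ = 1) (n : ℕ) :
    ‖szegoProd β z n 1 1‖ ^ 2 - ‖szegoProd β z n 0 1‖ ^ 2 = (1 - a ^ 2) ^ n := by
  rw [norm_sq_column_eq hβ hz]; simp

lemma norm_zero_one_lt (ha : a < 1) {z : ℂ} (hz : ‖z‖ ≤ 1) (n : ℕ) :
    ‖szegoProd β z n 0 1‖ < ‖szegoProd β z n 1 1‖ := by
  have ha0 : 0 ≤ a := by rw [← hβ 0]; positivity
  induction n with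
  | zero => simp [szegoProd]
  | succ n ih =>
    have h := normSq_sub_conj_mul (β n) (z * szegoProd β z n 0 1) (szegoProd β z n 1 1)
    rw [szegoProd_succ_apply_zero, szegoProd_succ_apply_one, mul_assoc]
    rw [hβ, norm_mul] at h
    have h1 : ‖z‖ * ‖szegoProd β z n 0 1‖ < ‖szegoProd β z n 1 1‖ :=
      (mul_le_of_le_one_left (norm_nonneg _) hz).trans_lt ih
    have h2 : (‖z‖ * ‖szegoProd β z n 0 1‖) ^ 2 < ‖szegoProd β z n 1 1‖ ^ 2 := by gcongr
    have h3 : 0 < 1 - a ^ 2 := by nlinarith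
    have h4 := mul_pos h3 (sub_pos.2 h2)
    rw [← h] at h4
    exact lt_of_pow_lt_pow_left₀ 2 (norm_nonneg _) (by linarith)

lemma norm_one_zero_lt (ha : a < 1) {z : ℂ} (hz : ‖z‖ ≤ 1) (n : ℕ) :
    ‖szegoProd β z n 1 0‖ < ‖szegoProd β z n 1 1‖ := by
  have ha0 : 0 ≤ a := by rw [← hβ 0]; positivity
  induction n generalizing β with
  | zero => simp [szegoProd]
  | succ n ih =>
    have ih := ih (β := fun j => β (j + 1)) fun j => hβ _
    set C := szegoProd (fun j => β (j + 1)) z n 1 0 with hC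
    set D := szegoProd (fun j => β (j + 1)) z n 1 1 with hD
    rw [szegoProd_succ'_one_zero, szegoProd_succ'_one_one, norm_mul]
    have h := normSq_sub_conj_mul (conj (β 0)) C D
    rw [Complex.conj_conj, RCLike.norm_conj, hβ] at h
    have h2 : ‖C‖ ^ 2 < ‖D‖ ^ 2 := by gcongr
    have h3 : 0 < 1 - a ^ 2 := by nlinarith
    have h4 := mul_pos h3 (sub_pos.2 h2)
    rw [← h] at h4
    refine (mul_le_of_le_one_left (norm_nonneg _) hz).trans_lt ?_
    exact lt_of_pow_lt_pow_left₀ 2 (norm_nonneg _) (by linarith)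

lemma norm_sq_row_one_eq {z : ℂ} (hz : ‖z‖ = 1) (n : ℕ) :
    ‖szegoProd β z n 1 1‖ ^ 2 - ‖szegoProd β z n 1 0‖ ^ 2 = (1 - a ^ 2) ^ n := by
  induction n generalizing β with
  | zero => simp [szegoProd]
  | succ n ih =>
    have ih := ih (β := fun j => β (j + 1)) fun j => hβ _
    have h := normSq_sub_conj_mul (conj (β 0)) (szegoProd (fun j => β (j + 1)) z n 1 0)
      (szegoProd (fun j => β (j + 1)) z n 1 1)
    rw [Complex.conj_conj, RCLike.norm_conj, hβ, ih] at h
    rw [szegoProd_succ'_one_zero, szegoProd_succ'_one_one, norm_mul, hz, one_mul, h]; ring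

lemma one_one_ne_zero (ha : a < 1) {z : ℂ} (hz : ‖z‖ ≤ 1) (n : ℕ) :
    szegoProd β z n 1 1 ≠ 0 := by
  rw [← norm_pos_iff]
  exact (norm_nonneg _).trans_lt (norm_one_zero_lt hβ ha hz n)

lemma norm_entries_le (ha : a < 1) {z : ℂ} (hz : ‖z‖ ≤ 1) (n : ℕ) (i : Fin 2) :
    ‖szegoProd β z n 0 i‖ ≤ 2 ^ n ∧ ‖szegoProd β z n 1 i‖ ≤ 2 ^ n := by
  induction n with
  | zero => simp only [szegoProd, Matrix.one_apply]; constructor <;> split_ifs <;> simp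
  | succ n ih =>
    rw [szegoProd_succ_apply_zero, szegoProd_succ_apply_one, pow_succ]
    have ha0 : 0 ≤ a := by rw [← hβ 0]; positivity
    constructor
    · refine (norm_sub_le _ _).trans ?_
      rw [norm_mul, norm_mul, RCLike.norm_conj, hβ]
      nlinarith [mul_le_mul hz ih.1 (norm_nonneg _) zero_le_one,
        mul_le_mul ha.le ih.2 (norm_nonneg _) zero_le_one]
    · refine (norm_sub_le _ _).trans ?_
      rw [norm_mul, norm_mul, hβ]
      have : a * ‖z‖ ≤ 1 := mul_le_one₀ ha.le (norm_nonneg _) hz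
      nlinarith [mul_le_mul this ih.1 (norm_nonneg _) zero_le_one]

lemma norm_one_one_ge {z : ℂ} (hz : ‖z‖ = 1) (n : ℕ) :
    (1 - a ^ 2) ^ n ≤ ‖szegoProd β z n 1 1‖ ^ 2 := by
  rw [← norm_sq_col_one_eq hβ hz n]
  linarith [sq_nonneg ‖szegoProd β z n 0 1‖]

end column

lemma szegoProd_at_zero (β : ℕ → ℂ) (n : ℕ) :
    szegoProd β 0 n 1 0 = 0 ∧ szegoProd β 0 n 1 1 = 1 := by
  induction n with
  | zero => simp [szegoProd]
  | succ n ih => simp [szegoProd_succ_apply_one, ih.1, ih.2]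

lemma differentiable_szegoProd (β : ℕ → ℂ) (n : ℕ) (i j : Fin 2) :
    Differentiable ℂ fun z => szegoProd β z n i j := by
  have : (Differentiable ℂ fun z => szegoProd β z n 0 j) ∧
      (Differentiable ℂ fun z => szegoProd β z n 1 j) := by
    induction n with
    | zero => simp [szegoProd]
    | succ n ih =>
      have h1 := ih.1
      have h2 := ih.2
      simp only [szegoProd_succ_apply_zero, szegoProd_succ_apply_one]
      exact ⟨by fun_prop, by fun_prop⟩
  fin_cases i
  · exact this.1
  · exact this.2

lemma integral_e_eq_circleAverage {E : Type*} [NormedAddCommGroup E] [NormedSpace ℝ E]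
    (f : ℂ → E) : ∫ t in (0 : ℝ)..1, f (e t) = Real.circleAverage f 0 1 := by
  rw [Real.circleAverage_def]
  have h := intervalIntegral.integral_comp_mul_left (a := 0) (b := 1)
    (fun θ => f (circleMap 0 1 θ)) (c := 2 * Real.pi) (by positivity)
  rw [mul_zero, mul_one] at h
  rw [← h]
  refine intervalIntegral.integral_congr fun t _ => ?_
  simp only [circleMap_zero, e_eq_exp_mul_I]
  simp

lemma integral_log_norm_e {F : ℂ → ℂ} (hF : Differentiable ℂ F)
    (h0 : ∀ z, ‖z‖ ≤ 1 → F z ≠ 0) (h1 : F 0 = 1) : ∫ t in (0 : ℝ)..1, Real.log ‖F (e t)‖ = 0 := by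
  rw [integral_e_eq_circleAverage fun z => Real.log ‖F z‖]
  rw [InnerProductSpace.HarmonicOnNhd.circleAverage_eq]
  · simp [h1]
  · intro z hz
    refine AnalyticAt.harmonicAt_log_norm (hF.analyticAt z) (h0 z ?_)
    simpa using hz

/-- `log |D|` for the lower right entry of the Szegő product. -/
def logD (β : ℕ → ℂ) (m : ℕ) (t : ℝ) : ℝ := Real.log ‖szegoProd β (e t) m 1 1‖

/-- The defect of additivity of `logD` under concatenation. -/
def mergeLoss (β : ℕ → ℂ) (m n : ℕ) (t : ℝ) : ℝ :=
  logD β m t + logD (fun j => β (m + j)) n t - logD β (m + n) t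

section
variable {β : ℕ → ℂ} {a : ℝ} (hβ : ∀ j, ‖β j‖ = a) (ha : a < 1)
include hβ ha

lemma integral_logD (m : ℕ) : ∫ t in (0 : ℝ)..1, logD β m t = 0 :=
  integral_log_norm_e (differentiable_szegoProd β m 1 1)
    (fun _ hz => one_one_ne_zero hβ ha hz m) (szegoProd_at_zero β m).2

lemma continuous_logD (m : ℕ) : Continuous (logD β m) := by
  unfold logD
  refine Continuous.log ?_ fun t => ?_
  · exact ((differentiable_szegoProd β m 1 1).continuous.comp continuous_e).norm
  · exact (norm_pos_iff.2 (one_one_ne_zero hβ ha (norm_e t).le m)).ne'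

lemma continuous_mergeLoss (m n : ℕ) : Continuous (mergeLoss β m n) := by
  unfold mergeLoss
  have h1 := continuous_logD hβ ha m
  have h2 := continuous_logD hβ ha (m + n)
  have h3 := continuous_logD (β := fun j => β (m + j)) (fun j => hβ _) ha n
  fun_prop

/-- The perturbation in `D_{m+n} = D_n D_m (1 + κ)`. -/
def mergeKappa (β : ℕ → ℂ) (m n : ℕ) (z : ℂ) : ℂ :=
  (szegoProd (fun j => β (m + j)) z n 1 0 / szegoProd (fun j => β (m + j)) z n 1 1)
    * (szegoProd β z m 0 1 / szegoProd β z m 1 1)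

lemma norm_mergeKappa_lt {z : ℂ} (hz : ‖z‖ ≤ 1) (m n : ℕ) : ‖mergeKappa β m n z‖ < 1 := by
  have hβ' : ∀ j, ‖(fun j => β (m + j)) j‖ = a := fun j => hβ _
  have h1 := norm_one_zero_lt hβ' ha hz n
  have h2 := norm_zero_one_lt hβ ha hz m
  rw [mergeKappa, norm_mul, norm_div, norm_div]
  have p1 := norm_pos_iff.2 (one_one_ne_zero hβ' ha hz n)
  have p2 := norm_pos_iff.2 (one_one_ne_zero hβ ha hz m)
  rw [div_mul_div_comm, div_lt_one (by positivity)]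
  nlinarith [norm_nonneg (szegoProd (fun j => β (m + j)) z n 1 0),
    norm_nonneg (szegoProd β z m 0 1)]

lemma one_one_add {z : ℂ} (hz : ‖z‖ ≤ 1) (m n : ℕ) :
    szegoProd β z (m + n) 1 1 = szegoProd (fun j => β (m + j)) z n 1 1 * szegoProd β z m 1 1
      * (1 + mergeKappa β m n z) := by
  have h1 := one_one_ne_zero (β := fun j => β (m + j)) (fun j => hβ _) ha hz n
  have h2 := one_one_ne_zero hβ ha hz m
  rw [szegoProd_add, Matrix.mul_apply, Fin.sum_univ_two, mergeKappa]
  field_simp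
  ring

lemma one_add_mergeKappa_re_pos {z : ℂ} (hz : ‖z‖ ≤ 1) (m n : ℕ) :
    0 < (1 + mergeKappa β m n z).re := by
  have := norm_mergeKappa_lt hβ ha hz m n
  have h2 := (abs_le.1 (Complex.abs_re_le_norm (mergeKappa β m n z))).1
  simp; linarith

lemma mergeLoss_eq (m n : ℕ) (t : ℝ) :
    mergeLoss β m n t = -Real.log ‖1 + mergeKappa β m n (e t)‖ := by
  have hz := (norm_e t).le
  have h1 := norm_pos_iff.2 (one_one_ne_zero (β := fun j => β (m + j)) (fun j => hβ _) ha hz n)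
  have h2 := norm_pos_iff.2 (one_one_ne_zero hβ ha hz m)
  have h3 : 0 < ‖1 + mergeKappa β m n (e t)‖ := by
    rw [norm_pos_iff]; intro h
    have := one_add_mergeKappa_re_pos hβ ha hz m n
    rw [h] at this; simp at this
  rw [mergeLoss, logD, logD, logD, one_one_add hβ ha hz, norm_mul, norm_mul,
    Real.log_mul (by positivity) (by positivity), Real.log_mul (by positivity) (by positivity)]
  ring

lemma neg_log_two_le_mergeLoss (m n : ℕ) (t : ℝ) : -Real.log 2 ≤ mergeLoss β m n t := by
  have hz := (norm_e t).le
  have h1 := norm_mergeKappa_lt hβ ha hz m n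
  rw [mergeLoss_eq hβ ha, neg_le_neg_iff]
  rcases (norm_nonneg (1 + mergeKappa β m n (e t))).eq_or_lt with h | h
  · rw [← h]; simp; positivity
  · refine Real.log_le_log h ((norm_add_le _ _).trans ?_)
    simp; linarith

lemma logD_add_le (m n : ℕ) (t : ℝ) :
    logD β (m + n) t ≤ logD β m t + logD (fun j => β (m + j)) n t + Real.log 2 := by
  have := neg_log_two_le_mergeLoss hβ ha m n t
  rw [mergeLoss] at this; linarith

lemma integral_exp_mergeLoss_le (m n : ℕ) :
    ∫ t in (0 : ℝ)..1, Real.exp (mergeLoss β m n t / 2) ≤ Real.sqrt 2 := by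
  set F : ℂ → ℂ := fun z => (1 + mergeKappa β m n z) ^ (-(1 / 2 : ℂ)) with hF
  have hdiff : DiffContOnCl ℂ F (Metric.ball 0 |1|) := by
    have : ∀ z ∈ closure (Metric.ball (0 : ℂ) |1|), DifferentiableAt ℂ F z := by
      intro z hz
      rw [abs_one, closure_ball _ one_ne_zero, mem_closedBall_zero_iff] at hz
      have d1 := (differentiable_szegoProd (fun j => β (m + j)) n 1 0) z
      have d2 := (differentiable_szegoProd (fun j => β (m + j)) n 1 1) z
      have d3 := (differentiable_szegoProd β m 0 1) z
      have d4 := (differentiable_szegoProd β m 1 1) z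
      have n1 := one_one_ne_zero (β := fun j => β (m + j)) (fun j => hβ _) ha hz n
      have n2 := one_one_ne_zero hβ ha hz m
      refine DifferentiableAt.cpow ?_ (differentiableAt_const _)
        (Or.inl (one_add_mergeKappa_re_pos hβ ha hz m n))
      unfold mergeKappa
      exact ((d1.div d2 n1).mul (d3.div d4 n2)).const_add 1
    exact ⟨fun z hz => (this z (subset_closure hz)).differentiableWithinAt,
      fun z hz => (this z hz).continuousAt.continuousWithinAt⟩
  have hmean : ∫ t in (0 : ℝ)..1, F (e t) = 1 := by
    rw [integral_e_eq_circleAverage, hdiff.circleAverage]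
    simp [hF, mergeKappa, (szegoProd_at_zero (fun j => β (m + j)) n).1]
  have hcontF : Continuous fun t => F (e t) := by
    have h := hdiff.continuousOn
    rw [abs_one, closure_ball _ one_ne_zero] at h
    exact h.comp_continuous continuous_e fun t => by simp [norm_e]
  have hpt : ∀ t : ℝ, Real.exp (mergeLoss β m n t / 2) ≤ Real.sqrt 2 * (F (e t)).re := by
    intro t
    set w := 1 + mergeKappa β m n (e t) with hw
    have hre : 0 < w.re := one_add_mergeKappa_re_pos hβ ha (norm_e t).le m n
    have hw0 : w ≠ 0 := by intro h; rw [h] at hre; simp at hre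
    have hwn := norm_pos_iff.2 hw0
    have hexp : F (e t)
        = Complex.exp ((-(Real.log ‖w‖ / 2) : ℝ) + (-(w.arg / 2) : ℝ) * Complex.I) := by
      rw [hF]; simp only; rw [← hw, Complex.cpow_def_of_ne_zero hw0, Complex.log]
      congr 1; push_cast; ring
    have harg : |w.arg| < Real.pi / 2 := Complex.abs_arg_lt_pi_div_two_iff.2 (Or.inl hre)
    have hcos : Real.sqrt 2 / 2 ≤ Real.cos (-(w.arg / 2)) := by
      rw [← Real.cos_pi_div_four, Real.cos_neg, ← Real.cos_abs (w.arg / 2)]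
      have h2 : |w.arg / 2| = |w.arg| / 2 := by rw [abs_div, abs_two]
      exact Real.cos_le_cos_of_nonneg_of_le_pi (abs_nonneg _)
        (by linarith [Real.pi_pos]) (by rw [h2]; linarith)
    rw [hexp, Complex.exp_re, mergeLoss_eq hβ ha, ← hw]
    simp only [Complex.add_re, Complex.add_im, Complex.ofReal_re, Complex.ofReal_im,
      Complex.re_ofReal_mul, Complex.im_ofReal_mul, Complex.I_re, Complex.I_im, mul_zero, mul_one,
      add_zero, zero_add]
    rw [show -Real.log ‖w‖ / 2 = -(Real.log ‖w‖ / 2) by ring]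
    have h2 : Real.sqrt 2 * Real.sqrt 2 = 2 := Real.mul_self_sqrt zero_le_two
    have h3 := mul_le_mul_of_nonneg_left hcos (Real.sqrt_nonneg 2)
    have h4 := (Real.exp_pos (-(Real.log ‖w‖ / 2))).le
    nlinarith
  calc ∫ t in (0 : ℝ)..1, Real.exp (mergeLoss β m n t / 2)
      ≤ ∫ t in (0 : ℝ)..1, Real.sqrt 2 * (F (e t)).re := by
        refine intervalIntegral.integral_mono_on zero_le_one ?_ ?_ fun t _ => hpt t
        · have := continuous_mergeLoss hβ ha m n
          exact Continuous.intervalIntegrable (by fun_prop) _ _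
        · exact Continuous.intervalIntegrable
            (continuous_const.mul (Complex.continuous_re.comp hcontF)) _ _
    _ = Real.sqrt 2 * (∫ t in (0 : ℝ)..1, F (e t)).re := by
        rw [intervalIntegral.integral_const_mul]
        congr 1
        exact Complex.reCLM.intervalIntegral_comp_comm (hcontF.intervalIntegrable _ _)
    _ = Real.sqrt 2 := by rw [hmean]; simp

end

/-- The Fejér kernel. -/
def fejer (D : ℕ) (θ : ℝ) : ℝ := ‖∑ l ∈ Finset.range D, e (l * θ)‖ ^ 2 / D

lemma fejer_nonneg (D : ℕ) (θ : ℝ) : 0 ≤ fejer D θ := by unfold fejer; positivity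

lemma fejer_eq_sum (D : ℕ) (θ : ℝ) : (fejer D θ : ℂ)
    = (D : ℂ)⁻¹ * ∑ p ∈ Finset.range D ×ˢ Finset.range D, e (((p.1 : ℝ) - p.2) * θ) := by
  rw [fejer, Finset.sum_product]
  push_cast
  rw [← Complex.mul_conj', map_sum, Finset.sum_mul_sum, div_eq_inv_mul]
  congr 1
  refine Finset.sum_congr rfl fun i _ => Finset.sum_congr rfl fun j _ => ?_
  rw [conj_e, ← e_add]; ring_nf

lemma sum_e_grid {G : ℕ} (hG : 0 < G) {m : ℤ} (hm : ¬ (G : ℤ) ∣ m) (θ : ℝ) :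
    ∑ g ∈ Finset.range G, e (m * (θ - g / G)) = 0 := by
  have hG' : (G : ℝ) ≠ 0 := by positivity
  have h1 : ∀ g ∈ Finset.range G, e (m * (θ - g / G)) = e (m * θ) * e (-m / G) ^ g := by
    intro g _
    rw [← e_natCast_mul, ← e_add]; ring_nf
  rw [Finset.sum_congr rfl h1, ← Finset.mul_sum]
  have hne : e (-m / G) ≠ 1 := by
    rw [Ne, e_eq_one_iff]
    rintro ⟨n, hn⟩
    apply hm
    refine ⟨-n, ?_⟩
    rw [div_eq_iff hG'] at hn
    have : (m : ℝ) = ((G * -n : ℤ) : ℝ) := by push_cast; linarith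
    exact_mod_cast this
  rw [geom_sum_eq hne, ← e_natCast_mul,
    show ((G : ℝ) * (-m / G)) = ((-m : ℤ) : ℝ) by push_cast; field_simp, e_int]
  simp

lemma sum_fejer_grid {D G : ℕ} (hD : 0 < D) (hG : D ≤ G) (θ : ℝ) :
    ∑ g ∈ Finset.range G, fejer D (θ - g / G) = G := by
  have : ((∑ g ∈ Finset.range G, fejer D (θ - g / G) : ℝ) : ℂ) = G := by
    push_cast
    simp only [fejer_eq_sum]
    rw [← Finset.mul_sum, Finset.sum_comm]
    have h : ∀ p ∈ Finset.range D ×ˢ Finset.range D,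
        ∑ g ∈ Finset.range G, e (((p.1 : ℝ) - p.2) * (θ - g / G))
          = if p.1 = p.2 then (G : ℂ) else 0 := by
      rintro ⟨i, j⟩ hp
      simp only [Finset.mem_product, Finset.mem_range] at hp
      split_ifs with hij
      · simp only at hij; simp [hij, e_zero]
      · have := sum_e_grid (G := G) (by omega) (m := (i : ℤ) - j) (by
          rintro ⟨x, hx⟩
          simp only at hij
          have : x = 0 := by
            by_contra hx0
            have h1 : (G : ℤ) ≤ |(G : ℤ) * x| := by
              rw [abs_mul, Nat.abs_cast]
              exact le_mul_of_one_le_right (by positivity) (Int.one_le_abs hx0)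
            rw [← hx] at h1
            rcases abs_cases ((i : ℤ) - j) with ⟨h2, _⟩ | ⟨h2, _⟩ <;> omega
          rw [this] at hx; omega) θ
        push_cast at this
        exact this
    rw [Finset.sum_congr rfl h, Finset.sum_product]
    have h2 : ∀ x ∈ Finset.range D,
        ∑ y ∈ Finset.range D, (if (x, y).1 = (x, y).2 then (G : ℂ) else 0) = G := by
      intro x hx
      simp only
      rw [Finset.sum_ite_eq, if_pos hx]
    rw [Finset.sum_congr rfl h2]
    have : (D : ℂ) ≠ 0 := by exact_mod_cast hD.ne'
    simp only [Finset.sum_const, Finset.card_range, nsmul_eq_mul]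
    field_simp
  exact_mod_cast this

lemma sum_fejer_mul_sq_grid {D G : ℕ} (hD : 0 < D) (hG : D < G) (θ : ℝ) :
    ∑ g ∈ Finset.range G, fejer D (θ - g / G) * ‖e (θ - g / G) - 1‖ ^ 2 = 2 * G / D := by
  have h1 : ∀ x : ℝ, fejer D x * ‖e x - 1‖ ^ 2 = (2 - 2 * (e (D * x)).re) / D := by
    intro x
    have : (e x - 1) * ∑ l ∈ Finset.range D, e (l * x) = e (D * x) - 1 := by
      simp only [e_natCast_mul]
      exact mul_geom_sum _ _
    rw [fejer, div_mul_eq_mul_div, ← mul_pow, mul_comm ‖_‖, ← norm_mul, this]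
    rw [← Complex.normSq_eq_norm_sq, Complex.normSq_sub, Complex.normSq_eq_norm_sq, norm_e]
    simp
    ring
  simp only [h1]
  rw [← Finset.sum_div, Finset.sum_sub_distrib, ← Finset.mul_sum, ← Complex.re_sum]
  have := sum_e_grid (G := G) (by omega) (m := D) (by
    intro h; have := Int.le_of_dvd (by omega) h; omega) θ
  push_cast at this
  rw [this]
  simp; ring

lemma sum_fejer_mul_grid_le {D G : ℕ} (hD : 0 < D) (hG : D < G) (θ : ℝ) :
    ∑ g ∈ Finset.range G, fejer D (θ - g / G) * ‖e θ - e (g / G)‖ ≤ G * Real.sqrt (2 / D) := by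
  have h0 : ∀ g : ℕ, ‖e θ - e (g / G)‖ = ‖e (θ - g / G) - 1‖ := by
    intro g
    have : e θ - e (g / G) = e (g / G) * (e (θ - g / G) - 1) := by
      rw [mul_sub, ← e_add]; ring_nf
    rw [this, norm_mul, norm_e, one_mul]
  simp only [h0]
  have hcs := Finset.sum_mul_sq_le_sq_mul_sq (Finset.range G)
    (fun g => Real.sqrt (fejer D (θ - g / G)))
    (fun g => Real.sqrt (fejer D (θ - g / G)) * ‖e (θ - g / G) - 1‖)
  simp only [← mul_assoc, mul_pow, Real.mul_self_sqrt (fejer_nonneg _ _),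
    Real.sq_sqrt (fejer_nonneg _ _)] at hcs
  rw [sum_fejer_grid hD hG.le, sum_fejer_mul_sq_grid hD hG] at hcs
  have h2 : ((G : ℝ) * Real.sqrt (2 / D)) ^ 2 = G * (2 * G / D) := by
    rw [mul_pow, Real.sq_sqrt (by positivity)]; ring
  rw [← h2] at hcs
  exact le_of_sq_le_sq hcs (by positivity) 

/-- Product Fejér kernel on a grid. -/
def fejerProd {v : ℕ} (D G : ℕ) (c : Fin v → ℝ) (g : Fin v → ℕ) : ℝ :=
  ∏ i, fejer D (c i - g i / G)

lemma fejerProd_nonneg {v : ℕ} (D G : ℕ) (c : Fin v → ℝ) (g : Fin v → ℕ) :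
    0 ≤ fejerProd D G c g := Finset.prod_nonneg fun _ _ => fejer_nonneg _ _

/-- The grid `{0, …, G-1}^v`. -/
abbrev gridSet (v G : ℕ) : Finset (Fin v → ℕ) := Fintype.piFinset fun _ => Finset.range G

lemma sum_fejerProd {v D G : ℕ} (hD : 0 < D) (hG : D ≤ G) (c : Fin v → ℝ) :
    ∑ g ∈ gridSet v G, fejerProd D G c g = (G : ℝ) ^ v := by
  unfold fejerProd
  rw [← Finset.prod_univ_sum (fun _ => Finset.range G) (fun i x => fejer D (c i - x / G))]
  simp [sum_fejer_grid hD hG]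

lemma sum_fejerProd_mul_le {v D G : ℕ} (hD : 0 < D) (hG : D < G) (c : Fin v → ℝ) (i : Fin v) :
    ∑ g ∈ gridSet v G, fejerProd D G c g * ‖e (c i) - e (g i / G)‖
      ≤ (G : ℝ) ^ v * Real.sqrt (2 / D) := by
  have h : ∀ g ∈ gridSet v G, fejerProd D G c g * ‖e (c i) - e (g i / G)‖
      = ∏ i', (fejer D (c i' - g i' / G) * if i' = i then ‖e (c i') - e (g i' / G)‖ else 1) := by
    intro g _
    rw [Finset.prod_mul_distrib, fejerProd, Finset.prod_ite_eq' Finset.univ i]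
    simp
  rw [Finset.sum_congr rfl h, ← Finset.prod_univ_sum (fun _ => Finset.range G)
    (fun i' x => fejer D (c i' - x / G) * if i' = i then ‖e (c i') - e (x / G)‖ else 1)]
  have h2 : ∀ i' ∈ Finset.univ, ∑ x ∈ Finset.range G,
      (fejer D (c i' - x / G) * if i' = i then ‖e (c i') - e (x / G)‖ else 1)
      ≤ G * (if i' = i then Real.sqrt (2 / D) else 1) := by
    intro i' _
    split_ifs
    · exact sum_fejer_mul_grid_le hD hG _
    · simp [sum_fejer_grid hD hG.le]
  refine (Finset.prod_le_prod (fun i' _ => Finset.sum_nonneg fun x _ =>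
    mul_nonneg (fejer_nonneg _ _) (by split_ifs <;> positivity)) h2).trans (le_of_eq ?_)
  rw [Finset.prod_mul_distrib, Finset.prod_ite_eq' Finset.univ i]
  simp

lemma fejerProd_eq_sum {v : ℕ} (D G : ℕ) (c : Fin v → ℝ) (g : Fin v → ℕ) :
    (fejerProd D G c g : ℂ) = (D : ℂ)⁻¹ ^ v *
      ∑ p ∈ Fintype.piFinset fun _ : Fin v => Finset.range D ×ˢ Finset.range D,
        e (∑ i, (((p i).1 : ℝ) - (p i).2) * c i)
          * e (-∑ i, (((p i).1 : ℝ) - (p i).2) * (g i / G)) := by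
  rw [fejerProd]
  push_cast
  simp only [fejer_eq_sum]
  rw [Finset.prod_mul_distrib, Finset.prod_const, Finset.card_univ, Fintype.card_fin,
    Finset.prod_univ_sum]
  congr 1
  refine Finset.sum_congr rfl fun p _ => ?_
  have hprod : ∀ f : Fin v → ℝ, ∏ i, e (f i) = e (∑ i, f i) := by
    intro f
    simp only [e, ← Complex.exp_sum, ← Finset.mul_sum]
    push_cast; rfl
  rw [hprod, ← e_add, ← Finset.sum_neg_distrib, ← Finset.sum_add_distrib]
  congr 1
  exact Finset.sum_congr rfl fun i _ => by ring

lemma abs_grid_mean_le {φ : ℝ → ℝ} {K : ℝ} (hφ : ∀ s t, |φ s - φ t| ≤ K * |s - t|)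
    (hc : Continuous φ)
    (hItg : ∫ t in (0 : ℝ)..1, φ t = 0) {G : ℕ} (hG : 0 < G) :
    |∑ g ∈ Finset.range G, φ (g / G)| ≤ K := by
  have hGR : (0 : ℝ) < G := by exact_mod_cast hG
  have hK : 0 ≤ K := by have := (abs_nonneg _).trans (hφ 1 0); simpa using this
  have h1 : ∑ g ∈ Finset.range G, ∫ t in ((g : ℕ) / G : ℝ)..((g + 1 : ℕ) / G : ℝ), φ t = 0 := by
    rw [intervalIntegral.sum_integral_adjacent_intervals (a := fun g : ℕ => (g / G : ℝ))]
    · simp only [Nat.cast_zero, zero_div]; rw [div_self hGR.ne', hItg]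
    · exact fun _ _ => hc.intervalIntegrable _ _
  have h2 : ∀ g : ℕ, |∫ t in ((g : ℕ) / G : ℝ)..((g + 1 : ℕ) / G : ℝ), (φ (g / G) - φ t)|
      ≤ K / G * (1 / G) := by
    intro g
    have hlen : ((g + 1 : ℕ) / G : ℝ) - (g : ℕ) / G = 1 / G := by push_cast; ring
    have := intervalIntegral.norm_integral_le_of_norm_le_const (a := ((g : ℕ) / G : ℝ))
      (b := ((g + 1 : ℕ) / G : ℝ)) (f := fun t => φ (g / G) - φ t) (C := K / G) (by
        intro t ht
        rw [Set.uIoc_of_le (by rw [← sub_nonneg, hlen]; positivity)] at ht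
        refine (hφ _ _).trans ?_
        rw [div_eq_mul_one_div K]
        gcongr
        rw [abs_sub_comm, abs_of_nonneg (by linarith [ht.1])]
        linarith [ht.2])
    rw [hlen, abs_of_pos (by positivity)] at this
    exact this
  have h3 : ∑ g ∈ Finset.range G, φ (g / G) = G * ∑ g ∈ Finset.range G,
      ∫ t in ((g : ℕ) / G : ℝ)..((g + 1 : ℕ) / G : ℝ), (φ (g / G) - φ t) := by
    have : ∀ g ∈ Finset.range G, ∫ t in ((g : ℕ) / G : ℝ)..((g + 1 : ℕ) / G : ℝ), (φ (g / G) - φ t)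
        = φ (g / G) / G - ∫ t in ((g : ℕ) / G : ℝ)..((g + 1 : ℕ) / G : ℝ), φ t := by
      intro g _
      rw [intervalIntegral.integral_sub (by simp) (hc.intervalIntegrable _ _),
        intervalIntegral.integral_const, smul_eq_mul]
      push_cast; ring
    rw [Finset.sum_congr rfl this, Finset.sum_sub_distrib, h1, sub_zero, ← Finset.sum_div]
    field_simp
  rw [h3, abs_mul, abs_of_pos hGR]
  calc _ ≤ G * ∑ g ∈ Finset.range G, K / G * (1 / G) := by
        gcongr
        exact (Finset.abs_sum_le_sum_abs _ _).trans (Finset.sum_le_sum fun g _ => h2 g)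
    _ = K := by simp; field_simp

section
variable {w : ℕ} {Λ : (Fin (w + 1) → ℝ) → ℝ} {Lip B : ℝ}
  (hLip : ∀ c c', |Λ c - Λ c'| ≤ Lip * ∑ i, ‖e (c i) - e (c' i)‖)
include hLip

lemma abs_sub_fejer_mean_le (hLip0 : 0 ≤ Lip) {D G : ℕ} (hD : 0 < D) (hG : D < G)
    (c : Fin (w + 1) → ℝ) :
    |(G : ℝ) ^ (w + 1) * Λ c
      - ∑ g ∈ gridSet (w + 1) G, Λ (fun i => g i / G) * fejerProd D G c g|
      ≤ (G : ℝ) ^ (w + 1) * (Lip * ((w + 1) * Real.sqrt (2 / D))) := by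
  rw [← sum_fejerProd hD hG.le c, Finset.sum_mul, ← Finset.sum_sub_distrib]
  calc _ ≤ ∑ g ∈ gridSet (w + 1) G, ∑ i, Lip * (fejerProd D G c g * ‖e (c i) - e (g i / G)‖) := by
        refine (Finset.abs_sum_le_sum_abs _ _).trans (Finset.sum_le_sum fun g _ => ?_)
        rw [mul_comm (Λ _), ← mul_sub, abs_mul, abs_of_nonneg (fejerProd_nonneg _ _ _ _)]
        refine (mul_le_mul_of_nonneg_left (hLip _ _) (fejerProd_nonneg _ _ _ _)).trans (le_of_eq ?_)
        rw [Finset.mul_sum, Finset.mul_sum]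
        exact Finset.sum_congr rfl fun i _ => by ring
    _ = ∑ i, Lip * ∑ g ∈ gridSet (w + 1) G, fejerProd D G c g * ‖e (c i) - e (g i / G)‖ := by
        rw [Finset.sum_comm]
        simp only [Finset.mul_sum]
    _ ≤ ∑ i : Fin (w + 1), Lip * ((G : ℝ) ^ (w + 1) * Real.sqrt (2 / D)) := by
        gcongr with i
        exact sum_fejerProd_mul_le hD hG c i
    _ = _ := by
        rw [sum_fejerProd hD hG.le c]
        simp; ring

lemma norm_grid_coeff_le (hmean : ∀ c, ∫ t in (0 : ℝ)..1, Λ (Fin.cons t c) = 0)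
    {G : ℕ} (hG : 0 < G) (hLip0 : 0 ≤ Lip) (a : Fin (w + 1) → ℝ) (ha : a 0 = 0) :
    ‖∑ g ∈ gridSet (w + 1) G, (Λ (fun i => g i / G) : ℂ) * e (-∑ i, a i * (g i / G))‖
      ≤ (G : ℝ) ^ w * (Lip * (2 * Real.pi)) := by
  have hbij : ∑ g ∈ gridSet (w + 1) G, (Λ (fun i => g i / G) : ℂ) * e (-∑ i, a i * (g i / G))
      = ∑ g ∈ gridSet w G, e (-∑ i : Fin w, a i.succ * (g i / G)) *
        ((∑ x ∈ Finset.range G, Λ (Fin.cons ((x : ℝ) / G) fun i => (g i : ℝ) / G) : ℝ) : ℂ) := by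
    push_cast
    simp only [Finset.mul_sum]
    rw [← Finset.sum_product']
    symm
    refine Finset.sum_bij' (fun p _ => (Fin.cons p.2 p.1 : Fin (w + 1) → ℕ))
      (fun g _ => (fun i : Fin w => g i.succ, g 0)) ?_ ?_ ?_ ?_ ?_
    · rintro ⟨g, x⟩ hp
      simp only [Finset.mem_product, Fintype.mem_piFinset] at hp ⊢
      intro i
      refine Fin.cases ?_ (fun i => ?_) i
      · simpa using hp.2
      · simpa using hp.1 i
    · intro g hg
      simp only [Finset.mem_product, Fintype.mem_piFinset] at hg ⊢
      exact ⟨fun i => hg _, hg _⟩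
    · rintro ⟨g, x⟩ _
      simp
    · intro g _
      exact Fin.cons_self_tail g
    · rintro ⟨g, x⟩ _
      rw [Fin.sum_univ_succ]
      simp only [Fin.cons_zero, Fin.cons_succ, ha, zero_mul, zero_add]
      rw [mul_comm]
      congr 3
      funext i
      refine Fin.cases ?_ (fun i => ?_) i <;> simp
  rw [hbij]
  calc _ ≤ ∑ g ∈ gridSet w G, Lip * (2 * Real.pi) := by
        refine (norm_sum_le _ _).trans (Finset.sum_le_sum fun g _ => ?_)
        rw [norm_mul, norm_e, one_mul, Complex.norm_real, Real.norm_eq_abs]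
        have hl : ∀ s t : ℝ, |Λ (Fin.cons s fun i => (g i : ℝ) / G)
            - Λ (Fin.cons t fun i => (g i : ℝ) / G)| ≤ Lip * (2 * Real.pi) * |s - t| := by
          intro s t
          refine (hLip _ _).trans ?_
          rw [Fin.sum_univ_succ]
          simp only [Fin.cons_zero, Fin.cons_succ, sub_self, norm_zero, Finset.sum_const_zero,
            add_zero]
          rw [mul_assoc]
          gcongr
          exact norm_e_sub_e s t
        refine abs_grid_mean_le hl ?_ (hmean _) hG
        have hl' : LipschitzWith (Lip * (2 * Real.pi)).toNNReal
            (fun t : ℝ => Λ (Fin.cons t fun i => (g i : ℝ) / G)) :=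
          LipschitzWith.of_dist_le_mul fun s t => by
            rw [Real.dist_eq, Real.dist_eq, Real.coe_toNNReal _ (by positivity)]
            exact hl s t
        exact hl'.continuous
    _ = _ := by simp

theorem abs_sum_le_of_char_sums (hLip0 : 0 ≤ Lip) (hB : ∀ c, |Λ c| ≤ B)
    (hmean : ∀ c, ∫ t in (0 : ℝ)..1, Λ (Fin.cons t c) = 0) {D n : ℕ} (hD : 0 < D)
    {δ : ℝ} (hδ : 0 ≤ δ) (c : ℕ → Fin (w + 1) → ℝ)
    (hc : ∀ a : Fin (w + 1) → ℤ, a 0 ≠ 0 → (∀ i, |a i| < D) →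
      ‖∑ j ∈ Finset.range n, e (∑ i, a i * c j i)‖ ≤ δ * n) :
    |∑ j ∈ Finset.range n, Λ (c j)|
      ≤ n * (Lip * ((w + 1) * Real.sqrt (2 / D)) + D ^ (w + 1) * B * δ) := by
  have hB0 : 0 ≤ B := (abs_nonneg _).trans (hB 0)
  set S := ∑ j ∈ Finset.range n, Λ (c j) with hS
  have hDR : (0 : ℝ) < D := by exact_mod_cast hD
  have main : ∀ G : ℕ, D < G → |S| ≤ n * (Lip * ((w + 1) * Real.sqrt (2 / D))
      + D ^ (w + 1) * B * δ) + D ^ (w + 1) * (n * (Lip * (2 * Real.pi))) / G := by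
    intro G hG
    have hGR : (0 : ℝ) < G := by exact_mod_cast (by omega : 0 < G)
    set S' := ∑ j ∈ Finset.range n,
      ∑ g ∈ gridSet (w + 1) G, Λ (fun i => g i / G) * fejerProd D G (c j) g with hS'
    have h1 : |(G : ℝ) ^ (w + 1) * S - S'|
        ≤ n * ((G : ℝ) ^ (w + 1) * (Lip * ((w + 1) * Real.sqrt (2 / D)))) := by
      rw [hS, hS', Finset.mul_sum, ← Finset.sum_sub_distrib]
      refine (Finset.abs_sum_le_sum_abs _ _).trans ((Finset.sum_le_sum fun j _ =>
        abs_sub_fejer_mean_le hLip hLip0 hD hG (c j)).trans (le_of_eq ?_))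
      simp
    set coef : (Fin (w + 1) → ℕ × ℕ) → ℂ := fun p => ∑ g ∈ gridSet (w + 1) G,
      (Λ (fun i => g i / G) : ℂ) * e (-∑ i, (((p i).1 : ℝ) - (p i).2) * (g i / G)) with hcoef
    have h2 : (S' : ℂ) = (D : ℂ)⁻¹ ^ (w + 1) *
        ∑ p ∈ Fintype.piFinset fun _ : Fin (w + 1) => Finset.range D ×ˢ Finset.range D,
          coef p * ∑ j ∈ Finset.range n, e (∑ i, (((p i).1 : ℝ) - (p i).2) * c j i) := by
      rw [hS', Complex.ofReal_sum]
      simp only [Complex.ofReal_sum, Complex.ofReal_mul, fejerProd_eq_sum]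
      simp only [hcoef, Finset.mul_sum, Finset.sum_mul]
      rw [Finset.sum_congr rfl fun j _ => Finset.sum_comm]
      rw [Finset.sum_comm]
      refine Finset.sum_congr rfl fun p _ => Finset.sum_congr rfl fun j _ =>
        Finset.sum_congr rfl fun g _ => by ring
    have h3 : ∀ p ∈ Fintype.piFinset fun _ : Fin (w + 1) => Finset.range D ×ˢ Finset.range D,
        ‖coef p * ∑ j ∈ Finset.range n, e (∑ i, (((p i).1 : ℝ) - (p i).2) * c j i)‖
          ≤ (G : ℝ) ^ (w + 1) * B * (δ * n) + (G : ℝ) ^ w * (Lip * (2 * Real.pi)) * n := by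
      intro p hp
      rw [Fintype.mem_piFinset] at hp
      rw [norm_mul]
      by_cases hp0 : (p 0).1 = (p 0).2
      · have hc1 := norm_grid_coeff_le hLip hmean (by omega : 0 < G) hLip0
          (fun i => ((p i).1 : ℝ) - (p i).2) (by simp [hp0])
        have hn : ‖∑ j ∈ Finset.range n, e (∑ i, (((p i).1 : ℝ) - (p i).2) * c j i)‖ ≤ n := by
          refine (norm_sum_le _ _).trans ?_
          simp [norm_e]
        have := mul_le_mul hc1 hn (norm_nonneg _) (by positivity)
        have h4 : 0 ≤ (G : ℝ) ^ (w + 1) * B * (δ * n) := by positivity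
        linarith
      · have hc1 : ‖coef p‖ ≤ (G : ℝ) ^ (w + 1) * B := by
          have hcB : ‖coef p‖ ≤ ∑ g ∈ gridSet (w + 1) G, B := by
            rw [hcoef]
            refine (norm_sum_le _ _).trans (Finset.sum_le_sum fun g _ => ?_)
            rw [norm_mul, norm_e, mul_one, Complex.norm_real]
            exact hB _
          exact hcB.trans (le_of_eq (by simp))
        have hn := hc (fun i => ((p i).1 : ℤ) - (p i).2) (by simpa [sub_eq_zero] using hp0) (by
          intro i
          have := hp i
          simp only [Finset.mem_product, Finset.mem_range] at this
          rw [abs_lt]; constructor <;> omega)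
        push_cast at hn
        have := mul_le_mul hc1 hn (norm_nonneg _) (by positivity)
        have h4 : 0 ≤ (G : ℝ) ^ w * (Lip * (2 * Real.pi)) * n := by positivity
        linarith
    have h5 : |S'| ≤ D ^ (w + 1) *
        ((G : ℝ) ^ (w + 1) * B * (δ * n) + (G : ℝ) ^ w * (Lip * (2 * Real.pi)) * n) := by
      rw [← Real.norm_eq_abs, ← Complex.norm_real, h2, norm_mul]
      refine (mul_le_mul_of_nonneg_left ((norm_sum_le _ _).trans (Finset.sum_le_sum h3))
        (norm_nonneg _)).trans (le_of_eq ?_)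
      simp only [Finset.sum_const, Fintype.card_piFinset_const, Finset.card_product,
        Finset.card_range, nsmul_eq_mul, norm_pow, norm_inv, Complex.norm_natCast]
      push_cast
      rw [mul_pow, inv_pow]
      field_simp
    have hGw : (0 : ℝ) < (G : ℝ) ^ (w + 1) := by positivity
    refine le_of_mul_le_mul_left ?_ hGw
    have h6 : (G : ℝ) ^ (w + 1) * |S| ≤ |(G : ℝ) ^ (w + 1) * S - S'| + |S'| := by
      rw [← abs_of_pos hGw, ← abs_mul, abs_of_pos hGw]
      have := abs_add_le ((G : ℝ) ^ (w + 1) * S - S') S'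
      rwa [sub_add_cancel] at this
    refine (h6.trans (add_le_add h1 h5)).trans (le_of_eq ?_)
    field_simp
    ring
  refine le_of_forall_pos_le_add fun ε hε => ?_
  set X := (D : ℝ) ^ (w + 1) * (n * (Lip * (2 * Real.pi)))
  obtain ⟨G, hG⟩ := exists_nat_gt (X / ε)
  refine (main (max G (D + 1)) (by omega)).trans ?_
  gcongr
  have hGm : (G : ℝ) ≤ (max G (D + 1) : ℕ) := by exact_mod_cast le_max_left _ _
  have hpos : (0 : ℝ) < (max G (D + 1) : ℕ) := by exact_mod_cast (by omega)
  rw [div_le_iff₀ hpos]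
  rw [div_lt_iff₀ hε] at hG
  nlinarith
end

lemma szegoProd_gauge (β : ℕ → ℂ) (c u : ℝ) (z : ℂ) (m : ℕ) :
    szegoProd β (z * e u) m 0 1
        = e (c + u * m - u) * szegoProd (fun j => β j * e (c + u * j)) z m 0 1 ∧
      szegoProd β (z * e u) m 1 1 = szegoProd (fun j => β j * e (c + u * j)) z m 1 1 := by
  induction m with
  | zero => simp [szegoProd]
  | succ m ih =>
    have h1 : e (c + u * (m + 1 : ℕ) - u) = e (c + u * m) := by
      congr 1; push_cast; ring
    have h2 : e u * e (c + u * m - u) = e (c + u * m) := by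
      rw [← e_add]; congr 1; ring
    have h3 : conj (e (c + u * m)) * e (c + u * m) = 1 := by
      rw [conj_e]; exact e_neg_mul_self _
    simp only [szegoProd_succ_apply_zero, szegoProd_succ_apply_one, ih.1, ih.2, h1, map_mul]
    constructor
    · linear_combination (z * szegoProd (fun j => β j * e (c + u * j)) z m 0 1) * h2
        + (conj (β m) * szegoProd (fun j => β j * e (c + u * j)) z m 1 1) * h3
    · linear_combination (-β m * z * szegoProd (fun j => β j * e (c + u * j)) z m 0 1) * h2

lemma logD_gauge (β : ℕ → ℂ) (c u : ℝ) (m : ℕ) (t : ℝ) :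
    logD (fun j => β j * e (c + u * j)) m t = logD β m (t + u) := by
  rw [logD, logD, e_add, (szegoProd_gauge β c u (e t) m).2]

section
variable {β β' : ℕ → ℂ} {a : ℝ} (hβ : ∀ j, ‖β j‖ = a) (hβ' : ∀ j, ‖β' j‖ = a) (ha : a < 1)

include hβ hβ' ha in
lemma norm_szegoProd_sub_le {z : ℂ} (hz : ‖z‖ = 1) {δ : ℝ} (hδ : 0 ≤ δ) {m : ℕ}
    (h : ∀ j < m, ‖β j - β' j‖ ≤ δ) :
    ‖szegoProd β z m 0 1 - szegoProd β' z m 0 1‖ ≤ 4 ^ m * δ ∧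
      ‖szegoProd β z m 1 1 - szegoProd β' z m 1 1‖ ≤ 4 ^ m * δ := by
  induction m with
  | zero => simp [szegoProd, hδ]
  | succ m ih =>
    obtain ⟨h0, h1⟩ := ih fun j hj => h j (by omega)
    have ha0 : 0 ≤ a := by rw [← hβ 0]; positivity
    have hm := h m (by omega)
    obtain ⟨e0, e1⟩ := norm_entries_le hβ' ha hz.le m 1
    have h24 : (2 : ℝ) ^ m ≤ 4 ^ m := by gcongr; norm_num
    have h4 : (2 : ℝ) ^ m * δ ≤ 4 ^ m * δ := by gcongr
    set f := szegoProd β z m 0 1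
    set g := szegoProd β z m 1 1
    set f' := szegoProd β' z m 0 1
    set g' := szegoProd β' z m 1 1
    have b1 : ‖conj (β m) * (g - g')‖ ≤ 4 ^ m * δ := by
      rw [norm_mul, RCLike.norm_conj, hβ]
      nlinarith [norm_nonneg (g - g')]
    have b2 : ‖conj (β m - β' m) * g'‖ ≤ 4 ^ m * δ := by
      rw [norm_mul, RCLike.norm_conj]
      refine (mul_le_mul hm e1 (norm_nonneg _) hδ).trans ?_
      linarith
    have b3 : ‖z * (f - f')‖ ≤ 4 ^ m * δ := by rwa [norm_mul, hz, one_mul]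
    have b4 : ‖β m * (z * (f - f'))‖ ≤ 4 ^ m * δ := by
      rw [norm_mul, hβ]
      nlinarith [norm_nonneg (z * (f - f'))]
    have b5 : ‖(β m - β' m) * (z * f')‖ ≤ 4 ^ m * δ := by
      rw [norm_mul, norm_mul, hz, one_mul]
      refine (mul_le_mul hm e0 (norm_nonneg _) hδ).trans ?_
      linarith
    simp only [szegoProd_succ_apply_zero, szegoProd_succ_apply_one]
    constructor
    · have : z * f - conj (β m) * g - (z * f' - conj (β' m) * g')
          = z * (f - f') - conj (β m) * (g - g') - conj (β m - β' m) * g' := by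
        rw [map_sub]; ring
      rw [this, pow_succ]
      refine (norm_sub_le _ _).trans ((add_le_add_left (norm_sub_le _ _) _).trans ?_)
      nlinarith [mul_nonneg (pow_nonneg (by norm_num : (0 : ℝ) ≤ 4) m) hδ]
    · have : g - β m * z * f - (g' - β' m * z * f')
          = (g - g') - β m * (z * (f - f')) - (β m - β' m) * (z * f') := by
        ring
      rw [this, pow_succ]
      refine (norm_sub_le _ _).trans ((add_le_add_left (norm_sub_le _ _) _).trans ?_)
      nlinarith [mul_nonneg (pow_nonneg (by norm_num : (0 : ℝ) ≤ 4) m) hδ]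

include hβ ha in
lemma pow_le_norm_one_one (m : ℕ) {z : ℂ} (hz : ‖z‖ = 1) :
    (1 - a ^ 2) ^ m ≤ ‖szegoProd β z m 1 1‖ := by
  have ha0 : 0 ≤ a := by rw [← hβ 0]; positivity
  have h := norm_one_one_ge hβ hz m
  have hp : 0 < (1 - a ^ 2) ^ m := by apply pow_pos; nlinarith
  have h1 : (1 - a ^ 2) ^ m ≤ 1 := pow_le_one₀ (by nlinarith) (by nlinarith)
  by_contra! hlt
  nlinarith [norm_nonneg (szegoProd β z m 1 1)]

lemma abs_log_sub_log_le {x y r : ℝ} (hr : 0 < r) (hx : r ≤ x) (hy : r ≤ y) :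
    |Real.log x - Real.log y| ≤ |x - y| / r := by
  have key : ∀ x y : ℝ, r ≤ x → r ≤ y → Real.log x - Real.log y ≤ |x - y| / r := by
    intro x y hx hy
    rw [← Real.log_div (by linarith) (by linarith)]
    refine (Real.log_le_sub_one_of_pos (div_pos (by linarith) (by linarith))).trans ?_
    rw [div_sub_one (by linarith)]
    calc (x - y) / y ≤ |x - y| / y := by gcongr; exacts [by linarith, le_abs_self _]
      _ ≤ _ := by gcongr
  rw [abs_le]
  constructor
  · have := key y x hy hx
    rw [abs_sub_comm] at this; linarith
  · exact key x y hx hy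

include hβ hβ' ha in
lemma abs_logD_sub_le {δ : ℝ} (hδ : 0 ≤ δ) {m : ℕ} (h : ∀ j < m, ‖β j - β' j‖ ≤ δ) (t : ℝ) :
    |logD β m t - logD β' m t| ≤ (4 / (1 - a ^ 2)) ^ m * δ := by
  have ha0 : 0 ≤ a := by rw [← hβ 0]; positivity
  have hp : 0 < (1 - a ^ 2) ^ m := by apply pow_pos; nlinarith
  refine (abs_log_sub_log_le hp (pow_le_norm_one_one hβ ha m (norm_e t))
    (pow_le_norm_one_one hβ' ha m (norm_e t))).trans ?_
  rw [div_pow, div_mul_eq_mul_div]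
  gcongr
  exact (abs_norm_sub_norm_le _ _).trans (norm_szegoProd_sub_le hβ hβ' ha (norm_e t) hδ h).2

include hβ ha in
lemma abs_logD_le (m : ℕ) (t : ℝ) :
    |logD β m t| ≤ m * (Real.log 2 - Real.log (1 - a ^ 2)) := by
  have ha0 : 0 ≤ a := by rw [← hβ 0]; positivity
  have hp : 0 < 1 - a ^ 2 := by nlinarith
  have hp0 := pow_pos hp m
  have h1 := pow_le_norm_one_one hβ ha m (norm_e t)
  have h2 := (norm_entries_le hβ ha (norm_e t).le m 1).2
  have l1 := Real.log_le_log hp0 h1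
  have l2 := Real.log_le_log (hp0.trans_le h1) h2
  rw [Real.log_pow] at l1 l2
  have l3 : Real.log (1 - a ^ 2) ≤ 0 := Real.log_nonpos hp.le (by nlinarith)
  have l4 : 0 < Real.log 2 := Real.log_pos (by norm_num)
  have hm : (0 : ℝ) ≤ m := by positivity
  rw [logD, abs_le]
  constructor <;> nlinarith

end

lemma norm_e_nat_mul_sub_le (n : ℕ) (s t : ℝ) : ‖e (n * s) - e (n * t)‖ ≤ n * ‖e s - e t‖ := by
  induction n with
  | zero => simp
  | succ n ih =>
    have h : e ((n + 1 : ℕ) * s) - e ((n + 1 : ℕ) * t)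
        = e s * (e (n * s) - e (n * t)) + e (n * t) * (e s - e t) := by
      have h1 : ∀ r, e ((n + 1 : ℕ) * r) = e (n * r) * e r := fun r => by
        rw [← e_add]; congr 1; push_cast; ring
      rw [h1, h1]; ring
    rw [h]
    refine (norm_add_le _ _).trans ?_
    rw [norm_mul, norm_mul, norm_e, norm_e]
    push_cast
    linarith

lemma norm_e_sum_sub_le {ι : Type*} (S : Finset ι) (f g : ι → ℝ) :
    ‖e (∑ i ∈ S, f i) - e (∑ i ∈ S, g i)‖ ≤ ∑ i ∈ S, ‖e (f i) - e (g i)‖ := by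
  classical
  induction S using Finset.induction_on with
  | empty => simp
  | insert i S hi ih =>
    rw [Finset.sum_insert hi, Finset.sum_insert hi, Finset.sum_insert hi, e_add, e_add]
    have : e (f i) * e (∑ i ∈ S, f i) - e (g i) * e (∑ i ∈ S, g i)
        = e (f i) * (e (∑ i ∈ S, f i) - e (∑ i ∈ S, g i))
          + e (∑ i ∈ S, g i) * (e (f i) - e (g i)) := by ring
    rw [this]
    refine (norm_add_le _ _).trans ?_
    rw [norm_mul, norm_mul, norm_e, norm_e]
    linarith

/-- Sequences `λ e(p(j))` with `p` a polynomial of degree `w + 2`, leading coefficient `ω`, and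
lower coefficients listed in `c`. -/
def phaseSeq (lam : ℂ) (ω : ℝ) {w : ℕ} (c : Fin (w + 1) → ℝ) (j : ℕ) : ℂ :=
  lam * e (ω * (j : ℝ) ^ (w + 2) + ∑ i : Fin (w + 1), c i * (j : ℝ) ^ ((i : ℕ) + 1))

/-- The lower coefficients of `ω (b + X)^(w + 2)`. -/
def shiftPhase (ω : ℝ) (w : ℕ) (b : ℝ) (i : Fin (w + 1)) : ℝ :=
  ((w + 2).choose (i + 1)) * ω * b ^ (w + 1 - i)

/-- The unimodular-phase sequence `λ e(ω n^k)`. -/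
def powSeq (lam : ℂ) (ω : ℝ) (k n : ℕ) : ℂ := lam * e (ω * (n : ℝ) ^ k)

lemma norm_powSeq (lam : ℂ) (ω : ℝ) (k n : ℕ) : ‖powSeq lam ω k n‖ = ‖lam‖ := by
  rw [powSeq, norm_mul, norm_e, mul_one]

lemma norm_phaseSeq (lam : ℂ) (ω : ℝ) {w : ℕ} (c : Fin (w + 1) → ℝ) (j : ℕ) :
    ‖phaseSeq lam ω c j‖ = ‖lam‖ := by
  rw [phaseSeq, norm_mul, norm_e, mul_one]

lemma powSeq_add (lam : ℂ) (ω : ℝ) (w b j : ℕ) :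
    powSeq lam ω (w + 2) (b + j)
      = phaseSeq lam ω (shiftPhase ω w b) j * e (ω * (b : ℝ) ^ (w + 2) + 0 * j) := by
  rw [powSeq, phaseSeq, mul_assoc, ← e_add]
  congr 2
  push_cast
  rw [add_comm (b : ℝ), add_pow, Finset.sum_range_succ, Finset.sum_range_succ', mul_add,
    mul_add, Finset.mul_sum]
  simp only [shiftPhase]
  rw [Fin.sum_univ_eq_sum_range
    (fun i => ((w + 2).choose (i + 1) : ℝ) * ω * (b : ℝ) ^ (w + 1 - i) * (j : ℝ) ^ (i + 1))]
  have : ∀ i ∈ Finset.range (w + 1), ω * ((j : ℝ) ^ (i + 1) * (b : ℝ) ^ (w + 2 - (i + 1))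
      * ((w + 2).choose (i + 1) : ℝ))
      = ((w + 2).choose (i + 1) : ℝ) * ω * (b : ℝ) ^ (w + 1 - i) * (j : ℝ) ^ (i + 1) := by
    intro i _
    rw [show w + 2 - (i + 1) = w + 1 - i by omega]; ring
  rw [Finset.sum_congr rfl this]
  simp
  ring

lemma logD_powSeq_add (lam : ℂ) (ω : ℝ) (w b m : ℕ) (t : ℝ) :
    logD (fun j => powSeq lam ω (w + 2) (b + j)) m t
      = logD (phaseSeq lam ω (shiftPhase ω w b)) m t := by
  simp only [powSeq_add]
  rw [logD_gauge, add_zero]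

lemma logD_phaseSeq_shift (lam : ℂ) (ω : ℝ) {w : ℕ} (c : Fin (w + 1) → ℝ) (m : ℕ) (t : ℝ) :
    logD (phaseSeq lam ω (c + Pi.single 0 t)) m 0 = logD (phaseSeq lam ω c) m t := by
  rw [← zero_add t, ← logD_gauge _ 0 t, zero_add]
  congr 1
  funext j
  rw [phaseSeq, phaseSeq, mul_assoc, ← e_add]
  congr 2
  simp only [Pi.add_apply, add_mul, Finset.sum_add_distrib]
  rw [Finset.sum_eq_single_of_mem (0 : Fin (w + 1)) (Finset.mem_univ _)
    (f := fun i => (Pi.single 0 t : Fin (w + 1) → ℝ) i * (j : ℝ) ^ ((i : ℕ) + 1))]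
  · simp; ring
  · intro i _ hi
    simp [hi]

lemma abs_logD_phaseSeq_sub_le {lam : ℂ} (hlam : ‖lam‖ < 1) (ω : ℝ) {w : ℕ} (m : ℕ)
    (c c' : Fin (w + 1) → ℝ) (t : ℝ) :
    |logD (phaseSeq lam ω c) m t - logD (phaseSeq lam ω c') m t|
      ≤ (4 / (1 - ‖lam‖ ^ 2)) ^ m * (m : ℝ) ^ (w + 1) * ∑ i, ‖e (c i) - e (c' i)‖ := by
  rw [mul_assoc]
  refine abs_logD_sub_le (norm_phaseSeq lam ω c) (norm_phaseSeq lam ω c') hlam (by positivity)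
    (fun j hj => ?_) t
  rw [phaseSeq, phaseSeq, ← mul_sub, norm_mul, e_add, e_add, ← mul_sub, norm_mul, norm_e, one_mul]
  refine (mul_le_of_le_one_left (norm_nonneg _) hlam.le).trans
    ((norm_e_sum_sub_le _ _ _).trans ?_)
  rw [Finset.mul_sum]
  refine Finset.sum_le_sum fun i _ => ?_
  have h := norm_e_nat_mul_sub_le (j ^ ((i : ℕ) + 1)) (c i) (c' i)
  push_cast at h
  rw [mul_comm (c i), mul_comm (c' i)]
  refine h.trans (mul_le_mul_of_nonneg_right ?_ (norm_nonneg _))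
  have hj1 : (j : ℝ) ≤ m := by exact_mod_cast hj.le
  have hm1 : (1 : ℝ) ≤ m := by exact_mod_cast (by omega : 1 ≤ m)
  calc (j : ℝ) ^ ((i : ℕ) + 1) ≤ (m : ℝ) ^ ((i : ℕ) + 1) := by gcongr
    _ ≤ (m : ℝ) ^ (w + 1) := pow_le_pow_right₀ hm1 (by omega)

lemma integral_logD_phaseSeq_cons {lam : ℂ} (hlam : ‖lam‖ < 1) (ω : ℝ) {w : ℕ} (m : ℕ)
    (c : Fin w → ℝ) :
    ∫ t in (0 : ℝ)..1, logD (phaseSeq lam ω (Fin.cons t c : Fin (w + 1) → ℝ)) m 0 = 0 := by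
  have h : ∀ t : ℝ, (Fin.cons t c : Fin (w + 1) → ℝ)
      = (Fin.cons 0 c : Fin (w + 1) → ℝ) + Pi.single 0 t := by
    intro t; funext i
    refine Fin.cases ?_ (fun i => ?_) i <;> simp [Fin.succ_ne_zero]
  have h2 : ∀ t : ℝ, logD (phaseSeq lam ω (Fin.cons t c : Fin (w + 1) → ℝ)) m 0
      = logD (phaseSeq lam ω (Fin.cons 0 c : Fin (w + 1) → ℝ)) m t := fun t => by
    rw [h t, logD_phaseSeq_shift]
  simp only [h2]
  exact integral_logD (norm_phaseSeq lam ω _) hlam m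

/-- At most exponential growth. -/
def ExpBounded (f : ℕ → ℕ) : Prop := ∃ A : ℕ, ∀ m, 1 ≤ m → f m ≤ 2 ^ (A * m)

lemma ExpBounded.const (c : ℕ) : ExpBounded fun _ => c :=
  ⟨c, fun m hm => c.lt_two_pow_self.le.trans
    (Nat.pow_le_pow_right (by norm_num) (Nat.le_mul_of_pos_right _ hm))⟩

lemma ExpBounded.id : ExpBounded fun m => m :=
  ⟨1, fun m _ => by rw [one_mul]; exact m.lt_two_pow_self.le⟩

lemma ExpBounded.mul {f g : ℕ → ℕ} (hf : ExpBounded f) (hg : ExpBounded g) :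
    ExpBounded fun m => f m * g m := by
  obtain ⟨A, hA⟩ := hf
  obtain ⟨B, hB⟩ := hg
  refine ⟨A + B, fun m hm => ?_⟩
  rw [add_mul, pow_add]
  exact Nat.mul_le_mul (hA m hm) (hB m hm)

lemma ExpBounded.pow {f : ℕ → ℕ} (hf : ExpBounded f) (r : ℕ) : ExpBounded fun m => f m ^ r := by
  obtain ⟨A, hA⟩ := hf
  refine ⟨A * r, fun m hm => ?_⟩
  rw [mul_right_comm, pow_mul]
  exact Nat.pow_le_pow_left (hA m hm) r

lemma ExpBounded.const_pow (c : ℕ) : ExpBounded fun m => c ^ m :=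
  ⟨c, fun m _ => by
    rw [pow_mul]
    exact Nat.pow_le_pow_left c.lt_two_pow_self.le m⟩

section
open Polynomial

/-- The polynomial `j ↦ ∑ i, a i * shiftPhase ω w (s + s' j) i`. -/
def charPoly (ω : ℝ) {w : ℕ} (a : Fin (w + 1) → ℤ) (s s' : ℝ) : ℝ[X] :=
  ∑ i : Fin (w + 1), C ((a i : ℝ) * (((w + 2).choose (i + 1)) * ω))
    * (C s' * X + C s) ^ (w + 1 - (i : ℕ))

lemma eval_charPoly (ω : ℝ) {w : ℕ} (a : Fin (w + 1) → ℤ) (s s' j : ℝ) :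
    (charPoly ω a s s').eval j = ∑ i, a i * shiftPhase ω w (s + s' * j) i := by
  rw [charPoly, eval_finsetSum]
  refine Finset.sum_congr rfl fun i _ => ?_
  simp only [eval_mul, eval_C, eval_pow, eval_add, eval_X, shiftPhase]
  ring

lemma natDegree_charPoly_term (x s s' : ℝ) (n : ℕ) :
    (C x * (C s' * X + C s) ^ n).natDegree ≤ n := by
  refine (natDegree_C_mul_le _ _).trans (natDegree_pow_le.trans ?_)
  exact (Nat.mul_le_mul_left n natDegree_linear_le).trans (by simp)

lemma natDegree_charPoly_le (ω : ℝ) {w : ℕ} (a : Fin (w + 1) → ℤ) (s s' : ℝ) :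
    (charPoly ω a s s').natDegree ≤ w + 1 :=
  natDegree_sum_le_of_forall_le _ _ fun i _ =>
    (natDegree_charPoly_term _ s s' _).trans (by omega)

lemma coeff_charPoly (ω : ℝ) {w : ℕ} (a : Fin (w + 1) → ℤ) (s s' : ℝ) :
    (charPoly ω a s s').coeff (w + 1) = a 0 * (w + 2) * s' ^ (w + 1) * ω := by
  rw [charPoly, finsetSum_coeff, Finset.sum_eq_single_of_mem (0 : Fin (w + 1)) (Finset.mem_univ _)]
  · rw [coeff_C_mul]
    have h := coeff_pow_of_natDegree_le (p := C s' * X + C s) (m := w + 1) (n := 1)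
      natDegree_linear_le
    simp only [mul_one, coeff_add, coeff_C_mul, coeff_X_one, coeff_C_succ, add_zero] at h
    simp only [Fin.coe_ofNat_eq_mod, Nat.zero_mod, Nat.sub_zero, h, zero_add, Nat.choose_one_right]
    push_cast
    ring
  · intro i _ hi
    refine coeff_eq_zero_of_natDegree_lt ((natDegree_charPoly_term _ s s' _).trans_lt ?_)
    have : (i : ℕ) ≠ 0 := fun h => hi (Fin.ext h)
    omega

end

theorem exists_bound_abs_sum_logD {lam : ℂ} (hlam : ‖lam‖ < 1) (ω : ℝ) (w : ℕ) :
    ∃ R : ℕ → ℕ, ExpBounded R ∧ ∀ m, 1 ≤ m → 1 ≤ R m ∧ ∀ s', 1 ≤ s' → s' ≤ 2 * m →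
      ∀ n : ℕ, 1 ≤ n → (∀ q : ℕ, 1 ≤ q → q ≤ R m → ∀ p : ℤ,
        (R m : ℝ) < |q * ω - p| * (n : ℝ) ^ (w + 1)) →
      ∀ (s : ℕ) (t : ℝ),
        |∑ j ∈ Finset.range n, logD (fun i => powSeq lam ω (w + 2) (s + s' * j + i)) m t| ≤ n := by
  obtain ⟨K, A, hK, hweyl⟩ := weyl_inverse w
  have hr : 0 < 1 - ‖lam‖ ^ 2 := by nlinarith [norm_nonneg lam]
  obtain ⟨N, hN⟩ := exists_nat_ge (4 / (1 - ‖lam‖ ^ 2))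
  obtain ⟨b, hb⟩ := exists_nat_ge (Real.log 2 - Real.log (1 - ‖lam‖ ^ 2))
  set Lp : ℕ → ℕ := fun m => N ^ m * m ^ (w + 1) with hLp
  have eLp : ExpBounded Lp := (ExpBounded.const_pow N).mul (ExpBounded.id.pow _)
  set D : ℕ → ℕ := fun m => 8 * ((w + 1) * Lp m) ^ 2 with hD
  have eD : ExpBounded D := (ExpBounded.const 8).mul (((ExpBounded.const _).mul eLp).pow 2)
  set Q : ℕ → ℕ := fun m => 2 * (D m ^ (w + 1) * (m * (b + 1))) with hQ
  have eQ : ExpBounded Q :=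
    (ExpBounded.const 2).mul ((eD.pow _).mul (ExpBounded.id.mul (ExpBounded.const _)))
  set R : ℕ → ℕ := fun m => K * Q m ^ A * (D m * (w + 2) * (2 * m) ^ (w + 1)) with hR
  have eR : ExpBounded R := ((ExpBounded.const K).mul (eQ.pow A)).mul
    ((eD.mul (ExpBounded.const _)).mul (((ExpBounded.const 2).mul ExpBounded.id).pow _))
  refine ⟨R, eR, fun m hm => ?_⟩
  have hN1 : 1 ≤ N := by
    have : (0 : ℝ) < N := lt_of_lt_of_le (by positivity) hN
    exact_mod_cast this
  have hLp1 : 1 ≤ Lp m := Nat.one_le_iff_ne_zero.2 (by positivity)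
  have hD1 : 1 ≤ D m := Nat.one_le_iff_ne_zero.2 (by positivity)
  have hQ1 : 1 ≤ Q m := Nat.one_le_iff_ne_zero.2 (by positivity)
  have hR1 : 1 ≤ R m := Nat.one_le_iff_ne_zero.2 (by positivity)
  refine ⟨hR1, fun s' hs' hs'm n hn hdio s t => ?_⟩
  have hsum : ∑ j ∈ Finset.range n, logD (fun i => powSeq lam ω (w + 2) (s + s' * j + i)) m t
      = ∑ j ∈ Finset.range n, (fun c => logD (phaseSeq lam ω c) m 0)
          ((fun j : ℕ => shiftPhase ω w (s + s' * j) + Pi.single 0 t) j) := by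
    refine Finset.sum_congr rfl fun j _ => ?_
    rw [logD_powSeq_add]
    beta_reduce
    rw [logD_phaseSeq_shift]
    push_cast
    rfl
  rw [hsum]
  have hmR : (0 : ℝ) < m := by exact_mod_cast hm
  refine (abs_sum_le_of_char_sums (Λ := fun c => logD (phaseSeq lam ω c) m 0) (Lip := Lp m)
    (B := m * (b + 1)) (D := D m)
    (δ := (Q m : ℝ)⁻¹) (fun c c' => ?_) (by positivity) (fun c => ?_)
    (fun c => integral_logD_phaseSeq_cons hlam ω m c) hD1 (by positivity) _ ?_).trans ?_
  · refine (abs_logD_phaseSeq_sub_le hlam ω m c c' 0).trans ?_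
    simp only [hLp]
    push_cast
    gcongr
  · refine (abs_logD_le (norm_phaseSeq lam ω c) hlam m 0).trans ?_
    gcongr
    linarith
  · intro a ha0 haD
    by_contra! hlt
    have hQR : (0 : ℝ) < Q m := by exact_mod_cast hQ1
    have hnQ : (n : ℝ) ≤ Q m * ‖∑ j ∈ Finset.range n,
        e ((charPoly ω a s s' + Polynomial.C (a 0 * t)).eval (j : ℝ))‖ := by
      have : ∀ j : ℕ, (charPoly ω a s s' + Polynomial.C (a 0 * t)).eval (j : ℝ)
          = ∑ i, (a i : ℝ) * (shiftPhase ω w (s + s' * j)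
            + (Pi.single 0 t : Fin (w + 1) → ℝ)) i := by
        intro j
        rw [Polynomial.eval_add, eval_charPoly, Polynomial.eval_C]
        simp only [Pi.add_apply, mul_add, Finset.sum_add_distrib]
        congr 1
        rw [Finset.sum_eq_single_of_mem (0 : Fin (w + 1)) (Finset.mem_univ _)]
        · simp
        · intro i _ hi; simp [hi]
      simp only [this]
      rw [inv_mul_lt_iff₀ hQR] at hlt
      exact hlt.le
    obtain ⟨q, hq1, hqle, p, hp⟩ := hweyl (Q m) hQ1 n hn _ (by
      refine (Polynomial.natDegree_add_le _ _).trans (max_le (natDegree_charPoly_le ω a s s') ?_)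
      exact (Polynomial.natDegree_C _).le.trans (Nat.zero_le _)) hnQ
    rw [Polynomial.coeff_add, coeff_charPoly, Polynomial.coeff_C_succ, add_zero] at hp
    have haD0 : (a 0).natAbs ≤ D m := by
      have := haD 0
      rw [Int.abs_eq_natAbs] at this
      omega
    have ha1 : 1 ≤ (a 0).natAbs := Int.natAbs_pos.2 ha0
    have hqR : q * ((a 0).natAbs * (w + 2) * s' ^ (w + 1)) ≤ R m := by
      simp only [hR]
      gcongr
    have hKR : K * Q m ^ A ≤ R m := Nat.le_mul_of_pos_right _ (by positivity)
    have hKR' : (K : ℝ) * (Q m : ℝ) ^ A ≤ R m := by exact_mod_cast hKR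
    obtain ⟨p', hp'⟩ : ∃ p' : ℤ, |((q * ((a 0).natAbs * (w + 2) * s' ^ (w + 1)) : ℕ) : ℝ) * ω - p'|
        = |q * ((a 0 : ℝ) * (w + 2) * (s' : ℝ) ^ (w + 1) * ω) - p| := by
      rcases le_total 0 (a 0) with h | h
      · refine ⟨p, ?_⟩
        have : (((a 0).natAbs : ℕ) : ℝ) = (a 0 : ℝ) := by
          rw [Nat.cast_natAbs, abs_of_nonneg h]
        push_cast
        rw [this]; congr 1; ring
      · refine ⟨-p, ?_⟩
        have : (((a 0).natAbs : ℕ) : ℝ) = -(a 0 : ℝ) := by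
          rw [Nat.cast_natAbs, abs_of_nonpos h]; push_cast; ring
        push_cast
        rw [this, ← abs_neg]; congr 1; ring
    have := hdio _ (by
      refine Nat.one_le_iff_ne_zero.2 ?_
      positivity) hqR p'
    rw [hp'] at this
    linarith
  · have hDR : (0 : ℝ) < D m := by exact_mod_cast hD1
    have hLR : (0 : ℝ) < Lp m := by exact_mod_cast hLp1
    have h1 : (Lp m : ℝ) * ((w + 1) * Real.sqrt (2 / D m)) = 1 / 2 := by
      have : (2 : ℝ) / D m = (1 / (2 * ((w + 1) * Lp m))) ^ 2 := by
        simp only [hD]; push_cast; field_simp; norm_num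
      rw [this, Real.sqrt_sq (by positivity)]
      field_simp
    have h2 : (D m : ℝ) ^ (w + 1) * (m * (b + 1)) * (Q m : ℝ)⁻¹ = 1 / 2 := by
      simp only [hQ]; push_cast
      have := pow_pos hDR (w + 1)
      field_simp
    rw [h1, h2]
    linarith

lemma ExpBounded.comp_two_mul {f : ℕ → ℕ} (hf : ExpBounded f) : ExpBounded fun m => f (2 * m) := by
  obtain ⟨A, hA⟩ := hf
  refine ⟨2 * A, fun m hm => (hA (2 * m) (by omega)).trans (le_of_eq ?_)⟩
  congr 1; ring

lemma exists_best_denominator {ω : ℝ} (hω : Irrational ω) {R : ℕ} (hR : 1 ≤ R) :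
    ∃ η : ℝ, 0 < η ∧ (∀ q : ℕ, 1 ≤ q → q ≤ R → ∀ p : ℤ, η ≤ |q * ω - p|) ∧
      ∃ q : ℕ, 1 ≤ q ∧ q ≤ R ∧ ∃ p : ℤ, |q * ω - p| = η := by
  obtain ⟨q, hq, hmin⟩ := Finset.exists_min_image (Finset.Icc 1 R)
    (fun q : ℕ => |q * ω - round (q * ω)|) ⟨1, by simp [hR]⟩
  rw [Finset.mem_Icc] at hq
  refine ⟨_, ?_, fun q' h1 h2 p => (hmin q' (Finset.mem_Icc.2 ⟨h1, h2⟩)).trans (round_le _ _),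
    q, hq.1, hq.2, _, rfl⟩
  rw [abs_pos, sub_ne_zero]
  exact (hω.natCast_mul (by omega)).ne_int _

lemma logD_mul_le {β : ℕ → ℂ} {a : ℝ} (hβ : ∀ j, ‖β j‖ = a) (ha : a < 1) (m n : ℕ) (t : ℝ) :
    logD β (m * n) t
      ≤ ∑ j ∈ Finset.range n, logD (fun i => β (m * j + i)) m t + n * Real.log 2 := by
  induction n with
  | zero => simp [logD, szegoProd]
  | succ n ih =>
    have := logD_add_le hβ ha (m * n) m t
    rw [Finset.sum_range_succ, mul_add, mul_one]
    push_cast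
    linarith

lemma exists_forall_abs_sum_logD_le {lam : ℂ} (hlam : ‖lam‖ < 1) {ω : ℝ} (hω : Irrational ω)
    (w : ℕ) {m : ℕ} (hm : 1 ≤ m) :
    ∃ N₀ : ℕ, ∀ n, N₀ ≤ n → ∀ (s : ℕ) (t : ℝ),
      |∑ j ∈ Finset.range n, logD (fun i => powSeq lam ω (w + 2) (s + m * j + i)) m t| ≤ n := by
  obtain ⟨R, -, hR⟩ := exists_bound_abs_sum_logD hlam ω w
  obtain ⟨hR1, hU⟩ := hR m hm
  obtain ⟨η, hη, hmin, -⟩ := exists_best_denominator hω hR1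
  obtain ⟨N₀, hN₀⟩ := exists_nat_gt ((R m : ℝ) / η)
  rw [div_lt_iff₀ hη] at hN₀
  refine ⟨N₀ + 1, fun n hn => hU m hm (by omega) n (by omega) fun q h1 h2 p => ?_⟩
  have h4 := hmin q h1 h2 p
  have h5 : (N₀ : ℝ) ≤ n := by exact_mod_cast (by omega : N₀ ≤ n)
  have h6 : (n : ℝ) ≤ (n : ℝ) ^ (w + 1) :=
    le_self_pow₀ (by exact_mod_cast (by omega : 1 ≤ n)) (by omega)
  calc (R m : ℝ) < N₀ * η := hN₀
    _ ≤ (n : ℝ) ^ (w + 1) * |q * ω - p| := by gcongr; exact h5.trans h6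
    _ = _ := mul_comm _ _

theorem exists_logD_powSeq_le {lam : ℂ} (hlam : ‖lam‖ < 1) {ω : ℝ} (hω : Irrational ω) (w : ℕ)
    {ε : ℝ} (hε : 0 < ε) :
    ∃ C, ∀ (s N : ℕ) (t : ℝ), logD (fun i => powSeq lam ω (w + 2) (s + i)) N t ≤ ε * N + C := by
  obtain ⟨m, hm⟩ := exists_nat_ge ((1 + Real.log 2) / ε)
  have hlog2 : 0 < Real.log 2 := Real.log_pos (by norm_num)
  rw [div_le_iff₀ hε] at hm
  have hm0 : 0 < m := by
    rcases Nat.eq_zero_or_pos m with h | h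
    · rw [h] at hm; push_cast at hm; linarith
    · exact h
  obtain ⟨N₀, hN₀⟩ := exists_forall_abs_sum_logD_le hlam hω w hm0
  set b := Real.log 2 - Real.log (1 - ‖lam‖ ^ 2) with hb
  have hb0 : 0 ≤ b := by
    have : Real.log (1 - ‖lam‖ ^ 2) ≤ 0 :=
      Real.log_nonpos (by nlinarith [norm_nonneg lam]) (by nlinarith [norm_nonneg lam])
    linarith
  refine ⟨(N₀ + 1) * m * b + Real.log 2, fun s N t => ?_⟩
  have hβ : ∀ s j, ‖(fun i => powSeq lam ω (w + 2) (s + i)) j‖ = ‖lam‖ :=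
    fun s j => norm_powSeq _ _ _ _
  have hmR : (0 : ℝ) < m := by exact_mod_cast hm0
  set n := N / m with hn
  have hN : m * n + N % m = N := Nat.div_add_mod N m
  have hNR : (m : ℝ) * n + (N % m : ℕ) = N := by exact_mod_cast hN
  have hrest : ((N % m : ℕ) : ℝ) ≤ m := by exact_mod_cast (Nat.mod_lt N hm0).le
  by_cases hnN : N₀ + 1 ≤ n
  · have h1 := logD_add_le (hβ s) hlam (m * n) (N % m) t
    rw [hN] at h1
    have h2 := logD_mul_le (hβ s) hlam m n t
    have h3 := hN₀ n (by omega) s t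
    have h7 := abs_logD_le (β := fun j => powSeq lam ω (w + 2) (s + (m * n + j)))
      (fun j => norm_powSeq _ _ _ _) hlam (N % m) t
    simp only [← add_assoc] at h1 h2 h7
    have h8 := le_of_abs_le h3
    have h9 := le_of_abs_le h7
    have h10 : ((N % m : ℕ) : ℝ) * b ≤ m * b := by gcongr
    have h11 : (n : ℝ) * (1 + Real.log 2) ≤ n * (m * ε) := by gcongr
    have h12 : 0 ≤ N₀ * (m * b) := by positivity
    have h13 : 0 ≤ ε * (N % m : ℕ) := by positivity
    have h14 : ε * N = ε * (m * n) + ε * (N % m : ℕ) := by rw [← hNR]; ring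
    linarith
  · have h7 := le_of_abs_le (abs_logD_le (hβ s) hlam N t)
    have h8 : (N : ℝ) ≤ (N₀ + 1) * m := by
      have : N ≤ (N₀ + 1) * m := by
        have : m * n ≤ N₀ * m := by rw [mul_comm]; gcongr; omega
        have := (Nat.mod_lt N hm0).le
        linarith
      exact_mod_cast this
    have h9 : (N : ℝ) * b ≤ (N₀ + 1) * m * b := by gcongr
    have h10 : 0 ≤ ε * N := by positivity
    linarith

lemma abs_logD_powSeq_sub_le {lam : ℂ} (hlam : ‖lam‖ < 1) (ω ω' : ℝ) (w : ℕ) {m b X : ℕ}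
    (hm : 1 ≤ m) (hbX : b ≤ X) (hX : 1 ≤ X) (t : ℝ) :
    |logD (fun j => powSeq lam ω (w + 2) (b + j)) m t
        - logD (fun j => powSeq lam ω' (w + 2) (b + j)) m t|
      ≤ (4 / (1 - ‖lam‖ ^ 2)) ^ m * (2 * Real.pi * (|ω - ω'| * ((w + 2) * 2 ^ (w + 2)
        * (m : ℝ) ^ (w + 2) * (X : ℝ) ^ (w + 1)))) := by
  rw [logD_powSeq_add, logD_powSeq_add]
  refine abs_logD_sub_le (norm_phaseSeq lam ω _) (norm_phaseSeq lam ω' _) hlam (by positivity)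
    (fun j hj => ?_) t
  rw [phaseSeq, phaseSeq, ← mul_sub, norm_mul]
  refine (mul_le_of_le_one_left (norm_nonneg _) hlam.le).trans ((norm_e_sub_e _ _).trans ?_)
  gcongr
  have hXR : (1 : ℝ) ≤ X := by exact_mod_cast hX
  have hmR : (1 : ℝ) ≤ m := by exact_mod_cast hm
  have hjR : (j : ℝ) ≤ m := by exact_mod_cast hj.le
  have hbR : (b : ℝ) ≤ X := by exact_mod_cast hbX
  have e1 : ω * (j : ℝ) ^ (w + 2) + ∑ i, shiftPhase ω w b i * (j : ℝ) ^ ((i : ℕ) + 1)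
      - (ω' * (j : ℝ) ^ (w + 2) + ∑ i, shiftPhase ω' w b i * (j : ℝ) ^ ((i : ℕ) + 1))
      = (ω - ω') * ((j : ℝ) ^ (w + 2) + ∑ i : Fin (w + 1), ((w + 2).choose (i + 1) : ℝ)
        * (b : ℝ) ^ (w + 1 - (i : ℕ)) * (j : ℝ) ^ ((i : ℕ) + 1)) := by
    rw [mul_add, Finset.mul_sum, add_sub_add_comm, ← Finset.sum_sub_distrib, sub_mul]
    congr 1
    refine Finset.sum_congr rfl fun i _ => ?_
    simp only [shiftPhase]; ring
  rw [e1, abs_mul, abs_of_nonneg (a := (j : ℝ) ^ (w + 2) + _) (by positivity)]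
  gcongr
  have hterm : ∀ i : Fin (w + 1), ((w + 2).choose (i + 1) : ℝ)
        * (b : ℝ) ^ (w + 1 - (i : ℕ)) * (j : ℝ) ^ ((i : ℕ) + 1)
      ≤ 2 ^ (w + 2) * (X : ℝ) ^ (w + 1) * (m : ℝ) ^ (w + 2) := by
    intro i
    have c1 : ((w + 2).choose (i + 1) : ℝ) ≤ 2 ^ (w + 2) := by
      exact_mod_cast Nat.choose_le_two_pow _ _
    have c2 : (b : ℝ) ^ (w + 1 - (i : ℕ)) ≤ (X : ℝ) ^ (w + 1) :=
      (pow_le_pow_left₀ (by positivity) hbR _).trans (pow_le_pow_right₀ hXR (by omega))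
    have c3 : (j : ℝ) ^ ((i : ℕ) + 1) ≤ (m : ℝ) ^ (w + 2) :=
      (pow_le_pow_left₀ (by positivity) hjR _).trans (pow_le_pow_right₀ hmR (by omega))
    gcongr
  have h0 : (j : ℝ) ^ (w + 2) ≤ 2 ^ (w + 2) * (X : ℝ) ^ (w + 1) * (m : ℝ) ^ (w + 2) := by
    have c1 : (1 : ℝ) ≤ 2 ^ (w + 2) * (X : ℝ) ^ (w + 1) :=
      one_le_mul_of_one_le_of_one_le (one_le_pow₀ (by norm_num)) (one_le_pow₀ hXR)
    have c3 : (j : ℝ) ^ (w + 2) ≤ (m : ℝ) ^ (w + 2) := by gcongr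
    exact c3.trans (le_mul_of_one_le_left (by positivity) c1)
  refine (add_le_add h0 (Finset.sum_le_sum fun i _ => hterm i)).trans (le_of_eq ?_)
  simp only [Finset.sum_const, Finset.card_univ, Fintype.card_fin, nsmul_eq_mul]
  push_cast
  ring

lemma sum_range_le_of_periodic {f : ℕ → ℝ} (hf : ∀ j, 0 ≤ f j) {q n : ℕ} (hq : 1 ≤ q)
    (hqn : q ≤ n) (hper : ∀ j, f (j + q) = f j) :
    ∑ j ∈ Finset.range n, f j ≤ 2 * n / q * ∑ j ∈ Finset.range q, f j := by
  have h1 : ∀ r, ∑ j ∈ Finset.range (r * q), f j = r * ∑ j ∈ Finset.range q, f j := by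
    intro r
    induction r with
    | zero => simp
    | succ r ih =>
      rw [add_mul, one_mul, Finset.sum_range_add, ih]
      have : ∀ x, f (r * q + x) = f x := by
        intro x
        clear ih
        induction r with
        | zero => simp
        | succ r ih' => rw [add_mul, one_mul, add_right_comm, hper, ih']
      simp only [this]
      push_cast; ring
  have hqR : (0 : ℝ) < q := by exact_mod_cast hq
  have h2 : n ≤ (n / q + 1) * q := by
    have := Nat.div_add_mod n q
    have := (Nat.mod_lt n hq).le
    nlinarith
  have h3 : ((n / q + 1 : ℕ) : ℝ) ≤ 2 * n / q := by
    rw [le_div_iff₀ hqR]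
    have := Nat.div_mul_le_self n q
    have h4 : (n / q + 1) * q ≤ 2 * n := by linarith
    exact_mod_cast h4
  calc ∑ j ∈ Finset.range n, f j ≤ ∑ j ∈ Finset.range ((n / q + 1) * q), f j :=
        Finset.sum_le_sum_of_subset_of_nonneg (Finset.range_subset_range.2 h2) fun _ _ _ => hf _
    _ = ((n / q + 1 : ℕ) : ℝ) * ∑ j ∈ Finset.range q, f j := h1 _
    _ ≤ _ := mul_le_mul_of_nonneg_right h3 (Finset.sum_nonneg fun _ _ => hf _)

lemma powSeq_periodic (lam : ℂ) (p : ℤ) {q : ℕ} (hq : 1 ≤ q) (k c x : ℕ) :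
    powSeq lam (p / q) k (c * q + x) = powSeq lam (p / q) k x := by
  have hqR : (q : ℝ) ≠ 0 := by positivity
  obtain ⟨z, hz⟩ : (q : ℤ) ∣ ((c * q + x : ℕ) : ℤ) ^ k - (x : ℤ) ^ k := by
    refine dvd_trans ⟨c, ?_⟩ (sub_dvd_pow_sub_pow _ _ k)
    push_cast; ring
  have hzR : ((c * q + x : ℕ) : ℝ) ^ k = (x : ℝ) ^ k + q * z := by
    have : (((c * q + x : ℕ) : ℤ) : ℝ) ^ k - ((x : ℤ) : ℝ) ^ k = q * z := by exact_mod_cast hz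
    push_cast at this ⊢
    linarith
  rw [powSeq, powSeq, hzR]
  have : (p : ℝ) / q * ((x : ℝ) ^ k + q * z) = p / q * (x : ℝ) ^ k + (p * z : ℤ) := by
    push_cast; field_simp
  rw [this, e_add, e_int, mul_one]

lemma measureReal_sum_mergeLoss_ge_le {β : ℕ → ℕ → ℂ} {a : ℝ} (hβ : ∀ j i, ‖β j i‖ = a)
    (ha : a < 1) (m : ℕ) {n : ℕ} (hn : 1 ≤ n) (h : ℝ) :
    (volume.restrict (Set.Ioc (0 : ℝ) 1)).real
        {t | h * n ≤ ∑ j ∈ Finset.range n, mergeLoss (β j) m m t}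
      ≤ Real.sqrt 2 * Real.exp (-h / 2) := by
  have hnR : (0 : ℝ) < n := by exact_mod_cast hn
  set F : ℝ → ℝ := fun t => ∑ j ∈ Finset.range n, (n : ℝ)⁻¹ * Real.exp (mergeLoss (β j) m m t / 2)
    with hF
  have hcont : ∀ j, Continuous fun t => (n : ℝ)⁻¹ * Real.exp (mergeLoss (β j) m m t / 2) :=
    fun j => by
      have := continuous_mergeLoss (hβ j) ha m m
      fun_prop
  have hFc : Continuous F := continuous_finsetSum _ fun j _ => hcont j
  have hItg : ∫ t in Set.Ioc (0 : ℝ) 1, F t ≤ Real.sqrt 2 := by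
    rw [← intervalIntegral.integral_of_le zero_le_one]
    simp only [hF]
    rw [intervalIntegral.integral_finsetSum fun j _ => (hcont j).intervalIntegrable _ _]
    calc _ ≤ ∑ j ∈ Finset.range n, (n : ℝ)⁻¹ * Real.sqrt 2 := Finset.sum_le_sum fun j _ => by
          rw [intervalIntegral.integral_const_mul]
          gcongr
          exact integral_exp_mergeLoss_le (hβ j) ha m m
      _ = _ := by simp; field_simp
  have hsub : {t | h * n ≤ ∑ j ∈ Finset.range n, mergeLoss (β j) m m t}
      ⊆ {t | Real.exp (h / 2) ≤ F t} := by
    intro t ht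
    simp only [Set.mem_ofPred_eq] at ht ⊢
    have hj := convexOn_exp.map_sum_le (t := Finset.range n) (w := fun _ => (n : ℝ)⁻¹)
      (p := fun j => mergeLoss (β j) m m t / 2) (fun _ _ => by positivity)
      (by simp; field_simp) (fun _ _ => Set.mem_univ _)
    simp only [smul_eq_mul] at hj
    refine le_trans ?_ hj
    rw [Real.exp_le_exp, ← Finset.mul_sum, ← Finset.sum_div, inv_mul_eq_div, le_div_iff₀ hnR]
    linarith
  have hM := mul_meas_ge_le_integral_of_nonneg (μ := volume.restrict (Set.Ioc (0 : ℝ) 1)) (f := F)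
    (Filter.Eventually.of_forall fun t => Finset.sum_nonneg fun j _ => by positivity)
    ((hFc.intervalIntegrable 0 1).1) (Real.exp (h / 2))
  refine (measureReal_mono hsub).trans ?_
  rw [neg_div, Real.exp_neg, ← div_eq_mul_inv, le_div_iff₀ (Real.exp_pos _), mul_comm]
  exact hM.trans hItg

/-- The loss in merging the `j`-th pair of adjacent blocks of length `m`. -/
def levelLoss (lam : ℂ) (ω : ℝ) (w m j : ℕ) (t : ℝ) : ℝ :=
  mergeLoss (fun l => powSeq lam ω (w + 2) (2 * m * j + l)) m m t

/-- The set of spectral parameters at which the mean merging loss is large. -/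
def badSet (lam : ℂ) (ω : ℝ) (w m : ℕ) (h : ℝ) (r : ℕ) : Set ℝ :=
  {t | h * (2 ^ r : ℕ) ≤ ∑ j ∈ Finset.range (2 ^ r), levelLoss lam ω w m j t}

lemma exists_finset_of_diam_le {S : Set ℕ} {B : ℕ}
    (h : ∀ r ∈ S, ∀ r' ∈ S, r ≤ r' → r' ≤ r + B) :
    ∃ T : Finset ℕ, T.card ≤ B + 1 ∧ S ⊆ T := by
  rcases S.eq_empty_or_nonempty with rfl | hS
  · exact ⟨∅, by simp, by simp⟩
  · refine ⟨Finset.Icc (sInf S) (sInf S + B), by simp; omega, fun r hr => ?_⟩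
    have h1 := Nat.sInf_le hr
    simpa [h1] using h _ (Nat.sInf_mem hS) r hr h1

lemma sum_levelLoss_eq (lam : ℂ) (ω : ℝ) (w m n : ℕ) (t : ℝ) :
    ∑ j ∈ Finset.range n, levelLoss lam ω w m j t
      = ∑ j ∈ Finset.range n, logD (fun l => powSeq lam ω (w + 2) (0 + 2 * m * j + l)) m t
        + ∑ j ∈ Finset.range n, logD (fun l => powSeq lam ω (w + 2) (m + 2 * m * j + l)) m t
        - ∑ j ∈ Finset.range n,
            logD (fun l => powSeq lam ω (w + 2) (0 + 2 * m * j + l)) (2 * m) t := by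
  rw [← Finset.sum_add_distrib, ← Finset.sum_sub_distrib]
  refine Finset.sum_congr rfl fun j _ => ?_
  simp only [levelLoss, mergeLoss, zero_add, ← add_assoc, two_mul, add_comm m (_ * j)]

section
variable {lam : ℂ} (hlam : ‖lam‖ < 1)
include hlam

lemma levelLoss_ge (ω : ℝ) (w m j : ℕ) (t : ℝ) : -Real.log 2 ≤ levelLoss lam ω w m j t :=
  neg_log_two_le_mergeLoss (fun _ => norm_powSeq _ _ _ _) hlam m m t

lemma exists_abs_levelLoss_sub_le (w : ℕ) :
    ∃ E : ℕ → ℕ, ExpBounded E ∧ ∀ m, 1 ≤ m → ∀ n : ℕ, ∀ ω ω' : ℝ,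
      |ω - ω'| * (n : ℝ) ^ (w + 1) * E m ≤ 1 → ∀ j < n, ∀ t,
        |levelLoss lam ω w m j t - levelLoss lam ω' w m j t| ≤ 1 := by
  have hr : 0 < 1 - ‖lam‖ ^ 2 := by nlinarith [norm_nonneg lam]
  obtain ⟨N, hN⟩ := exists_nat_ge (4 / (1 - ‖lam‖ ^ 2))
  have hN1 : (1 : ℝ) ≤ N := by
    have : (0 : ℝ) < N := lt_of_lt_of_le (by positivity) hN
    exact_mod_cast this
  refine ⟨fun m => 21 * ((w + 2) * 2 ^ (w + 2)) * (N ^ (2 * m) * (2 * m) ^ (2 * w + 3)),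
    (ExpBounded.const _).mul ((ExpBounded.const_pow N).comp_two_mul.mul
      (((ExpBounded.const 2).mul ExpBounded.id).pow _)), fun m hm n ω ω' hE j hj t => ?_⟩
  have hn : 1 ≤ n := by omega
  have hmR : (1 : ℝ) ≤ m := by exact_mod_cast hm
  have key : ∀ b l, 1 ≤ l → l ≤ 2 * m → b ≤ 2 * m * n →
      |logD (fun j => powSeq lam ω (w + 2) (b + j)) l t
        - logD (fun j => powSeq lam ω' (w + 2) (b + j)) l t| ≤ 1 / 3 := by
    intro b l hl hlm hb
    refine (abs_logD_powSeq_sub_le hlam ω ω' w hl hb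
      (Nat.one_le_iff_ne_zero.2 (by positivity)) t).trans ?_
    have hlR : (l : ℝ) ≤ 2 * m := by exact_mod_cast hlm
    have h1 : (4 / (1 - ‖lam‖ ^ 2)) ^ l ≤ (N : ℝ) ^ (2 * m) :=
      (pow_le_pow_left₀ (by positivity) hN _).trans (pow_le_pow_right₀ hN1 hlm)
    have h2 : 2 * Real.pi ≤ 7 := by linarith [Real.pi_lt_d2]
    calc _ ≤ (N : ℝ) ^ (2 * m) * (7 * (|ω - ω'| * ((w + 2) * 2 ^ (w + 2)
          * (2 * m : ℝ) ^ (w + 2) * ((2 * m * n : ℕ) : ℝ) ^ (w + 1)))) := by gcongr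
      _ = 1 / 3 * (|ω - ω'| * (n : ℝ) ^ (w + 1) * ((21 * ((w + 2) * 2 ^ (w + 2))
          * (N ^ (2 * m) * (2 * m) ^ (2 * w + 3)) : ℕ) : ℝ)) := by
        push_cast
        rw [mul_pow (2 * (m : ℝ)) (n : ℝ), show 2 * w + 3 = (w + 2) + (w + 1) by ring,
          pow_add (2 * (m : ℝ))]
        ring
      _ ≤ 1 / 3 * 1 := by gcongr
      _ = 1 / 3 := by norm_num
  have hb1 : 2 * m * j + m ≤ 2 * m * n := by nlinarith
  have k1 := key (2 * m * j) m hm (by omega) (by omega)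
  have k2 := key (2 * m * j + m) m hm (by omega) hb1
  have k3 := key (2 * m * j) (m + m) (by omega) (by omega) (by omega)
  simp only [levelLoss, mergeLoss, ← add_assoc]
  rw [abs_le] at *
  constructor <;> linarith

theorem exists_measureReal_iUnion_badSet_le {ω : ℝ} (hω : Irrational ω) (w : ℕ) :
    ∃ A : ℕ, ∀ m, 1 ≤ m → ∀ h : ℝ, 4 ≤ h →
      (volume.restrict (Set.Ioc (0 : ℝ) 1)).real (⋃ r, badSet lam ω w m h r)
        ≤ (A * m + 2) * (Real.sqrt 2 * Real.exp (1 - h / 4)) := by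
  obtain ⟨R₀, eR₀, hR₀⟩ := exists_bound_abs_sum_logD hlam ω w
  obtain ⟨E, eE, hE⟩ := exists_abs_levelLoss_sub_le hlam w
  set R : ℕ → ℕ := fun m => R₀ m * R₀ (2 * m) with hRdef
  have eR : ExpBounded R := eR₀.mul eR₀.comp_two_mul
  obtain ⟨A₁, hA₁⟩ := eR
  obtain ⟨A₂, hA₂⟩ := eE
  refine ⟨A₁ + (A₁ + A₂), fun m hm h hh => ?_⟩
  obtain ⟨r1, hU1⟩ := hR₀ m hm
  obtain ⟨r2, hU2⟩ := hR₀ (2 * m) (by omega)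
  have hR1 : 1 ≤ R m := Nat.mul_pos r1 r2
  have hle1 : R₀ m ≤ R m := Nat.le_mul_of_pos_right _ r2
  have hle2 : R₀ (2 * m) ≤ R m := Nat.le_mul_of_pos_left _ r1
  obtain ⟨η, hη, hmin, q, hq1, hqR, p, hp⟩ := exists_best_denominator hω hR1
  have hqR0 : (0 : ℝ) < q := by exact_mod_cast hq1
  set μ := volume.restrict (Set.Ioc (0 : ℝ) 1) with hμ
  have hsmall : ∀ r, μ.real (badSet lam ω w m h r) ≤ Real.sqrt 2 * Real.exp (1 - h / 4) := by
    intro r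
    refine (measureReal_sum_mergeLoss_ge_le
      (β := fun j l => powSeq lam ω (w + 2) (2 * m * j + l))
      (fun _ _ => norm_powSeq _ _ _ _) hlam m Nat.one_le_two_pow h).trans ?_
    gcongr
    linarith
  set F : Set ℝ := {t | ((h - 1) / 2 - Real.log 2) * q
    ≤ ∑ j ∈ Finset.range q, levelLoss lam (p / q) w m j t} with hFdef
  have hlog2 : Real.log 2 < 1 := Real.log_two_lt_d9.trans (by norm_num)
  have hlog2' : 0 < Real.log 2 := Real.log_pos (by norm_num)
  have hF : μ.real F ≤ Real.sqrt 2 * Real.exp (1 - h / 4) := by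
    refine (measureReal_sum_mergeLoss_ge_le
      (β := fun j l => powSeq lam (p / q) (w + 2) (2 * m * j + l))
      (fun _ _ => norm_powSeq _ _ _ _) hlam m hq1 _).trans ?_
    gcongr
    linarith
  set S : Set ℕ := {r | 1 < η * ((2 ^ r : ℕ) : ℝ) ^ (w + 1) * E m
    ∧ η * ((2 ^ r : ℕ) : ℝ) ^ (w + 1) ≤ R m} with hS
  obtain ⟨T, hT, hST⟩ := exists_finset_of_diam_le (S := S) (B := (A₁ + A₂) * m) (by
    intro r hr r' hr' hrr
    obtain ⟨d, rfl⟩ := Nat.exists_eq_add_of_le hrr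
    have h1 := hr.1
    have h2 := hr'.2
    have h3 : ((2 ^ d : ℕ) : ℝ) < R m * E m := by
      have e1 : (((2 ^ (r + d) : ℕ) : ℝ)) ^ (w + 1)
          = ((2 ^ r : ℕ) : ℝ) ^ (w + 1) * ((2 ^ d : ℕ) : ℝ) ^ (w + 1) := by
        push_cast; rw [pow_add (2 : ℝ) r d, mul_pow]
      rw [e1] at h2
      have e2 : ((2 ^ d : ℕ) : ℝ) ≤ ((2 ^ d : ℕ) : ℝ) ^ (w + 1) :=
        le_self_pow₀ (by exact_mod_cast Nat.one_le_two_pow) (by omega)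
      have e3 : (0 : ℝ) < (2 ^ d : ℕ) := by positivity
      calc ((2 ^ d : ℕ) : ℝ) = 1 * (2 ^ d : ℕ) := (one_mul _).symm
        _ < η * ((2 ^ r : ℕ) : ℝ) ^ (w + 1) * E m * (2 ^ d : ℕ) := by gcongr
        _ ≤ η * ((2 ^ r : ℕ) : ℝ) ^ (w + 1) * E m * ((2 ^ d : ℕ) : ℝ) ^ (w + 1) := by gcongr
        _ = η * (((2 ^ r : ℕ) : ℝ) ^ (w + 1) * ((2 ^ d : ℕ) : ℝ) ^ (w + 1)) * E m := by ring
        _ ≤ _ := by gcongr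
    have h4 : 2 ^ d < R m * E m := by exact_mod_cast h3
    have h5 : R m * E m ≤ 2 ^ ((A₁ + A₂) * m) := by
      rw [add_mul, pow_add]; exact Nat.mul_le_mul (hA₁ m hm) (hA₂ m hm)
    have := (Nat.pow_lt_pow_iff_right (by norm_num : 1 < 2)).1 (h4.trans_le h5)
    omega)
  have hcover : (⋃ r, badSet lam ω w m h r)
      ⊆ (⋃ r ∈ Finset.range (A₁ * m), badSet lam ω w m h r) ∪ F
        ∪ ⋃ r ∈ T, badSet lam ω w m h r := by
    intro t ht
    obtain ⟨r, hr⟩ := Set.mem_iUnion.1 ht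
    by_cases c1 : r < A₁ * m
    · exact Or.inl (Or.inl (Set.mem_biUnion (Finset.mem_coe.2 (Finset.mem_range.2 c1)) hr))
    have hRr : R m ≤ 2 ^ r :=
      (hA₁ m hm).trans (Nat.pow_le_pow_right (by norm_num) (not_lt.1 c1))
    by_cases c2 : r ∈ S
    · exact Or.inr (Set.mem_biUnion (Finset.mem_coe.2 (hST c2)) hr)
    refine Or.inl (Or.inr ?_)
    have hn1 : 1 ≤ 2 ^ r := Nat.one_le_two_pow
    set n := 2 ^ r with hn
    have hnR : (0 : ℝ) < n := by exact_mod_cast hn1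
    simp only [badSet, Set.mem_ofPred_eq, ← hn] at hr
    by_cases c3 : 1 < η * (n : ℝ) ^ (w + 1) * E m
    · exfalso
      have c4 : (R m : ℝ) < η * (n : ℝ) ^ (w + 1) := by
        by_contra! hc; exact c2 ⟨c3, hc⟩
      have hd : ∀ R' ≤ R m, ∀ q : ℕ, 1 ≤ q → q ≤ R' → ∀ p : ℤ,
          (R' : ℝ) < |q * ω - p| * (n : ℝ) ^ (w + 1) := fun R' hR' q h1 h2 p => by
        have h3 : (R' : ℝ) ≤ R m := by exact_mod_cast hR'
        have h4 : η * (n : ℝ) ^ (w + 1) ≤ |q * ω - p| * (n : ℝ) ^ (w + 1) := by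
          gcongr; exact hmin q h1 (h2.trans hR') p
        linarith
      have b1 := hU1 (2 * m) (by omega) le_rfl n hn1 (hd _ hle1) 0 t
      have b2 := hU1 (2 * m) (by omega) le_rfl n hn1 (hd _ hle1) m t
      have b3 := hU2 (2 * m) (by omega) (by omega) n hn1 (hd _ hle2) 0 t
      rw [sum_levelLoss_eq] at hr
      rw [abs_le] at b1 b2 b3
      nlinarith
    · rw [not_lt] at c3
      have hdω : |ω - p / q| ≤ η := by
        have : ω - p / q = (q * ω - p) / q := by field_simp
        rw [this, abs_div, hp, Nat.abs_cast]
        exact div_le_self hη.le (by exact_mod_cast hq1)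
      have hclose := hE m hm n ω (p / q) (by
        refine le_trans ?_ c3
        gcongr)
      have hper := sum_range_le_of_periodic
        (f := fun j => levelLoss lam (p / q) w m j t + Real.log 2)
        (fun j => by linarith [levelLoss_ge hlam (p / q) w m j t]) hq1 (hqR.trans hRr) (fun j => by
          have : (fun l => powSeq lam (p / q) (w + 2) (2 * m * (j + q) + l))
              = fun l => powSeq lam (p / q) (w + 2) (2 * m * j + l) := by
            funext l
            rw [← powSeq_periodic lam p hq1 (w + 2) (2 * m) (2 * m * j + l)]
            congr 1; ring
          simp only [levelLoss, this])
      have h1 : ∑ j ∈ Finset.range n, levelLoss lam ω w m j t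
          ≤ ∑ j ∈ Finset.range n, (1 + (levelLoss lam (p / q) w m j t + Real.log 2)) := by
        refine Finset.sum_le_sum fun j hj => ?_
        have := (abs_le.1 (hclose j (Finset.mem_range.1 hj) t)).2
        linarith
      rw [Finset.sum_add_distrib] at h1
      simp only [Finset.sum_const, Finset.card_range, nsmul_eq_mul, mul_one] at h1
      have h2 := hr.trans (h1.trans (add_le_add_right hper _))
      rw [Finset.sum_add_distrib] at h2
      simp only [Finset.sum_const, Finset.card_range, nsmul_eq_mul] at h2
      simp only [hFdef, Set.mem_ofPred_eq]
      set X := ∑ j ∈ Finset.range q, levelLoss lam (p / q) w m j t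
      have h3 : (h - 1) * n ≤ n * (2 / q * (X + q * Real.log 2)) := by
        have : 2 * (n : ℝ) / q * (X + q * Real.log 2) = n * (2 / q * (X + q * Real.log 2)) := by
          ring
        linarith
      rw [mul_comm, mul_le_mul_iff_right₀ hnR, div_mul_eq_mul_div, le_div_iff₀ hqR0] at h3
      linarith
  refine (measureReal_mono hcover).trans ?_
  set c := Real.sqrt 2 * Real.exp (1 - h / 4) with hc
  have hc0 : 0 ≤ c := by positivity
  have m1 : μ.real (⋃ r ∈ Finset.range (A₁ * m), badSet lam ω w m h r) ≤ (A₁ * m : ℕ) * c := by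
    refine (measureReal_biUnion_finset_le _ _).trans
      ((Finset.sum_le_sum fun r _ => hsmall r).trans (le_of_eq ?_))
    simp
  have m2 : μ.real (⋃ r ∈ T, badSet lam ω w m h r) ≤ ((A₁ + A₂) * m + 1 : ℕ) * c := by
    refine (measureReal_biUnion_finset_le _ _).trans
      ((Finset.sum_le_sum fun r _ => hsmall r).trans ?_)
    rw [Finset.sum_const, nsmul_eq_mul]
    gcongr
  have m3 := measureReal_union_le (μ := μ)
    ((⋃ r ∈ Finset.range (A₁ * m), badSet lam ω w m h r) ∪ F) (⋃ r ∈ T, badSet lam ω w m h r)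
  have m4 := measureReal_union_le (μ := μ) (⋃ r ∈ Finset.range (A₁ * m), badSet lam ω w m h r) F
  push_cast at m1 m2 ⊢
  nlinarith
end

lemma exp_neg_le_div_pow {y : ℝ} (hy : 0 < y) : Real.exp (-y) ≤ 24 / y ^ 4 := by
  have h := Real.pow_div_factorial_le_exp y hy.le 4
  rw [Real.exp_neg, inv_eq_one_div, div_le_div_iff₀ (Real.exp_pos _) (by positivity)]
  rw [div_le_iff₀ (by positivity)] at h
  have : ((Nat.factorial 4 : ℕ) : ℝ) = 24 := by norm_num [Nat.factorial]
  rw [this] at h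
  linarith

lemma ae_eventually_notMem_badSet {lam : ℂ} (hlam : ‖lam‖ < 1) {ω : ℝ} (hω : Irrational ω)
    (w : ℕ) : ∀ᵐ t ∂volume.restrict (Set.Ioc (0 : ℝ) 1), ∃ i₀ : ℕ, ∀ i, i₀ ≤ i → ∀ r,
      t ∉ badSet lam ω w (2 ^ i) ((3 / 2 : ℝ) ^ i) r := by
  obtain ⟨A, hA⟩ := exists_measureReal_iUnion_badSet_le hlam hω w
  set C : ℝ := (A + 2) * (Real.sqrt 2 * (Real.exp 1 * (24 * 256)))
  have hb : ∀ i : ℕ, volume.restrict (Set.Ioc (0 : ℝ) 1)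
      (⋃ r, badSet lam ω w (2 ^ (i + 4)) ((3 / 2 : ℝ) ^ (i + 4)) r)
      ≤ ENNReal.ofReal (C * (32 / 81) ^ (i + 4)) := by
    intro i
    have h4 : (4 : ℝ) ≤ (3 / 2) ^ (i + 4) := by
      rw [pow_add]
      have : (1 : ℝ) ≤ (3 / 2) ^ i := one_le_pow₀ (by norm_num)
      norm_num; linarith
    rw [← ofReal_measureReal]
    refine ENNReal.ofReal_le_ofReal ((hA _ Nat.one_le_two_pow _ h4).trans ?_)
    set n := i + 4
    have h1 : Real.exp (1 - (3 / 2 : ℝ) ^ n / 4) ≤ Real.exp 1 * (24 * 256 * (16 / 81) ^ n) := by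
      rw [sub_eq_add_neg, Real.exp_add]
      gcongr
      refine (exp_neg_le_div_pow (by positivity)).trans (le_of_eq ?_)
      rw [show (16 / 81 : ℝ) = ((3 / 2) ^ 4)⁻¹ by norm_num, div_pow, ← pow_mul, mul_comm n 4,
        pow_mul, inv_pow]
      field_simp
      norm_num
    have h2 : (A : ℝ) * (2 ^ n : ℕ) + 2 ≤ (A + 2) * 2 ^ n := by
      push_cast
      have : (1 : ℝ) ≤ 2 ^ n := one_le_pow₀ (by norm_num)
      linarith
    calc _ ≤ ((A : ℝ) + 2) * 2 ^ n
          * (Real.sqrt 2 * (Real.exp 1 * (24 * 256 * (16 / 81) ^ n))) := by gcongr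
      _ = C * (2 ^ n * (16 / 81) ^ n) := by simp only [C]; ring
      _ = C * (32 / 81) ^ n := by rw [← mul_pow]; norm_num
  have hsum : Summable fun i : ℕ => C * (32 / 81 : ℝ) ^ (i + 4) :=
    ((summable_nat_add_iff 4).2 (summable_geometric_of_lt_one (by norm_num)
      (by norm_num))).mul_left C
  have := ae_eventually_notMem (ne_top_of_le_ne_top hsum.tsum_ofReal_ne_top
    (ENNReal.tsum_le_tsum hb))
  filter_upwards [this] with t ht
  obtain ⟨i₀, hi₀⟩ := Filter.eventually_atTop.1 ht
  refine ⟨i₀ + 4, fun i hi r hr => ?_⟩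
  obtain ⟨i, rfl⟩ := Nat.exists_eq_add_of_le' (by omega : 4 ≤ i)
  exact hi₀ i (by omega) (Set.mem_iUnion_of_mem r hr)

lemma sum_range_two_mul' (f : ℕ → ℝ) (n : ℕ) :
    ∑ j ∈ Finset.range (2 * n), f j = ∑ j ∈ Finset.range n, (f (2 * j) + f (2 * j + 1)) := by
  induction n with
  | zero => simp
  | succ n ih =>
    rw [mul_add, mul_one, Finset.sum_range_succ, Finset.sum_range_succ, ih,
      Finset.sum_range_succ, add_assoc]

/-- The sum of `logD` over the first `2 ^ r` dyadic blocks of length `2 ^ i`. -/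
def dyadicSum (lam : ℂ) (ω : ℝ) (w i r : ℕ) (t : ℝ) : ℝ :=
  ∑ j ∈ Finset.range (2 ^ r), logD (fun l => powSeq lam ω (w + 2) (2 ^ i * j + l)) (2 ^ i) t

lemma dyadicSum_succ (lam : ℂ) (ω : ℝ) (w i r : ℕ) (t : ℝ) :
    dyadicSum lam ω w (i + 1) r t = dyadicSum lam ω w i (r + 1) t
      - ∑ j ∈ Finset.range (2 ^ r), levelLoss lam ω w (2 ^ i) j t := by
  rw [dyadicSum, dyadicSum, pow_succ' 2 r, sum_range_two_mul', ← Finset.sum_sub_distrib]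
  refine Finset.sum_congr rfl fun j _ => ?_
  have h1 : ∀ l, 2 ^ i * (2 * j + 1) + l = 2 * 2 ^ i * j + (2 ^ i + l) := fun l => by ring
  have h2 : ∀ l, 2 ^ i * (2 * j) + l = 2 * 2 ^ i * j + l := fun l => by ring
  simp only [levelLoss, mergeLoss, h1, h2, pow_succ' 2 i, two_mul (2 ^ i)]
  ring

theorem ae_exists_logD_ge {lam : ℂ} (hlam : ‖lam‖ < 1) {ω : ℝ} (hω : Irrational ω) (w : ℕ) :
    ∀ᵐ t ∂volume.restrict (Set.Ioc (0 : ℝ) 1), ∀ ε : ℝ, 0 < ε → ∃ s₀ : ℕ, ∀ s, s₀ ≤ s →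
      -(ε * 2 ^ s) ≤ logD (powSeq lam ω (w + 2)) (2 ^ s) t := by
  filter_upwards [ae_eventually_notMem_badSet hlam hω w] with t ⟨i₁, hi₁⟩ ε hε
  obtain ⟨i₂, hi₂⟩ := exists_pow_lt_of_lt_one (by positivity : 0 < ε / 8)
    (by norm_num : (3 / 4 : ℝ) < 1)
  set i₀ := max i₁ i₂
  have hx : (3 / 4 : ℝ) ^ i₀ ≤ ε / 8 :=
    (pow_le_pow_of_le_one (by norm_num) (by norm_num) (le_max_right _ _)).trans hi₂.le
  have hind : ∀ d r : ℕ, dyadicSum lam ω w i₀ (r + d) t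
      - 2 ^ (r + d + i₀) * ∑ c ∈ Finset.range d, (3 / 4 : ℝ) ^ (i₀ + c)
      ≤ dyadicSum lam ω w (i₀ + d) r t := by
    intro d
    induction d with
    | zero => intro r; simp
    | succ d ih =>
      intro r
      have h1 := ih (r + 1)
      rw [← add_assoc i₀, dyadicSum_succ]
      have h2 : ∑ j ∈ Finset.range (2 ^ r), levelLoss lam ω w (2 ^ (i₀ + d)) j t
          ≤ (3 / 2 : ℝ) ^ (i₀ + d) * 2 ^ r := by
        have := hi₁ (i₀ + d) ((le_max_left _ _).trans (Nat.le_add_right _ _)) r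
        simp only [badSet, Set.mem_ofPred_eq, not_le] at this
        push_cast at this
        exact this.le
      have h3 : (3 / 2 : ℝ) ^ (i₀ + d) * 2 ^ r
          ≤ 2 ^ (r + 1 + d + i₀) * (3 / 4 : ℝ) ^ (i₀ + d) := by
        have : (2 : ℝ) ^ (r + 1 + d + i₀) = 2 * (2 ^ r * 2 ^ (i₀ + d)) := by ring
        rw [this, show (3 / 2 : ℝ) = 2 * (3 / 4) by norm_num, mul_pow]
        have : (0 : ℝ) ≤ 2 ^ r * 2 ^ (i₀ + d) * (3 / 4 : ℝ) ^ (i₀ + d) := by positivity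
        linarith
      rw [Finset.sum_range_succ, show r + (d + 1) = r + 1 + d by ring]
      linarith
  obtain ⟨N₀, hN₀⟩ := exists_forall_abs_sum_logD_le hlam hω w (m := 2 ^ i₀) Nat.one_le_two_pow
  refine ⟨i₀ + N₀, fun s hs => ?_⟩
  obtain ⟨d, rfl⟩ := Nat.exists_eq_add_of_le (by omega : i₀ ≤ s)
  have h1 := hind d 0
  have h2 := (abs_le.1 (hN₀ (2 ^ d) ((by omega : N₀ ≤ d).trans d.lt_two_pow_self.le) 0 t)).1
  simp only [zero_add] at h1 h2
  have h3 : dyadicSum lam ω w (i₀ + d) 0 t = logD (powSeq lam ω (w + 2)) (2 ^ (i₀ + d)) t := by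
    simp [dyadicSum]
  have h4 : ∑ c ∈ Finset.range d, (3 / 4 : ℝ) ^ (i₀ + c) ≤ ε / 2 := by
    have h5 : ∀ d : ℕ, ∑ c ∈ Finset.range d, (3 / 4 : ℝ) ^ c ≤ 4 := fun d => by
      rw [geom_sum_eq (by norm_num)]
      have : (0 : ℝ) ≤ (3 / 4) ^ d := by positivity
      rw [div_le_iff_of_neg (by norm_num)]; linarith
    simp only [pow_add, ← Finset.mul_sum]
    have := mul_le_mul hx (h5 d) (Finset.sum_nonneg fun _ _ => by positivity) (by positivity)
    linarith
  have h6 : (2 : ℝ) ^ d ≤ ε / 2 * 2 ^ (i₀ + d) := by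
    have h7 : (1 / 2 : ℝ) ^ i₀ ≤ (3 / 4) ^ i₀ :=
      pow_le_pow_left₀ (by norm_num) (by norm_num) _
    have h8 : (2 : ℝ) ^ d = (1 / 2) ^ i₀ * 2 ^ (i₀ + d) := by
      rw [pow_add, ← mul_assoc, ← mul_pow]; norm_num
    rw [h8]
    gcongr
    linarith
  have h9 : (2 : ℝ) ^ (d + i₀) * ∑ c ∈ Finset.range d, (3 / 4 : ℝ) ^ (i₀ + c)
      ≤ 2 ^ (d + i₀) * (ε / 2) := by gcongr
  rw [add_comm d i₀] at h1 h9
  rw [h3] at h1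
  unfold dyadicSum at h1
  push_cast at h2
  linarith

/-- The components at `n` of the unnormalized Szegő recursion started at `(1, τ)`. -/
def szegoVec (β : ℕ → ℂ) (z τ : ℂ) (n : ℕ) (i : Fin 2) : ℂ :=
  szegoProd β z n i 0 + τ * szegoProd β z n i 1

lemma szegoVec_zero (β : ℕ → ℂ) (z τ : ℂ) : szegoVec β z τ 0 0 = 1 ∧ szegoVec β z τ 0 1 = τ := by
  simp [szegoVec, szegoProd]

lemma szegoVec_succ (β : ℕ → ℂ) (z τ : ℂ) (n : ℕ) :
    szegoVec β z τ (n + 1) 0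
        = z * szegoVec β z τ n 0 - conj (β n) * szegoVec β z τ n 1 ∧
      szegoVec β z τ (n + 1) 1
        = szegoVec β z τ n 1 - β n * z * szegoVec β z τ n 0 := by
  simp only [szegoVec, szegoProd_succ_apply_zero, szegoProd_succ_apply_one]
  constructor <;> ring

lemma szegoVec_add (β : ℕ → ℂ) (z τ : ℂ) (m n : ℕ) (i : Fin 2) :
    szegoVec β z τ (m + n) i = szegoProd (fun j => β (m + j)) z n i 0 * szegoVec β z τ m 0
      + szegoProd (fun j => β (m + j)) z n i 1 * szegoVec β z τ m 1 := by
  simp only [szegoVec, szegoProd_add, Matrix.mul_apply, Fin.sum_univ_two]; ring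

lemma norm_szegoVec_zero_eq_one (β : ℕ → ℂ) {z τ : ℂ} (hz : ‖z‖ = 1) (hτ : ‖τ‖ = 1) (n : ℕ) :
    ‖szegoVec β z τ n 0‖ = ‖szegoVec β z τ n 1‖ := by
  induction n with
  | zero => simp [szegoVec_zero, hτ]
  | succ n ih =>
    have h := normSq_sub_conj_mul (β n) (z * szegoVec β z τ n 0) (szegoVec β z τ n 1)
    rw [norm_mul, hz, one_mul, ih, sub_self, mul_zero, ← mul_assoc, ← (szegoVec_succ β z τ n).1,
      ← (szegoVec_succ β z τ n).2] at h
    exact ((sq_eq_sq₀ (norm_nonneg _) (norm_nonneg _)).1 (sub_eq_zero.1 h)).symm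

section
variable {β : ℕ → ℂ} {a : ℝ} (hβ : ∀ j, ‖β j‖ = a)
include hβ

lemma norm_det_szegoProd {z : ℂ} (hz : ‖z‖ = 1) (ha : a ≤ 1) (n : ℕ) :
    ‖(szegoProd β z n).det‖ = (1 - a ^ 2) ^ n := by
  have ha0 : 0 ≤ a := by rw [← hβ 0]; positivity
  induction n with
  | zero => simp [szegoProd]
  | succ n ih =>
    have h : (szegoStep (β n) z).det = z * ((1 - a ^ 2 : ℝ) : ℂ) := by
      rw [szegoStep, Matrix.det_fin_two_of, ← hβ n, Complex.ofReal_sub, Complex.ofReal_pow,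
        ← Complex.conj_mul']
      push_cast; ring
    rw [szegoProd, Matrix.det_mul, norm_mul, ih, h, norm_mul, hz, Complex.norm_real, pow_succ,
      Real.norm_of_nonneg (by nlinarith)]
    ring

lemma norm_zero_zero_eq {z : ℂ} (hz : ‖z‖ = 1) (n : ℕ) :
    ‖szegoProd β z n 0 0‖ = ‖szegoProd β z n 1 1‖ := by
  have h1 := norm_sq_column_eq hβ hz 0 n
  have h2 := norm_sq_row_one_eq hβ hz n
  simp at h1
  exact (sq_eq_sq₀ (norm_nonneg _) (norm_nonneg _)).1 (by linarith)

lemma norm_szegoVec_le (ha : a < 1) {z τ : ℂ} (hz : ‖z‖ = 1) (hτ : ‖τ‖ = 1) (m n : ℕ) :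
    (1 - a ^ 2) ^ n * ‖szegoVec β z τ m 1‖
      ≤ 2 * ‖szegoProd (fun j => β (m + j)) z n 1 1‖ * ‖szegoVec β z τ (m + n) 1‖ := by
  have hβ' : ∀ j, ‖(fun j => β (m + j)) j‖ = a := fun j => hβ _
  set Q := szegoProd (fun j => β (m + j)) z n with hQ
  have h1 : Q.det * szegoVec β z τ m 1
      = Q 0 0 * szegoVec β z τ (m + n) 1 - Q 1 0 * szegoVec β z τ (m + n) 0 := by
    rw [szegoVec_add, szegoVec_add, Matrix.det_fin_two, ← hQ]; ring
  rw [← norm_det_szegoProd hβ' hz ha.le n, ← hQ, ← norm_mul, h1]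
  refine (norm_sub_le _ _).trans ?_
  rw [norm_mul, norm_mul, norm_szegoVec_zero_eq_one β hz hτ, hQ, norm_zero_zero_eq hβ' hz]
  have := norm_one_zero_lt hβ' ha hz.le n
  have h2 := norm_nonneg (szegoVec β z τ (m + n) 1)
  nlinarith

lemma exists_unit_szegoVec_small (ha : a < 1) {z : ℂ} (hz : ‖z‖ = 1) (n : ℕ) :
    ∃ τ : ℂ, ‖τ‖ = 1 ∧ ‖szegoVec β z τ n 1‖ * ‖szegoProd β z n 1 1‖ ≤ (1 - a ^ 2) ^ n := by
  have h1 := norm_sq_row_one_eq hβ hz n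
  have h2 := norm_one_zero_lt hβ ha hz.le n
  have h3 := one_one_ne_zero hβ ha hz.le n
  have h4 := norm_pos_iff.2 h3
  set C := szegoProd β z n 1 0
  set D := szegoProd β z n 1 1
  by_cases hC : C = 0
  · refine ⟨1, by simp, ?_⟩
    rw [szegoVec, one_mul]
    change ‖C + D‖ * ‖D‖ ≤ _
    rw [hC] at h1 ⊢
    simp at h1 ⊢
    nlinarith
  · have hC' : 0 < ‖C‖ := norm_pos_iff.2 hC
    refine ⟨-(C / D * ((‖D‖ / ‖C‖ : ℝ) : ℂ)), ?_, ?_⟩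
    · rw [norm_neg, norm_mul, norm_div, Complex.norm_real, Real.norm_of_nonneg (by positivity)]
      field_simp
    · have : szegoVec β z (-(C / D * ((‖D‖ / ‖C‖ : ℝ) : ℂ))) n 1
          = C * ((1 - ‖D‖ / ‖C‖ : ℝ) : ℂ) := by
        change C + _ * D = _
        push_cast; field_simp; ring
      rw [this, norm_mul, Complex.norm_real, Real.norm_eq_abs, abs_sub_comm, abs_of_nonneg]
      · have : ‖C‖ * (‖D‖ / ‖C‖ - 1) = ‖D‖ - ‖C‖ := by field_simp
        rw [this]; nlinarith
      · rw [sub_nonneg, one_le_div hC']; exact h2.le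

/-- Subexponential control of the lower right entries forces a decaying solution. -/
lemma exists_summable_szegoVec (ha : a < 1) {z : ℂ} (hz : ‖z‖ = 1) {K r : ℝ} (hr : 1 < r)
    (hr2 : (1 - a ^ 2) * r ^ 14 < 1)
    (hup : ∀ s N, ‖szegoProd (fun i => β (s + i)) z N 1 1‖ ≤ K * r ^ N) {s₀ : ℕ}
    (hlo : ∀ s ≥ s₀, 1 ≤ ‖szegoProd β z (2 ^ s) 1 1‖ * r ^ (2 ^ s)) :
    ∃ τ : ℂ, ‖τ‖ = 1 ∧ Summable fun n => ‖szegoVec β z τ n 1‖ ^ 2 / (1 - a ^ 2) ^ n := by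
  have ha0 : 0 ≤ a := by rw [← hβ 0]; positivity
  set q := 1 - a ^ 2 with hq
  have hq0 : 0 < q := by nlinarith
  have hr0 : 0 < r := by linarith
  have hK : 1 ≤ K := by simpa [szegoProd] using hup 0 0
  have hup0 : ∀ N, ‖szegoProd β z N 1 1‖ ≤ K * r ^ N := fun N => by simpa using hup 0 N
  choose σ hσ1 hσ2 using fun s => exists_unit_szegoVec_small hβ ha hz (2 ^ s)
  have hsmall : ∀ s ≥ s₀, ‖szegoVec β z (σ s) (2 ^ s) 1‖ ≤ q ^ (2 ^ s) * r ^ (2 ^ s) := by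
    intro s hs
    have h1 := hσ2 s
    have h2 := hlo s hs
    have h3 := norm_nonneg (szegoVec β z (σ s) (2 ^ s) 1)
    calc ‖szegoVec β z (σ s) (2 ^ s) 1‖
        ≤ ‖szegoVec β z (σ s) (2 ^ s) 1‖ * (‖szegoProd β z (2 ^ s) 1 1‖ * r ^ (2 ^ s)) :=
          le_mul_of_one_le_right h3 h2
      _ = (‖szegoVec β z (σ s) (2 ^ s) 1‖ * ‖szegoProd β z (2 ^ s) 1 1‖) * r ^ (2 ^ s) := by ring
      _ ≤ _ := by gcongr
  have hback : ∀ s ≥ s₀, ∀ n ≤ 2 ^ s,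
      ‖szegoVec β z (σ s) n 1‖ ≤ 2 * K * q ^ n * r ^ (2 * 2 ^ s) := by
    intro s hs n hn
    obtain ⟨d, hd⟩ := Nat.exists_eq_add_of_le hn
    have h1 := norm_szegoVec_le hβ ha hz (hσ1 s) n d
    rw [← hd] at h1
    have h2 := hup n d
    have h3 : r ^ d ≤ r ^ (2 ^ s) := pow_le_pow_right₀ hr.le (by omega)
    have h4 : q ^ d * ‖szegoVec β z (σ s) n 1‖
        ≤ q ^ d * (2 * K * q ^ n * r ^ (2 * 2 ^ s)) := by
      refine h1.trans ?_
      calc _ ≤ 2 * (K * r ^ (2 ^ s)) * (q ^ (2 ^ s) * r ^ (2 ^ s)) := by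
            gcongr
            · exact h2.trans (by gcongr)
            · exact hsmall s hs
        _ = _ := by
          have : q ^ (2 ^ s) = q ^ n * q ^ d := by rw [hd, pow_add]
          rw [this, two_mul (2 ^ s), pow_add]; ring
    exact le_of_mul_le_mul_left h4 (by positivity)
  have hlin : ∀ (τ τ' : ℂ) (n : ℕ), ‖τ - τ'‖ * ‖szegoProd β z n 1 1‖
      ≤ ‖szegoVec β z τ n 1‖ + ‖szegoVec β z τ' n 1‖ := by
    intro τ τ' n
    rw [← norm_mul]
    refine le_trans (le_of_eq ?_) (norm_sub_le _ _)
    congr 1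
    rw [szegoVec, szegoVec]; ring
  have hlin' : ∀ (τ τ' : ℂ) (n : ℕ), ‖szegoVec β z τ n 1‖
      ≤ ‖szegoVec β z τ' n 1‖ + ‖τ - τ'‖ * ‖szegoProd β z n 1 1‖ := by
    intro τ τ' n
    rw [← norm_mul]
    refine le_trans (le_of_eq ?_) (norm_add_le _ _)
    congr 1
    rw [szegoVec, szegoVec]; ring
  set θ := q * r ^ 6 with hθ
  have hθ0 : 0 < θ := by positivity
  have hθ1 : θ < 1 := by
    refine lt_of_le_of_lt ?_ hr2
    exact mul_le_mul_of_nonneg_left (pow_le_pow_right₀ hr.le (by norm_num)) hq0.le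
  have hstep : ∀ s ≥ s₀, ‖σ s - σ (s + 1)‖ ≤ 3 * K * θ ^ (2 ^ s) := by
    intro s hs
    have h1 := hlin (σ s) (σ (s + 1)) (2 ^ s)
    have h2 := hsmall s hs
    have h3 := hback (s + 1) (by omega) (2 ^ s) (by rw [pow_succ]; omega)
    have h4 := hlo s hs
    have h5 : r ^ (2 ^ s) ≤ r ^ (2 * 2 ^ (s + 1)) :=
      pow_le_pow_right₀ hr.le (by rw [pow_succ]; omega)
    calc ‖σ s - σ (s + 1)‖
        ≤ ‖σ s - σ (s + 1)‖ * (‖szegoProd β z (2 ^ s) 1 1‖ * r ^ (2 ^ s)) :=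
          le_mul_of_one_le_right (norm_nonneg _) h4
      _ = (‖σ s - σ (s + 1)‖ * ‖szegoProd β z (2 ^ s) 1 1‖) * r ^ (2 ^ s) := by ring
      _ ≤ (q ^ (2 ^ s) * r ^ (2 * 2 ^ (s + 1)) + 2 * K * q ^ (2 ^ s) * r ^ (2 * 2 ^ (s + 1)))
          * r ^ (2 ^ s) := by
        gcongr
        refine h1.trans (add_le_add (h2.trans (by gcongr)) h3)
      _ = (1 + 2 * K) * (q ^ (2 ^ s) * (r ^ (2 * 2 ^ (s + 1)) * r ^ (2 ^ s))) := by ring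
      _ ≤ 3 * K * θ ^ (2 ^ s) := by
        rw [hθ, mul_pow, ← pow_mul, ← pow_add]
        have : r ^ (2 * 2 ^ (s + 1) + 2 ^ s) ≤ r ^ (6 * 2 ^ s) :=
          pow_le_pow_right₀ hr.le (by rw [pow_succ]; omega)
        gcongr
        linarith
  obtain ⟨τ, hτ⟩ : ∃ τ : ℂ, ∀ s ≥ s₀, ‖σ s - τ‖ ≤ 3 * K * θ ^ (2 ^ s) / (1 - θ) := by
    have hpow : ∀ i s : ℕ, θ ^ (2 ^ (s + i)) ≤ θ ^ (2 ^ s) * θ ^ i := fun i s => by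
      rw [← pow_add]
      refine pow_le_pow_of_le_one hθ0.le hθ1.le ?_
      have h1 : i < 2 ^ i := i.lt_two_pow_self
      have h2 : 1 ≤ 2 ^ s := Nat.one_le_two_pow
      rw [pow_add]; nlinarith
    have hgeo := summable_geometric_of_lt_one hθ0.le hθ1
    have hsum : ∀ s, Summable fun i => 3 * K * θ ^ (2 ^ (s + i)) := fun s =>
      Summable.of_nonneg_of_le (fun i => by positivity)
        (fun i => mul_le_mul_of_nonneg_left (hpow i s) (by positivity))
        ((hgeo.mul_left _).mul_left _)
    have hd : ∀ i, dist (σ (s₀ + i)) (σ (s₀ + i + 1)) ≤ 3 * K * θ ^ (2 ^ (s₀ + i)) := fun i => by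
      rw [dist_eq_norm]; exact hstep _ (by omega)
    obtain ⟨τ, hτ⟩ := cauchySeq_tendsto_of_complete (cauchySeq_of_dist_le_of_summable
      (f := fun i => σ (s₀ + i)) _ hd (hsum s₀))
    refine ⟨τ, fun s hs => ?_⟩
    obtain ⟨i, rfl⟩ := Nat.exists_eq_add_of_le hs
    rw [← dist_eq_norm]
    refine (dist_le_tsum_of_dist_le_of_tendsto _ hd (hsum s₀) hτ i).trans ?_
    calc ∑' m, 3 * K * θ ^ (2 ^ (s₀ + (i + m)))
        ≤ ∑' m, 3 * K * (θ ^ (2 ^ (s₀ + i)) * θ ^ m) := by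
          refine Summable.tsum_le_tsum (fun m => ?_) ?_ ((hgeo.mul_left _).mul_left _)
          · rw [← add_assoc]
            exact mul_le_mul_of_nonneg_left (hpow m (s₀ + i)) (by positivity)
          · simpa only [add_assoc] using hsum (s₀ + i)
      _ = _ := by rw [tsum_mul_left, tsum_mul_left, tsum_geometric_of_lt_one hθ0.le hθ1]; ring
  have hlim : Filter.Tendsto σ Filter.atTop (nhds τ) := by
    have h1 : Filter.Tendsto (fun s : ℕ => 3 * K * θ ^ (2 ^ s) / (1 - θ)) Filter.atTop
        (nhds 0) := by
      have := (tendsto_pow_atTop_nhds_zero_of_lt_one hθ0.le hθ1).comp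
        (tendsto_pow_atTop_atTop_of_one_lt (r := 2) one_lt_two)
      simpa using (this.const_mul (3 * K)).div_const (1 - θ)
    rw [tendsto_iff_norm_sub_tendsto_zero]
    refine squeeze_zero' (Filter.Eventually.of_forall fun _ => norm_nonneg _) ?_ h1
    filter_upwards [Filter.eventually_ge_atTop s₀] with s hs using hτ s hs
  have hτ1 : ‖τ‖ = 1 := by
    have := hlim.norm
    simp only [hσ1] at this
    exact tendsto_nhds_unique this tendsto_const_nhds
  refine ⟨τ, hτ1, ?_⟩
  have hbound : ∀ n ≥ 2 ^ s₀,
      ‖szegoVec β z τ n 1‖ ≤ (2 * K + 3 * K / (1 - θ) * K) * (θ * r) ^ n := by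
    intro n hn
    have hn0 : n ≠ 0 := by have : 1 ≤ 2 ^ s₀ := Nat.one_le_two_pow; omega
    obtain ⟨s, hs1, hs2, hs3⟩ : ∃ s, s₀ ≤ s ∧ n ≤ 2 ^ s ∧ 2 ^ s ≤ 2 * n := by
      refine ⟨Nat.log 2 n + 1, ?_, ?_, ?_⟩
      · have := Nat.le_log_of_pow_le one_lt_two hn; omega
      · exact (Nat.lt_pow_succ_log_self one_lt_two n).le
      · rw [pow_succ]
        have := Nat.pow_log_le_self 2 hn0
        omega
    have h0 := sub_pos.2 hθ1
    have h1 := hlin' τ (σ s) n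
    rw [norm_sub_rev] at h1
    have h2 := hback s hs1 n hs2
    have h3 := hτ s hs1
    have h4 : r ^ (2 * 2 ^ s) ≤ r ^ (7 * n) := pow_le_pow_right₀ hr.le (by omega)
    have h5 : θ ^ (2 ^ s) ≤ θ ^ n := pow_le_pow_of_le_one hθ0.le hθ1.le hs2
    calc _ ≤ 2 * K * q ^ n * r ^ (7 * n) + 3 * K * θ ^ n / (1 - θ) * (K * r ^ n) := by
          refine h1.trans (add_le_add (h2.trans (by gcongr)) ?_)
          gcongr
          · exact h3.trans (by gcongr)
          · exact hup0 n
      _ = _ := by rw [hθ, mul_pow, mul_pow, ← pow_mul, pow_mul r 7 n, pow_mul r 6 n]; ring_nf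
  set A := 2 * K + 3 * K / (1 - θ) * K
  rw [← summable_nat_add_iff (2 ^ s₀)]

  have hgeo := summable_geometric_of_lt_one (r := q * r ^ 14) (by positivity) hr2
  refine Summable.of_nonneg_of_le (fun n => by positivity) (fun n => ?_)
    (((summable_nat_add_iff (2 ^ s₀)).2 hgeo).mul_left (A ^ 2))
  rw [div_le_iff₀ (by positivity)]
  calc _ ≤ (A * (θ * r) ^ (n + 2 ^ s₀)) ^ 2 := by
        gcongr
        exact hbound _ (by omega)
    _ = _ := by
      rw [hθ]
      generalize n + 2 ^ s₀ = p
      ring_nf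
end

lemma ae_exists_summable_szegoVec {lam : ℂ} (hlam0 : lam ≠ 0) (hlam : ‖lam‖ < 1) {ω : ℝ}
    (hω : Irrational ω) (w : ℕ) :
    ∀ᵐ t ∂volume.restrict (Set.Ioc (0 : ℝ) 1), ∃ τ : ℂ, ‖τ‖ = 1 ∧
      Summable fun n => ‖szegoVec (powSeq lam ω (w + 2)) (e t) τ n 1‖ ^ 2
        / (1 - ‖lam‖ ^ 2) ^ n := by
  have h0 : 0 < ‖lam‖ := norm_pos_iff.2 hlam0
  have hq0 : 0 < 1 - ‖lam‖ ^ 2 := by nlinarith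
  have hq1 : 1 - ‖lam‖ ^ 2 < 1 := by nlinarith
  have hl := Real.log_neg hq0 hq1
  filter_upwards [ae_exists_logD_ge hlam hω w] with t ht
  set ε := -Real.log (1 - ‖lam‖ ^ 2) / 20 with hε
  have hε0 : 0 < ε := by rw [hε]; linarith
  obtain ⟨C, hC⟩ := exists_logD_powSeq_le hlam hω w hε0
  obtain ⟨s₀, hs₀⟩ := ht ε hε0
  have hpos : ∀ (s N : ℕ),
      0 < ‖szegoProd (fun i => powSeq lam ω (w + 2) (s + i)) (e t) N 1 1‖ := fun s N =>
    norm_pos_iff.2 (one_one_ne_zero (fun j => norm_powSeq _ _ _ _) hlam (norm_e t).le N)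
  refine exists_summable_szegoVec (norm_powSeq lam ω (w + 2)) hlam (norm_e t) (K := Real.exp C)
    (r := Real.exp ε) (Real.one_lt_exp_iff.2 hε0) ?_ (fun s N => ?_) (s₀ := s₀) (fun s hs => ?_)
  · rw [← Real.exp_log hq0, ← Real.exp_nat_mul, ← Real.exp_add, Real.exp_lt_one_iff]
    push_cast; linarith
  · rw [← Real.exp_nat_mul, ← Real.exp_add, ← Real.log_le_iff_le_exp (hpos s N)]
    have := hC s N t
    rw [logD] at this
    linarith
  · have h1 := hs₀ s hs
    have h2 := hpos 0 (2 ^ s)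
    simp only [zero_add] at h2
    rw [logD, Real.le_log_iff_exp_le h2] at h1
    have h3 : Real.exp (-(ε * 2 ^ s)) * Real.exp ε ^ (2 ^ s) = 1 := by
      rw [← Real.exp_nat_mul, ← Real.exp_add]; push_cast; simp [mul_comm]
    rw [← h3]; gcongr

/-- The normalized Szegő recursion at `z = e t` started at `(1, e (-x))`. -/
def normVec (β : ℕ → ℂ) (a t x : ℝ) (i : Fin 2) (n : ℕ) : ℂ :=
  szegoVec β (e t) (e (-x)) n i / (√(1 - a ^ 2) : ℂ) ^ n

lemma normVec_zero (β : ℕ → ℂ) (a t x : ℝ) :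
    normVec β a t x 0 0 = 1 ∧ normVec β a t x 1 0 = e (-x) := by
  simp [normVec, szegoVec_zero]

lemma continuous_normVec (β : ℕ → ℂ) (a : ℝ) (i : Fin 2) (n : ℕ) :
    Continuous fun p : ℝ × ℝ => normVec β a p.1 p.2 i n := by
  unfold normVec szegoVec
  have h (j : Fin 2) : Continuous fun p : ℝ × ℝ => szegoProd β (e p.1) n i j :=
    (differentiable_szegoProd β n i j).continuous.comp (continuous_e.comp continuous_fst)
  have h2 : Continuous fun p : ℝ × ℝ => e (-p.2) := continuous_e.comp continuous_snd.neg
  exact ((h 0).add (h2.mul (h 1))).div_const _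

lemma e_sub_eq (s t : ℝ) : e (s - t) = conj (e t) * e s := by
  rw [conj_e, ← e_add]; ring_nf

lemma norm_normVec_zero_eq_one (β : ℕ → ℂ) (a t x : ℝ) (n : ℕ) :
    ‖normVec β a t x 0 n‖ = ‖normVec β a t x 1 n‖ := by
  rw [normVec, normVec, norm_div, norm_div, norm_szegoVec_zero_eq_one β (norm_e t) (norm_e _)]

section
variable {β : ℕ → ℂ} {a : ℝ} (hβ : ∀ j, ‖β j‖ = a) (ha : a < 1)
include hβ ha

lemma sqrt_one_sub_sq_pos : 0 < √(1 - a ^ 2) := by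
  have ha0 : 0 ≤ a := by rw [← hβ 0]; positivity
  exact Real.sqrt_pos.2 (by nlinarith)

lemma normVec_succ (t x : ℝ) (n : ℕ) :
    (√(1 - a ^ 2) : ℂ) * normVec β a t x 0 (n + 1)
        = e t * normVec β a t x 0 n - conj (β n) * normVec β a t x 1 n ∧
      (√(1 - a ^ 2) : ℂ) * normVec β a t x 1 (n + 1)
        = normVec β a t x 1 n - β n * e t * normVec β a t x 0 n := by
  have h : (√(1 - a ^ 2) : ℂ) ≠ 0 := by exact_mod_cast (sqrt_one_sub_sq_pos hβ ha).ne'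
  simp only [normVec, (szegoVec_succ β (e t) (e (-x)) n).1, (szegoVec_succ β (e t) (e (-x)) n).2]
  constructor <;> (field_simp; ring)

lemma normVec_identity (t x t' x' : ℝ) (n : ℕ) :
    conj (normVec β a t' x' 1 n) * normVec β a t x 1 n
        - conj (normVec β a t' x' 0 n) * normVec β a t x 0 n
      = e (x' - x) - 1 + (1 - e (t - t'))
        * ∑ i ∈ Finset.range n, conj (normVec β a t' x' 0 i) * normVec β a t x 0 i := by
  induction n with
  | zero =>
    simp only [normVec_zero, Finset.range_zero, Finset.sum_empty, map_one]
    rw [show x' - x = -x - -x' by ring, e_sub_eq]; simp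
  | succ n ih =>
    have hρ := sqrt_one_sub_sq_pos hβ ha
    have h : (√(1 - a ^ 2) : ℂ) ≠ 0 := by exact_mod_cast hρ.ne'
    have hsq : (√(1 - a ^ 2) : ℂ) ^ 2 = 1 - conj (β n) * β n := by
      rw [Complex.conj_mul', hβ n, ← Complex.ofReal_pow, Real.sq_sqrt (Real.sqrt_pos.1 hρ).le]
      push_cast; ring
    obtain ⟨h1, h2⟩ := normVec_succ hβ ha t x n
    obtain ⟨h3, h4⟩ := normVec_succ hβ ha t' x' n
    have h3' := congrArg conj h3
    have h4' := congrArg conj h4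
    simp only [map_mul, map_sub, Complex.conj_ofReal, Complex.conj_conj] at h3' h4'
    rw [Finset.sum_range_succ, mul_add, ← add_assoc, ← ih, e_sub_eq]
    apply mul_left_cancel₀ (pow_ne_zero 2 h)
    have hz : conj (e t') * e t' = 1 := by rw [conj_e, e_neg_mul_self]
    calc _ = (↑√(1 - a ^ 2) * conj (normVec β a t' x' 1 (n + 1)))
          * (↑√(1 - a ^ 2) * normVec β a t x 1 (n + 1))
          - (↑√(1 - a ^ 2) * conj (normVec β a t' x' 0 (n + 1)))
          * (↑√(1 - a ^ 2) * normVec β a t x 0 (n + 1)) := by ring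
      _ = _ := by rw [h1, h2, h3', h4', hsq]; ring

end

/-- The first component of the normalized recursion, as a vector in `ℓ²`. -/
def solVec (β : ℕ → ℂ) (a t x : ℝ) : lp (fun _ : ℕ => ℂ) 2 :=
  open Classical in if h : Memℓp (normVec β a t x 0) 2 then ⟨_, h⟩ else 0

lemma solVec_apply {β : ℕ → ℂ} {a t x : ℝ} (h : Memℓp (normVec β a t x 0) 2) (n : ℕ) :
    solVec β a t x n = normVec β a t x 0 n := by
  rw [solVec, dif_pos h]

lemma tendsto_apply_lp (f : lp (fun _ : ℕ => ℂ) 2) :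
    Filter.Tendsto (fun n => f n) Filter.atTop (nhds 0) := by
  have h := (lp.hasSum_norm (p := 2) (by norm_num) f).summable.tendsto_atTop_zero
  simp only [ENNReal.toReal_ofNat, Real.rpow_ofNat] at h
  rw [tendsto_zero_iff_norm_tendsto_zero]
  have := h.sqrt
  simpa using this

lemma norm_sq_lp (f : lp (fun _ : ℕ => ℂ) 2) : HasSum (fun n => ‖f n‖ ^ 2) (‖f‖ ^ 2) := by
  simpa using lp.hasSum_norm (p := 2) (by norm_num) f

lemma one_le_norm_solVec {β : ℕ → ℂ} {a : ℝ} {t x : ℝ} (h : Memℓp (normVec β a t x 0) 2) :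
    1 ≤ ‖solVec β a t x‖ := by
  have := lp.norm_apply_le_norm (p := 2) (by norm_num) (solVec β a t x) 0
  rwa [solVec_apply h, (normVec_zero β a t x).1, norm_one] at this

lemma memlp_normVec {β : ℕ → ℂ} {a : ℝ} {t x M : ℝ}
    (h : ∀ n, ∑ i ∈ Finset.range n, ‖normVec β a t x 0 i‖ ^ 2 ≤ M) :
    Memℓp (normVec β a t x 0) 2 ∧ ‖solVec β a t x‖ ^ 2 ≤ M := by
  have hs := summable_of_sum_range_le (fun n => by positivity) h
  have hm : Memℓp (normVec β a t x 0) 2 := memℓp_gen (by simpa using hs)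
  refine ⟨hm, ?_⟩
  have h1 := norm_sq_lp (solVec β a t x)
  simp only [solVec_apply hm] at h1
  exact le_of_tendsto' h1.tendsto_sum_nat h

section
variable {β : ℕ → ℂ} {a : ℝ} (hβ : ∀ j, ‖β j‖ = a) (ha : a < 1)
include hβ ha

lemma inner_solVec {t x t' x' : ℝ} (h : Memℓp (normVec β a t x 0) 2)
    (h' : Memℓp (normVec β a t' x' 0) 2) :
    (e (t - t') - 1) * inner ℂ (solVec β a t' x') (solVec β a t x) = e (x' - x) - 1 := by
  have hs : HasSum (fun n => conj (normVec β a t' x' 0 n) * normVec β a t x 0 n)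
      (inner ℂ (solVec β a t' x') (solVec β a t x)) := by
    have := lp.hasSum_inner (𝕜 := ℂ) (solVec β a t' x') (solVec β a t x)
    simpa only [solVec_apply h, solVec_apply h', RCLike.inner_apply, mul_comm] using this
  have hz0 : ∀ {t x : ℝ}, Memℓp (normVec β a t x 0) 2 →
      Filter.Tendsto (normVec β a t x 0) Filter.atTop (nhds 0) := fun h => by
    exact (tendsto_apply_lp (solVec β a _ _)).congr fun n => solVec_apply h n
  have hz1 : ∀ {t x : ℝ}, Memℓp (normVec β a t x 0) 2 →
      Filter.Tendsto (normVec β a t x 1) Filter.atTop (nhds 0) := fun h => by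
    rw [tendsto_zero_iff_norm_tendsto_zero]
    have := (hz0 h).norm
    simpa only [norm_normVec_zero_eq_one, norm_zero] using this
  have hc : ∀ {u : ℕ → ℂ}, Filter.Tendsto u Filter.atTop (nhds 0) →
      Filter.Tendsto (fun n => conj (u n)) Filter.atTop (nhds 0) := fun hu => by
    have := (Complex.continuous_conj.tendsto 0).comp hu
    rwa [map_zero] at this
  have hL := ((hc (hz1 h')).mul (hz1 h)).sub ((hc (hz0 h')).mul (hz0 h))
  have hR := (hs.tendsto_sum_nat.const_mul (1 - e (t - t'))).const_add (e (x' - x) - 1)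
  simp only [normVec_identity hβ ha] at hL
  have := tendsto_nhds_unique hL hR
  linear_combination this

end

lemma tendsto_inner_of_tendsto_apply {ι : Type*} {l : Filter ι}
    {v : ι → lp (fun _ : ℕ => ℂ) 2} {w : lp (fun _ : ℕ => ℂ) 2} {K : ℝ}
    (hK : ∀ᶠ s in l, ‖v s‖ ≤ K) (hv : ∀ n, Filter.Tendsto (fun s => v s n) l (nhds (w n)))
    (y : lp (fun _ : ℕ => ℂ) 2) :
    Filter.Tendsto (fun s => inner ℂ (v s) y) l (nhds (inner ℂ w y)) := by
  rw [Metric.tendsto_nhds]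
  intro ε hε
  have hB : 0 < |K| + ‖w‖ + 1 := by positivity
  have hy := lp.hasSum_single (p := 2) (by norm_num) y
  obtain ⟨S, hS⟩ := (Metric.tendsto_nhds.1 hy (ε / 2 / (|K| + ‖w‖ + 1)) (by positivity)).exists
  set yS := ∑ i ∈ S, lp.single 2 i (y i) with hyS
  have hfin : Filter.Tendsto (fun s => inner ℂ (v s) yS) l (nhds (inner ℂ w yS)) := by
    simp only [hyS, inner_sum, lp.inner_single_right, RCLike.inner_apply]
    refine tendsto_finsetSum _ fun i _ => Filter.Tendsto.const_mul _ ?_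
    exact (Complex.continuous_conj.tendsto _).comp (hv i)
  filter_upwards [hK, Metric.tendsto_nhds.1 hfin (ε / 2) (by positivity)] with s h1 h2
  rw [dist_eq_norm] at h2 hS ⊢
  have h3 : inner ℂ (v s) y - inner ℂ w y
      = (inner ℂ (v s) yS - inner ℂ w yS) - inner ℂ (v s - w) (yS - y) := by
    rw [inner_sub_left, inner_sub_right, inner_sub_right]; ring
  rw [h3]
  have h4 : ‖(inner ℂ (v s - w) (yS - y) : ℂ)‖ ≤ ε / 2 := by
    refine (norm_inner_le_norm _ _).trans ?_
    have h5 : ‖v s - w‖ ≤ |K| + ‖w‖ + 1 := by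
      have := norm_sub_le (v s) w
      have := le_abs_self K
      linarith
    calc _ ≤ (|K| + ‖w‖ + 1) * (ε / 2 / (|K| + ‖w‖ + 1)) := by gcongr
      _ = ε / 2 := by field_simp
  have := norm_sub_le (inner ℂ (v s) yS - inner ℂ w yS) (inner ℂ (v s - w) (yS - y))
  linarith

lemma inner_self_lp (x : lp (fun _ : ℕ => ℂ) 2) : inner ℂ x x = (‖x‖ : ℂ) ^ 2 := by
  rw [inner_self_eq_norm_sq_to_K]; rfl

lemma tendsto_normVec {ι : Type*} {l : Filter ι} (β : ℕ → ℂ) (a : ℝ) (i : Fin 2) (n : ℕ)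
    {u v : ι → ℝ} {t x : ℝ} (hu : Filter.Tendsto u l (nhds t)) (hv : Filter.Tendsto v l (nhds x)) :
    Filter.Tendsto (fun s => normVec β a (u s) (v s) i n) l (nhds (normVec β a t x i n)) := by
  have h1 := (continuous_normVec β a i n).tendsto (t, x)
  generalize normVec β a = g at h1 ⊢
  exact h1.comp (hu.prodMk_nhds hv)

lemma hasDerivAt_e (t : ℝ) : HasDerivAt e (2 * Real.pi * Complex.I * e t) t := by
  have h := ((hasDerivAt_id (t : ℂ)).const_mul (2 * Real.pi * Complex.I)).cexp.comp_ofReal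
  rw [show e = fun y : ℝ => Complex.exp (2 * Real.pi * Complex.I * y) from rfl]
  simpa [mul_comm] using h

lemma four_mul_abs_le {y : ℝ} (hy : |y| ≤ 1 / 3) : 4 * |y| ≤ ‖e y - 1‖ := by
  have h := four_mul_dist_round_le y
  have hr : round y = 0 := by
    rw [round_eq_zero_iff]
    exact ⟨by linarith [(abs_le.1 hy).1], by linarith [(abs_le.1 hy).2]⟩
  simpa [hr] using h

lemma log_e_im {y : ℝ} (hy : |y| ≤ 1 / 3) : (Complex.log (e y)).im = 2 * Real.pi * y := by
  have h := abs_le.1 hy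
  have hπ := Real.pi_pos
  rw [e_eq_exp_mul_I, Complex.log_exp]
  · simp
  · simp; nlinarith
  · simp; nlinarith

section
variable {β : ℕ → ℂ} {a : ℝ} (hβ : ∀ j, ‖β j‖ = a) (ha : a < 1)
include hβ ha

lemma abs_sub_le_of_bounded {E : Set ℝ} {f : ℝ → ℝ} {M : ℝ}
    (hM : ∀ t ∈ E, ∀ n, ∑ i ∈ Finset.range n, ‖normVec β a t (f t) 0 i‖ ^ 2 ≤ M)
    (hf : ∀ t ∈ E, ∀ t' ∈ E, |f t' - f t| ≤ 1 / 3) {t t' : ℝ} (ht : t ∈ E) (ht' : t' ∈ E) :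
    |f t' - f t| ≤ Real.pi * M / 2 * |t' - t| := by
  obtain ⟨h1, h2⟩ := memlp_normVec (hM t ht)
  obtain ⟨h3, h4⟩ := memlp_normVec (hM t' ht')
  have h5 := four_mul_abs_le (hf t ht t' ht')
  rw [← inner_solVec hβ ha h1 h3, norm_mul] at h5
  have h6 : ‖e (t - t') - 1‖ ≤ 2 * Real.pi * |t' - t| := by
    have := norm_e_sub_e (t - t') 0
    rwa [e_zero, sub_zero, abs_sub_comm] at this
  have h7 : ‖(inner ℂ (solVec β a t' (f t')) (solVec β a t (f t)) : ℂ)‖ ≤ M := by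
    refine (norm_inner_le_norm _ _).trans ?_
    nlinarith [sq_nonneg (‖solVec β a t' (f t')‖ - ‖solVec β a t (f t)‖)]
  have h8 := mul_le_mul h6 h7 (norm_nonneg _) (by positivity)
  linarith

lemma hasDerivWithinAt_phase {E : Set ℝ} {f : ℝ → ℝ} {M : ℝ}
    (hM : ∀ t ∈ E, ∀ n, ∑ i ∈ Finset.range n, ‖normVec β a t (f t) 0 i‖ ^ 2 ≤ M)
    (hf : ∀ t ∈ E, ∀ t' ∈ E, |f t' - f t| ≤ 1 / 3) {t : ℝ} (ht : t ∈ E) :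
    HasDerivWithinAt f (-‖solVec β a t (f t)‖ ^ 2) E t := by
  have hcont : ContinuousWithinAt f E t := by
    rw [ContinuousWithinAt, tendsto_iff_norm_sub_tendsto_zero]
    have h1 : Filter.Tendsto (fun s => Real.pi * M / 2 * |s - t|) (nhdsWithin t E) (nhds 0) := by
      have : Continuous fun s => Real.pi * M / 2 * |s - t| := by fun_prop
      simpa using (this.tendsto t).mono_left nhdsWithin_le_nhds
    refine squeeze_zero' (Filter.Eventually.of_forall fun _ => norm_nonneg _) ?_ h1
    filter_upwards [self_mem_nhdsWithin] with s hs
    exact abs_sub_le_of_bounded hβ ha hM hf ht hs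
  obtain ⟨hmem, -⟩ := memlp_normVec (hM t ht)
  have hinner : Filter.Tendsto (fun s => inner ℂ (solVec β a s (f s)) (solVec β a t (f t)))
      (nhdsWithin t E) (nhds ((‖solVec β a t (f t)‖ : ℂ) ^ 2)) := by
    rw [← inner_self_lp]
    refine tendsto_inner_of_tendsto_apply (K := √M) ?_ (fun n => ?_) _
    · filter_upwards [self_mem_nhdsWithin] with s hs
      exact Real.le_sqrt_of_sq_le (memlp_normVec (hM s hs)).2
    · have h1 : Filter.Tendsto (fun s => normVec β a s (f s) 0 n) (nhdsWithin t E)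
          (nhds (normVec β a t (f t) 0 n)) :=
        tendsto_normVec β a 0 n (Filter.tendsto_id.mono_left nhdsWithin_le_nhds) hcont
      rw [solVec_apply hmem]
      refine h1.congr' ?_
      filter_upwards [self_mem_nhdsWithin] with s hs
      rw [solVec_apply (memlp_normVec (hM s hs)).1]
  have hF : HasDerivWithinAt (fun s => e (f s - f t))
      (-(2 * Real.pi * Complex.I) * (‖solVec β a t (f t)‖ : ℂ) ^ 2) E t := by
    have h1 : HasDerivAt (fun s => e (t - s)) (-(2 * Real.pi * Complex.I)) t := by
      have := (hasDerivAt_e (t - t)).scomp t ((hasDerivAt_id t).const_sub t)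
      simpa [e_zero, Function.comp_def] using this
    rw [hasDerivWithinAt_iff_tendsto_slope]
    have h2 := (hasDerivWithinAt_iff_tendsto_slope.1 (h1.hasDerivWithinAt (s := E))).mul
      (hinner.mono_left (nhdsWithin_mono t Set.sdiff_subset))
    refine h2.congr' ?_
    filter_upwards [self_mem_nhdsWithin] with s hs
    have h3 := inner_solVec hβ ha hmem (memlp_normVec (hM s hs.1)).1
    simp only [slope, vsub_eq_sub, sub_self, e_zero, smul_mul_assoc]
    rw [h3]
  have hlog := hF.clog_real (by simp [e_zero, Complex.one_mem_slitPlane])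
  have him := (Complex.imCLM.hasFDerivAt.comp_hasDerivWithinAt t hlog)
  have h4 := (him.div_const (2 * Real.pi)).add_const (f t)
  have h5 : HasDerivWithinAt f _ E t := h4.congr (fun s hs => ?_) ?_
  · convert h5 using 1
    simp only [sub_self, e_zero, div_one, Complex.imCLM_apply]
    rw [← Complex.ofReal_pow, Complex.im_mul_ofReal]
    simp
    field_simp
  · simp [log_e_im (hf t ht s hs)]
  · simp [e_zero]
end

lemma exists_measurable_cover_injOn {E : Set ℝ} {f f' : ℝ → ℝ}
    (hf : ∀ x ∈ E, HasDerivWithinAt f (f' x) E x) (h0 : ∀ x ∈ E, f' x ≠ 0) :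
    ∃ s : ℕ → Set ℝ, (∀ n, MeasurableSet (s n)) ∧ E ⊆ ⋃ n, s n ∧
      ∀ n, Set.InjOn f (E ∩ s n) := by
  classical
  obtain ⟨s, A, -, hs, hE, happ, hA⟩ := exists_partition_approximatesLinearOn_of_hasFDerivWithinAt
    f E (fun x => ContinuousLinearMap.toSpanSingleton ℝ (f' x))
    (fun x hx => (hf x hx).hasFDerivWithinAt)
    (fun A => if A 1 = 0 then 1 else ‖A 1‖₊ / 2) (fun A => by
      split_ifs with h
      · exact one_ne_zero
      · exact div_ne_zero (nnnorm_ne_zero_iff.2 h) two_ne_zero)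
  refine ⟨s, hs, hE, fun n x hx y hy hxy => ?_⟩
  obtain ⟨z, hz, hAz⟩ := hA ⟨x, hx.1⟩ n
  have h1 : A n 1 ≠ 0 := by rw [hAz]; simpa using h0 z hz
  have h2 := happ n x hx y hy
  have h3 : A n (x - y) = (x - y) * A n 1 := by
    rw [← smul_eq_mul, ← map_smul, smul_eq_mul, mul_one]
  rw [if_neg h1, hxy, sub_self, zero_sub, norm_neg, h3, norm_mul] at h2
  simp only [NNReal.coe_div, coe_nnnorm, NNReal.coe_ofNat] at h2
  by_contra hne
  have h4 : 0 < ‖x - y‖ := norm_pos_iff.2 (sub_ne_zero.2 hne)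
  have h5 : 0 < ‖A n 1‖ := norm_pos_iff.2 h1
  nlinarith

/-- The phases `t` that have a square summable solution with norm squared at most `M` whose initial
phase lies in the `c`-th third of the unit interval. -/
def boundedPhases (β : ℕ → ℂ) (a : ℝ) (M c : ℕ) : Set ℝ :=
  {t | t ∈ Set.Icc (0 : ℝ) 1 ∧ ∃ x ∈ Set.Icc ((c : ℝ) / 3) ((c + 1) / 3),
    ∀ n, ∑ i ∈ Finset.range n, ‖normVec β a t x 0 i‖ ^ 2 ≤ M}

lemma isClosed_boundedPhases (β : ℕ → ℂ) (a : ℝ) (M c : ℕ) :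
    IsClosed (boundedPhases β a M c) := by
  have h : boundedPhases β a M c = Prod.fst '' ((Set.Icc (0 : ℝ) 1 ×ˢ
      Set.Icc ((c : ℝ) / 3) ((c + 1) / 3)) ∩
      ⋂ n, {p : ℝ × ℝ | ∑ i ∈ Finset.range n, ‖normVec β a p.1 p.2 0 i‖ ^ 2 ≤ M}) := by
    ext t
    simp only [boundedPhases, Set.mem_image, Set.mem_inter_iff, Set.mem_prod, Set.mem_iInter,
      Set.mem_ofPred_eq, Prod.exists, exists_and_right, exists_eq_right]
    constructor
    · rintro ⟨ht, x, hx, h⟩; exact ⟨x, ⟨ht, hx⟩, h⟩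
    · rintro ⟨x, ⟨ht, hx⟩, h⟩; exact ⟨ht, x, hx, h⟩
  rw [h]
  refine (((isCompact_Icc.prod isCompact_Icc).inter_right (isClosed_iInter fun n => ?_)).image
    continuous_fst).isClosed
  exact isClosed_le (continuous_finsetSum _ fun i _ =>
    ((continuous_normVec β a 0 i).norm.pow 2)) continuous_const

lemma exists_e_neg_eq {τ : ℂ} (h : ‖τ‖ = 1) : ∃ x ∈ Set.Ico (0 : ℝ) 1, e (-x) = τ := by
  refine ⟨Int.fract (-(τ.arg / (2 * Real.pi))), ⟨Int.fract_nonneg _, Int.fract_lt_one _⟩, ?_⟩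
  have h1 : -Int.fract (-(τ.arg / (2 * Real.pi)))
      = τ.arg / (2 * Real.pi) + (⌊-(τ.arg / (2 * Real.pi))⌋ : ℤ) := by
    rw [Int.fract]; ring
  rw [h1, e_add, e_int, mul_one, e_eq_exp_mul_I]
  have := Complex.norm_mul_exp_arg_mul_I τ
  rw [h, Complex.ofReal_one, one_mul] at this
  rw [← this]
  congr 3
  rw [this]
  field_simp

section
variable {β : ℕ → ℂ} {a : ℝ} (hβ : ∀ j, ‖β j‖ = a) (ha : a < 1)
include hβ ha

lemma exists_mem_boundedPhases {t : ℝ} (ht : t ∈ Set.Icc (0 : ℝ) 1)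
    (h : ∃ τ : ℂ, ‖τ‖ = 1 ∧ Summable fun n => ‖szegoVec β (e t) τ n 1‖ ^ 2 / (1 - a ^ 2) ^ n) :
    ∃ M c : ℕ, c < 3 ∧ t ∈ boundedPhases β a M c := by
  obtain ⟨τ, hτ, hs⟩ := h
  obtain ⟨x, hx, rfl⟩ := exists_e_neg_eq hτ
  obtain ⟨M, hM⟩ := exists_nat_ge
    (∑' n, ‖szegoVec β (e t) (e (-x)) n 1‖ ^ 2 / (1 - a ^ 2) ^ n)
  have ha0 : 0 ≤ a := by rw [← hβ 0]; positivity
  have hq : 0 < 1 - a ^ 2 := by nlinarith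
  have hx3 : 0 ≤ 3 * x := by linarith [hx.1]
  refine ⟨M, ⌊3 * x⌋₊, (Nat.floor_lt hx3).2 (by push_cast; linarith [hx.2]), ht, x,
    ⟨by linarith [Nat.floor_le hx3], by linarith [Nat.lt_floor_add_one (3 * x)]⟩, fun n => ?_⟩
  refine le_trans ?_ ((hs.sum_le_tsum (Finset.range n) fun i _ => by positivity).trans hM)
  refine Finset.sum_le_sum fun i _ => ?_
  rw [norm_normVec_zero_eq_one, normVec, norm_div, div_pow, norm_pow, Complex.norm_real,
    ← pow_mul, mul_comm i 2, pow_mul, Real.norm_of_nonneg (Real.sqrt_nonneg _), Real.sq_sqrt hq.le]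

lemma exists_disjoint_phase_pieces (hae : ∀ᵐ t ∂volume.restrict (Set.Ioc (0 : ℝ) 1), ∃ τ : ℂ,
      ‖τ‖ = 1 ∧ Summable fun n => ‖szegoVec β (e t) τ n 1‖ ^ 2 / (1 - a ^ 2) ^ n) :
    ∃ (E : ℕ → Set ℝ) (f : ℕ → ℝ → ℝ), (∀ n, MeasurableSet (E n)) ∧
      (∀ n, E n ⊆ Set.Ioc 0 1) ∧ Pairwise (Function.onFun Disjoint E) ∧
      volume (⋃ n, E n) = 1 ∧ ∀ n, Set.InjOn (f n) (E n) ∧ ∀ t ∈ E n, f n t ∈ Set.Icc (0 : ℝ) 1 ∧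
        Memℓp (normVec β a t (f n t) 0) 2 ∧
        HasDerivWithinAt (f n) (-‖solVec β a t (f n t)‖ ^ 2) (E n) t := by
  set H : ℕ → Fin 3 → Set ℝ := fun M c => boundedPhases β a M c ∩ Set.Ioc 0 1 with hH
  have hHm : ∀ M c, MeasurableSet (H M c) := fun M c =>
    (isClosed_boundedPhases β a M c).measurableSet.inter measurableSet_Ioc
  have hex : ∀ (M : ℕ) (c : Fin 3) (t : ℝ), ∃ x, t ∈ H M c →
      x ∈ Set.Icc ((c : ℝ) / 3) ((c + 1) / 3) ∧
      ∀ n, ∑ i ∈ Finset.range n, ‖normVec β a t x 0 i‖ ^ 2 ≤ M := by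
    intro M c t
    by_cases h : t ∈ H M c
    · obtain ⟨x, hx⟩ := h.1.2
      exact ⟨x, fun _ => hx⟩
    · exact ⟨0, fun h' => absurd h' h⟩
  choose F hF using hex
  have hder : ∀ (M : ℕ) (c : Fin 3), ∀ t ∈ H M c,
      HasDerivWithinAt (F M c) (-‖solVec β a t (F M c t)‖ ^ 2) (H M c) t := by
    intro M c t ht
    refine hasDerivWithinAt_phase hβ ha (fun s hs => (hF M c s hs).2) (fun s hs s' hs' => ?_) ht
    have h1 := (hF M c s hs).1
    have h2 := (hF M c s' hs').1
    rw [abs_le]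
    constructor <;> linarith [h1.1, h1.2, h2.1, h2.2]
  have hmem : ∀ (M : ℕ) (c : Fin 3), ∀ t ∈ H M c, Memℓp (normVec β a t (F M c t) 0) 2 :=
    fun M c t ht => (memlp_normVec (hF M c t ht).2).1
  have hcov := fun (M : ℕ) (c : Fin 3) => exists_measurable_cover_injOn (hder M c)
    (fun t ht => by
      have := one_le_norm_solVec (hmem M c t ht)
      have : 0 < ‖solVec β a t (F M c t)‖ ^ 2 := by positivity
      linarith)
  choose s hsm hcov hinj using hcov
  obtain ⟨g, hg⟩ := exists_surjective_nat (ℕ × Fin 3 × ℕ)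
  set S : ℕ → Set ℝ := fun n =>
    H (g n).1 (g n).2.1 ∩ s (g n).1 (g n).2.1 (g n).2.2 with hS
  have hSm : ∀ n, MeasurableSet (S n) := fun n => (hHm _ _).inter (hsm _ _ _)
  have hSE : ∀ n, disjointed S n ⊆ S n := disjointed_subset S
  refine ⟨disjointed S, fun n => F (g n).1 (g n).2.1, fun n => MeasurableSet.disjointed hSm n,
    fun n t ht => (hSE n ht).1.2, disjoint_disjointed S, ?_, fun n =>
    ⟨(hinj _ _ _).mono (hSE n), fun t ht => ?_⟩⟩
  · rw [iUnion_disjointed]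
    apply le_antisymm
    · calc volume (⋃ n, S n) ≤ volume (Set.Ioc (0 : ℝ) 1) :=
            measure_mono (Set.iUnion_subset fun n t ht => ht.1.2)
        _ = 1 := by simp
    · calc (1 : ENNReal) = volume (Set.Ioc (0 : ℝ) 1) := by simp
        _ ≤ volume (⋃ n, S n) := by
          refine measure_mono_ae ?_
          rw [ae_restrict_iff' measurableSet_Ioc] at hae
          filter_upwards [hae] with t ht htm
          obtain ⟨M, c, hc, h⟩ := exists_mem_boundedPhases hβ ha ⟨htm.1.le, htm.2⟩ (ht htm)
          have h1 : t ∈ H M ⟨c, hc⟩ := ⟨h, htm⟩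
          obtain ⟨j, hj⟩ := Set.mem_iUnion.1 (hcov M ⟨c, hc⟩ h1)
          obtain ⟨n, hn⟩ := hg (M, ⟨c, hc⟩, j)
          refine Set.mem_iUnion.2 ⟨n, ?_⟩
          simp only [hS, hn]
          exact ⟨h1, hj⟩
  · have htS := (hSE n ht).1
    refine ⟨?_, hmem _ _ _ htS, (hder _ _ t htS).mono fun u hu => (hSE n hu).1⟩
    obtain ⟨h1, h2⟩ := (hF _ _ t htS).1
    have h3 : (((g n).2.1 : ℕ) : ℝ) ≤ 2 := by exact_mod_cast Nat.lt_succ_iff.1 (g n).2.1.2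
    exact ⟨le_trans (by positivity) h1, by linarith⟩
end

lemma norm_inner_single_zero (v : lp (fun _ : ℕ => ℂ) 2) :
    ‖(inner ℂ v (lp.single 2 0 (1 : ℂ)) : ℂ)‖ = ‖v 0‖ := by
  rw [lp.inner_single_right]; simp

section
variable {ι : Type*} {s : ι → lp (fun _ : ℕ => ℂ) 2} (h0 : ∀ i, ‖s i 0‖ = 1)
  (hs : Pairwise fun i j => inner ℂ (s i) (s j) = 0)
include h0

lemma norm_pos_of_apply_zero (i : ι) : 0 < ‖s i‖ := by
  have h := lp.norm_apply_le_norm (p := 2) (by norm_num) (s i) 0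
  rw [h0 i] at h
  linarith

lemma norm_inner_normalize_single (i : ι) :
    ‖(inner ℂ (((‖s i‖⁻¹ : ℝ) : ℂ) • s i) (lp.single 2 0 (1 : ℂ)) : ℂ)‖ ^ 2
      = (‖s i‖ ^ 2)⁻¹ := by
  rw [norm_inner_single_zero, lp.coeFn_smul, Pi.smul_apply, norm_smul, h0, mul_one,
    Complex.norm_real, norm_inv, norm_norm, inv_pow]

include hs

lemma orthonormal_normalize : Orthonormal ℂ fun i => ((‖s i‖⁻¹ : ℝ) : ℂ) • s i := by
  refine ⟨fun i => ?_, fun i j hij => ?_⟩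
  · have := norm_pos_of_apply_zero h0 i
    rw [norm_smul, Complex.norm_real, norm_inv, norm_norm, inv_mul_cancel₀ this.ne']
  · change inner ℂ (((‖s i‖⁻¹ : ℝ) : ℂ) • s i) (((‖s j‖⁻¹ : ℝ) : ℂ) • s j) = 0
    rw [inner_smul_left, inner_smul_right, hs hij]; simp

lemma tsum_inv_norm_sq_le_one :
    Summable (fun i => (‖s i‖ ^ 2)⁻¹) ∧ ∑' i, (‖s i‖ ^ 2)⁻¹ ≤ 1 := by
  have h1 := (orthonormal_normalize h0 hs).inner_products_summable (lp.single 2 0 (1 : ℂ))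
  have h2 := (orthonormal_normalize h0 hs).tsum_inner_products_le (lp.single 2 0 (1 : ℂ))
  simp only [norm_inner_normalize_single h0] at h1 h2
  rw [lp.norm_single (by norm_num), norm_one, one_pow] at h2
  exact ⟨h1, h2⟩

lemma apply_zero_eq_zero_of_orthogonal (h1 : 1 ≤ ∑' i, (‖s i‖ ^ 2)⁻¹)
    {η : lp (fun _ : ℕ => ℂ) 2} (hη : ∀ i, inner ℂ (s i) η = 0) : η 0 = 0 := by
  have key : ∀ c : ℂ, 1 ≤ ‖lp.single 2 0 (1 : ℂ) - c • η‖ ^ 2 := by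
    intro c
    have h2 := (orthonormal_normalize h0 hs).tsum_inner_products_le
      (lp.single 2 0 (1 : ℂ) - c • η)
    refine h1.trans (le_trans (le_of_eq (tsum_congr fun i => ?_)) h2)
    rw [inner_sub_right, inner_smul_right, inner_smul_left, inner_smul_left, hη, mul_zero,
      mul_zero, sub_zero, ← inner_smul_left, norm_inner_normalize_single h0]
  by_contra hne
  have hpos : 0 < ‖η 0‖ := norm_pos_iff.2 hne
  have hn : 0 < ‖η‖ := hpos.trans_le (lp.norm_apply_le_norm (p := 2) (by norm_num) η 0)
  have hexp : ∀ r : ℝ, ‖lp.single 2 0 (1 : ℂ) - ((r : ℂ) * conj (η 0)) • η‖ ^ 2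
      = 1 - 2 * (r * ‖η 0‖ ^ 2) + r ^ 2 * ‖η 0‖ ^ 2 * ‖η‖ ^ 2 := by
    intro r
    rw [@norm_sub_sq ℂ, lp.norm_single (by norm_num), norm_smul, inner_smul_right,
      lp.inner_single_left]
    have : (r : ℂ) * conj (η 0) * η 0 = ((r * ‖η 0‖ ^ 2 : ℝ) : ℂ) := by
      rw [mul_assoc, mul_comm (conj (η 0)), Complex.mul_conj, Complex.normSq_eq_norm_sq]
      push_cast; ring
    simp only [RCLike.inner_apply, map_one, mul_one]
    rw [this, norm_mul, RCLike.norm_conj, Complex.norm_real, Real.norm_eq_abs, mul_pow, mul_pow,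
      sq_abs, RCLike.re_eq_complex_re, Complex.ofReal_re]
    simp
  have h3 := key (((‖η‖ ^ 2)⁻¹ : ℝ) * conj (η 0))
  rw [hexp] at h3
  have h4 : ((‖η‖ ^ 2)⁻¹) ^ 2 * ‖η 0‖ ^ 2 * ‖η‖ ^ 2 = (‖η‖ ^ 2)⁻¹ * ‖η 0‖ ^ 2 := by
    field_simp
  have h5 : 0 < (‖η‖ ^ 2)⁻¹ * ‖η 0‖ ^ 2 := by positivity
  linarith
end

lemma e_sub_ne_one {t t' : ℝ} (ht : t ∈ Set.Ioc (0 : ℝ) 1) (ht' : t' ∈ Set.Ioc (0 : ℝ) 1)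
    (h : t ≠ t') : e (t - t') ≠ 1 := by
  intro h1
  obtain ⟨n, hn⟩ := (e_eq_one_iff _).1 h1
  have h2 : (-1 : ℝ) < n := by rw [← hn]; linarith [ht.1, ht'.2]
  have h3 : (n : ℝ) < 1 := by rw [← hn]; linarith [ht'.1, ht.2]
  have h4 : n = 0 := by
    have : -1 < n := by exact_mod_cast h2
    have : n < 1 := by exact_mod_cast h3
    omega
  rw [h4, Int.cast_zero, sub_eq_zero] at hn
  exact h hn

section
variable {β : ℕ → ℂ} {a : ℝ} (hβ : ∀ j, ‖β j‖ = a) (ha : a < 1)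
include hβ ha

lemma ae_exists_phases (hae : ∀ᵐ t ∂volume.restrict (Set.Ioc (0 : ℝ) 1), ∃ τ : ℂ,
      ‖τ‖ = 1 ∧ Summable fun n => ‖szegoVec β (e t) τ n 1‖ ^ 2 / (1 - a ^ 2) ^ n) :
    ∀ᵐ x ∂volume.restrict (Set.Ico (0 : ℝ) 1), ∃ (J : Set ℕ) (t : J → ℝ),
      Function.Injective t ∧ (∀ i, t i ∈ Set.Ioc (0 : ℝ) 1) ∧
      (∀ i, Memℓp (normVec β a (t i) x 0) 2) ∧ 1 ≤ ∑' i, (‖solVec β a (t i) x‖ ^ 2)⁻¹ := by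
  obtain ⟨E, f, hE, hE1, hdis, hvol, hf⟩ := exists_disjoint_phase_pieces hβ ha hae
  set T : ℕ → ℝ → ℝ := fun n x => Function.invFunOn (f n) (E n) x with hT
  have hTE : ∀ n x, x ∈ f n '' E n → T n x ∈ E n ∧ f n (T n x) = x := fun n x hx =>
    ⟨Function.invFunOn_mem hx, Function.invFunOn_eq hx⟩
  have hTf : ∀ n, ∀ t ∈ E n, T n (f n t) = t := fun n t ht =>
    (hf n).1 (hTE n _ ⟨t, ht, rfl⟩).1 ht (hTE n _ ⟨t, ht, rfl⟩).2
  set w : ℕ → ℝ → ENNReal := fun n => (f n '' E n).indicator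
    fun x => ENNReal.ofReal (‖solVec β a (T n x) x‖ ^ 2)⁻¹ with hw
  have hmem : ∀ n x, x ∈ f n '' E n → Memℓp (normVec β a (T n x) x 0) 2 := by
    intro n x hx
    have := ((hf n).2 _ (hTE n x hx).1).2.1
    rwa [(hTE n x hx).2] at this
  have hinj : ∀ x, Function.Injective fun i : {n | x ∈ f n '' E n} => T i x := by
    rintro x ⟨i, hi⟩ ⟨j, hj⟩ hij
    by_contra hne
    have hne' : i ≠ j := fun h => hne (Subtype.ext h)
    have h1 := (hTE i x hi).1
    have h2 := (hTE j x hj).1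
    have hij' : T i x = T j x := hij
    rw [hij'] at h1
    exact Set.disjoint_left.1 (hdis hne') h1 h2
  have hbes : ∀ x, Summable (fun i : {n | x ∈ f n '' E n} => (‖solVec β a (T i x) x‖ ^ 2)⁻¹) ∧
      ∑' i : {n | x ∈ f n '' E n}, (‖solVec β a (T i x) x‖ ^ 2)⁻¹ ≤ 1 := by
    intro x
    refine tsum_inv_norm_sq_le_one (fun i => ?_) fun i j hij => ?_
    · rw [solVec_apply (hmem _ x i.2), (normVec_zero _ _ _ _).1, norm_one]
    · have h1 := inner_solVec hβ ha (hmem _ x j.2) (hmem _ x i.2)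
      rw [sub_self, e_zero, sub_self, mul_eq_zero] at h1
      refine h1.resolve_left (sub_ne_zero.2 (e_sub_ne_one ?_ ?_ ?_))
      · exact hE1 _ (hTE _ x j.2).1
      · exact hE1 _ (hTE _ x i.2).1
      · exact fun h => hij (hinj x h).symm
  have hsum : ∀ x, ∑' n, w n x = ENNReal.ofReal
      (∑' i : {n | x ∈ f n '' E n}, (‖solVec β a (T i x) x‖ ^ 2)⁻¹) := by
    intro x
    rw [ENNReal.ofReal_tsum_of_nonneg (fun i => by positivity) (hbes x).1,
      tsum_subtype {n | x ∈ f n '' E n}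
        fun n => ENNReal.ofReal (‖solVec β a (T n x) x‖ ^ 2)⁻¹]
    refine tsum_congr fun n => ?_
    simp only [hw, Set.indicator, Set.mem_ofPred_eq]
  have hItg : ∀ n, ∫⁻ x in f n '' E n, w n x = volume (E n) := by
    intro n
    rw [lintegral_image_eq_lintegral_abs_deriv_mul (hE n) (fun t ht => ((hf n).2 t ht).2.2)
      (hf n).1, setLIntegral_congr_fun (g := fun _ => 1) (hE n), setLIntegral_one]
    intro t ht
    have h1 : f n t ∈ f n '' E n := ⟨t, ht, rfl⟩
    have h2 := one_le_norm_solVec (((hf n).2 t ht).2.1)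
    simp only [hw, Set.indicator_of_mem h1, hTf n t ht]
    rw [← ENNReal.ofReal_mul (abs_nonneg _), abs_neg, abs_of_nonneg (by positivity),
      mul_inv_cancel₀ (by positivity), ENNReal.ofReal_one]
  choose h hhm hhw hhi using fun n => exists_measurable_le_lintegral_eq volume (w n)
  have hle : ∀ x, ∑' n, h n x ≤ (Set.Icc (0 : ℝ) 1).indicator 1 x := by
    intro x
    by_cases hx : x ∈ Set.Icc (0 : ℝ) 1
    · rw [Set.indicator_of_mem hx, Pi.one_apply]
      refine (ENNReal.tsum_le_tsum fun n => hhw n x).trans ?_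
      rw [hsum]
      exact ENNReal.ofReal_le_one.2 (hbes x).2
    · rw [Set.indicator_of_notMem hx, nonpos_iff_eq_zero, ENNReal.tsum_eq_zero]
      intro n
      have h1 : x ∉ f n '' E n := by
        rintro ⟨t, ht, rfl⟩
        exact hx ((hf n).2 t ht).1
      have h2 := hhw n x
      rw [hw] at h2
      simpa [Set.indicator_of_notMem h1] using h2
  have hI : ∫⁻ x, (Set.Icc (0 : ℝ) 1).indicator (1 : ℝ → ENNReal) x = 1 := by
    rw [lintegral_indicator_one measurableSet_Icc]; simp
  have hge : (1 : ENNReal) ≤ ∫⁻ x, ∑' n, h n x := by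
    rw [lintegral_tsum fun n => (hhm n).aemeasurable, ← hvol, measure_iUnion hdis hE]
    refine ENNReal.tsum_le_tsum fun n => ?_
    rw [← hItg n, ← hhi n]
    exact setLIntegral_le_lintegral _ _
  have hae := ae_eq_of_ae_le_of_lintegral_le (μ := volume) (Filter.Eventually.of_forall hle)
    (ne_top_of_le_ne_top (by rw [hI]; exact ENNReal.one_ne_top) (lintegral_mono hle))
    (measurable_one.indicator measurableSet_Icc).aemeasurable (by rw [hI]; exact hge)
  rw [ae_restrict_iff' measurableSet_Ico]
  filter_upwards [hae] with x hx hx01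
  refine ⟨{n | x ∈ f n '' E n}, fun i => T i x, hinj x, fun i => hE1 _ (hTE _ x i.2).1,
    fun i => hmem _ x i.2, ?_⟩
  rw [Set.indicator_of_mem (show x ∈ Set.Icc (0 : ℝ) 1 from ⟨hx01.1, hx01.2.le⟩),
    Pi.one_apply] at hx
  rw [← ENNReal.one_le_ofReal, ← hsum, ← hx]
  exact ENNReal.tsum_le_tsum fun n => hhw n x
end

/-- `L` acts by the unitary `2 × 2` blocks of `α (2 m)` on the pairs `(2 m, 2 m + 1)`. -/
def IsEvenFactor (α : ℕ → ℂ) (L : lp (fun _ : ℕ => ℂ) 2 →L[ℂ] lp (fun _ : ℕ => ℂ) 2) : Prop :=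
  ∀ (ψ : lp (fun _ : ℕ => ℂ) 2) (m : ℕ),
    (L ψ) (2 * m) = conj (α (2 * m)) * ψ (2 * m) + rhoN α (2 * m) * ψ (2 * m + 1) ∧
    (L ψ) (2 * m + 1) = rhoN α (2 * m) * ψ (2 * m) - α (2 * m) * ψ (2 * m + 1)

/-- `M` fixes the entry `0` and acts by the unitary `2 × 2` blocks of `α (2 m + 1)` on the pairs
`(2 m + 1, 2 m + 2)`. -/
def IsOddFactor (α : ℕ → ℂ) (M : lp (fun _ : ℕ => ℂ) 2 →L[ℂ] lp (fun _ : ℕ => ℂ) 2) : Prop :=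
  ∀ (ψ : lp (fun _ : ℕ => ℂ) 2), (M ψ) 0 = ψ 0 ∧ ∀ m : ℕ,
    (M ψ) (2 * m + 1)
      = conj (α (2 * m + 1)) * ψ (2 * m + 1) + rhoN α (2 * m + 1) * ψ (2 * m + 2) ∧
    (M ψ) (2 * m + 2)
      = rhoN α (2 * m + 1) * ψ (2 * m + 1) - α (2 * m + 1) * ψ (2 * m + 2)

lemma conj_rhoN (α : ℕ → ℂ) (n : ℕ) : conj (rhoN α n) = rhoN α n := Complex.conj_ofReal _

lemma eq_of_even_odd {f g : ℕ → ℂ} (h : ∀ m, f (2 * m) = g (2 * m) ∧ f (2 * m + 1) = g (2 * m + 1))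
    (n : ℕ) : f n = g n := by
  obtain ⟨m, rfl | rfl⟩ := Nat.even_or_odd' n
  · exact (h _).1
  · exact (h _).2

lemma tsum_eq_of_pairs {f g : ℕ → ℝ} (hf : Summable f) (hg : Summable g)
    (h : ∀ m, f (2 * m) + f (2 * m + 1) = g (2 * m) + g (2 * m + 1)) : ∑' n, f n = ∑' n, g n := by
  have he : Function.Injective fun m : ℕ => 2 * m := fun _ _ h => by simpa using h
  have ho : Function.Injective fun m : ℕ => 2 * m + 1 := fun _ _ h => by simpa using h
  have hfe : Summable fun m => f (2 * m) := hf.comp_injective he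
  have hfo : Summable fun m => f (2 * m + 1) := hf.comp_injective ho
  have hge : Summable fun m => g (2 * m) := hg.comp_injective he
  have hgo : Summable fun m => g (2 * m + 1) := hg.comp_injective ho
  rw [← tsum_even_add_odd hfe hfo, ← tsum_even_add_odd hge hgo, ← hfe.tsum_add hfo,
    ← hge.tsum_add hgo]
  exact tsum_congr h

section
variable {α : ℕ → ℂ} (hα : ∀ n, ‖α n‖ < 1)
include hα

lemma rhoN_sq (n : ℕ) : rhoN α n ^ 2 = 1 - α n * conj (α n) := by
  have h : 0 ≤ 1 - ‖α n‖ ^ 2 := by nlinarith [hα n, norm_nonneg (α n)]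
  rw [rhoN, ← Complex.ofReal_pow, Real.sq_sqrt h, Complex.mul_conj, Complex.normSq_eq_norm_sq]
  push_cast; ring

lemma rhoN_ne_zero (n : ℕ) : rhoN α n ≠ 0 := by
  have h : 0 < 1 - ‖α n‖ ^ 2 := by nlinarith [hα n, norm_nonneg (α n)]
  rw [rhoN]
  exact_mod_cast (Real.sqrt_pos.2 h).ne'

lemma norm_sq_block (n : ℕ) (x y : ℂ) :
    ‖conj (α n) * x + rhoN α n * y‖ ^ 2 + ‖rhoN α n * x - α n * y‖ ^ 2 = ‖x‖ ^ 2 + ‖y‖ ^ 2 := by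
  have h := rhoN_sq hα n
  have h2 := conj_rhoN α n
  have h3 : ∀ z : ℂ, ((‖z‖ ^ 2 : ℝ) : ℂ) = z * conj z := fun z => by
    rw [Complex.mul_conj, Complex.normSq_eq_norm_sq]
  have : ((‖conj (α n) * x + rhoN α n * y‖ ^ 2 + ‖rhoN α n * x - α n * y‖ ^ 2 : ℝ) : ℂ)
      = ((‖x‖ ^ 2 + ‖y‖ ^ 2 : ℝ) : ℂ) := by
    rw [Complex.ofReal_add, Complex.ofReal_add, h3, h3, h3, h3]
    simp only [map_add, map_sub, map_mul, Complex.conj_conj, h2]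
    linear_combination (x * conj x + y * conj y) * h
  exact_mod_cast this

variable {L M : lp (fun _ : ℕ => ℂ) 2 →L[ℂ] lp (fun _ : ℕ => ℂ) 2}

lemma norm_evenFactor (hL : IsEvenFactor α L) (ψ : lp (fun _ : ℕ => ℂ) 2) : ‖L ψ‖ = ‖ψ‖ := by
  rw [← sq_eq_sq₀ (norm_nonneg _) (norm_nonneg _), ← (norm_sq_lp (L ψ)).tsum_eq,
    ← (norm_sq_lp ψ).tsum_eq]
  refine tsum_eq_of_pairs (norm_sq_lp _).summable (norm_sq_lp _).summable fun m => ?_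
  rw [(hL ψ m).1, (hL ψ m).2, norm_sq_block hα]

lemma norm_oddFactor (hM : IsOddFactor α M) (ψ : lp (fun _ : ℕ => ℂ) 2) : ‖M ψ‖ = ‖ψ‖ := by
  rw [← sq_eq_sq₀ (norm_nonneg _) (norm_nonneg _), ← (norm_sq_lp (M ψ)).tsum_eq,
    ← (norm_sq_lp ψ).tsum_eq, (norm_sq_lp (M ψ)).summable.tsum_eq_zero_add,
    (norm_sq_lp ψ).summable.tsum_eq_zero_add, (hM ψ).1]
  congr 1
  refine tsum_eq_of_pairs ((summable_nat_add_iff 1).2 (norm_sq_lp _).summable)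
    ((summable_nat_add_iff 1).2 (norm_sq_lp _).summable) fun m => ?_
  change ‖(M ψ) (2 * m + 1)‖ ^ 2 + ‖(M ψ) (2 * m + 2)‖ ^ 2 = _
  rw [((hM ψ).2 m).1, ((hM ψ).2 m).2, norm_sq_block hα]

lemma surjective_evenFactor (hL : IsEvenFactor α L) : Function.Surjective L := by
  intro y
  refine ⟨star (L (star y)), ?_⟩
  refine lp.ext (funext (eq_of_even_odd fun m => ?_))
  have h := rhoN_sq hα (2 * m)
  rw [(hL _ m).1, (hL _ m).2]
  simp only [lp.star_apply, (hL (star y) m).1, (hL (star y) m).2, star_add, star_sub, star_mul']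
  simp only [Complex.star_def, Complex.conj_conj, conj_rhoN]
  constructor
  · linear_combination y (2 * m) * h
  · linear_combination y (2 * m + 1) * h

lemma surjective_oddFactor (hM : IsOddFactor α M) : Function.Surjective M := by
  intro y
  refine ⟨star (M (star y)), ?_⟩
  refine lp.ext (funext fun n => ?_)
  rcases n with _ | n
  · simp only [(hM _).1, lp.star_apply, star_star]
  · revert n
    refine eq_of_even_odd fun m => ?_
    have h := rhoN_sq hα (2 * m + 1)
    change (M (star (M (star y)))) (2 * m + 1) = y (2 * m + 1)
      ∧ (M (star (M (star y)))) (2 * m + 2) = y (2 * m + 2)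
    rw [((hM _).2 m).1, ((hM _).2 m).2]
    simp only [lp.star_apply, ((hM (star y)).2 m).1, ((hM (star y)).2 m).2, star_add, star_sub,
      star_mul']
    simp only [Complex.star_def, Complex.conj_conj, conj_rhoN]
    constructor
    · linear_combination y (2 * m + 1) * h
    · linear_combination y (2 * m + 2) * h

variable (hL : IsEvenFactor α L) (hM : IsOddFactor α M)
include hL hM

lemma inner_cmv (x y : lp (fun _ : ℕ => ℂ) 2) : inner ℂ (L (M x)) (L (M y)) = inner ℂ x y := by
  have h : ∀ x, ‖(L.comp M).toLinearMap x‖ = ‖x‖ := fun x => by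
    change ‖L (M x)‖ = _
    rw [norm_evenFactor hα hL, norm_oddFactor hα hM]
  exact (LinearMap.norm_map_iff_inner_map_map (L.comp M)).1 h x y

lemma surjective_cmv : Function.Surjective fun x => L (M x) :=
  (surjective_evenFactor hα hL).comp (surjective_oddFactor hα hM)

lemma inner_eq_zero_of_eigen {x y : lp (fun _ : ℕ => ℂ) 2} {z w : ℂ} (hx : L (M x) = z • x)
    (hy : L (M y) = w • y) (hz : ‖z‖ = 1) (h : z ≠ w) : inner ℂ x y = 0 := by
  have h1 := inner_cmv hα hL hM x y
  rw [hx, hy, inner_smul_left, inner_smul_right] at h1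
  have hzz : z * conj z = 1 := by
    rw [Complex.mul_conj, Complex.normSq_eq_norm_sq, hz]; simp
  have h2 : (w - z) * inner ℂ x y = 0 := by
    linear_combination z * h1 - w * inner ℂ x y * hzz
  exact (mul_eq_zero.1 h2).resolve_left (sub_ne_zero.2 h.symm)

lemma eq_zero_of_invariant {W : Set (lp (fun _ : ℕ => ℂ) 2)} (hW : ∀ x, x ∈ W ↔ L (M x) ∈ W)
    (h0 : ∀ x ∈ W, x 0 = 0) : ∀ x ∈ W, x = 0 := by
  have key : ∀ m : ℕ, ∀ j ≤ 2 * m, ∀ x ∈ W, x j = 0 := by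
    intro m
    induction m with
    | zero => intro j hj; obtain rfl : j = 0 := by omega
              exact h0
    | succ m ih =>
      have hχ : ∀ x ∈ W, (M x) (2 * m) = 0 := by
        intro x hx
        rcases m with _ | m
        · exact (hM x).1.trans (h0 x hx)
        · change (M x) (2 * m + 2) = 0
          rw [((hM x).2 m).2, ih _ (by omega) x hx, ih (2 * m + 2) (by omega) x hx]
          simp
      have hχ1 : ∀ x ∈ W, (M x) (2 * m + 1) = 0 := by
        intro x hx
        have h1 := ih (2 * m) le_rfl _ ((hW x).1 hx)
        rw [(hL (M x) m).1, hχ x hx, mul_zero, zero_add, mul_eq_zero] at h1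
        exact h1.resolve_left (rhoN_ne_zero hα _)
      have hodd : ∀ x ∈ W, x (2 * m + 1) = 0 := by
        intro x hx
        obtain ⟨y, rfl⟩ := surjective_cmv hα hL hM x
        have hy := (hW y).2 hx
        simp only
        rw [(hL (M y) m).2, hχ y hy, hχ1 y hy]; simp
      have heven : ∀ x ∈ W, x (2 * m + 2) = 0 := by
        intro x hx
        have h1 := hχ1 x hx
        rw [((hM x).2 m).1, hodd x hx, mul_zero, zero_add, mul_eq_zero] at h1
        exact h1.resolve_left (rhoN_ne_zero hα _)
      intro j hj
      rcases Nat.lt_or_ge (2 * m) j with h | h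
      · rcases (by omega : j = 2 * m + 1 ∨ j = 2 * m + 2) with rfl | rfl
        · exact hodd
        · exact heven
      · exact ih j h
  intro x hx
  exact lp.ext (funext fun n => key n n (by omega) x hx)
end

lemma exists_lp_of_norm_eq {u w : ℕ → ℂ} (hu : Memℓp u 2) (h : ∀ n, ‖w n‖ = ‖u n‖) :
    ∃ ψ : lp (fun _ : ℕ => ℂ) 2, ∀ n, ψ n = w n := by
  refine ⟨⟨w, memℓp_gen ?_⟩, fun n => rfl⟩
  simpa only [h] using hu.summable (by norm_num)

section
variable {α : ℕ → ℂ} (hα : ∀ n, ‖α n‖ < 1)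
variable {L M : lp (fun _ : ℕ => ℂ) 2 →L[ℂ] lp (fun _ : ℕ => ℂ) 2}
  (hL : IsEvenFactor α L) (hM : IsOddFactor α M)
include hα hL hM

lemma exists_eigenvector {u v : ℕ → ℂ} {z : ℂ} (hz : ‖z‖ = 1)
    (hu : ∀ n, rhoN α n * u (n + 1) = z * u n - conj (α n) * v n)
    (hv : ∀ n, rhoN α n * v (n + 1) = v n - α n * z * u n)
    (h0 : u 0 = v 0) (huv : ∀ n, ‖v n‖ = ‖u n‖) (hmem : Memℓp u 2) :
    ∃ ψ : lp (fun _ : ℕ => ℂ) 2, L (M ψ) = z • ψ ∧ ∀ n, ‖ψ n‖ = ‖u n‖ := by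
  have hz0 : z ≠ 0 := norm_pos_iff.1 (by rw [hz]; norm_num)
  set w : ℕ → ℂ := fun n =>
    if Even n then z⁻¹ ^ (n / 2) * u n else z⁻¹ ^ (n / 2 + 1) * v n with hw
  have hwn : ∀ n, ‖w n‖ = ‖u n‖ := by
    intro n
    simp only [hw]
    split_ifs <;> simp [hz, huv]
  obtain ⟨ψ, hψ⟩ := exists_lp_of_norm_eq hmem hwn
  have he : ∀ m, ψ (2 * m) = z⁻¹ ^ m * u (2 * m) := fun m => by
    rw [hψ]; simp [hw]
  have ho : ∀ m, ψ (2 * m + 1) = z⁻¹ ^ (m + 1) * v (2 * m + 1) := fun m => by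
    rw [hψ]
    simp only [hw, Nat.not_even_bit1, if_false]
    rw [show (2 * m + 1) / 2 = m by omega]
  have hzm : ∀ m, z⁻¹ ^ (m + 1) * z = z⁻¹ ^ m := fun m => by
    rw [pow_succ, mul_assoc, inv_mul_cancel₀ hz0, mul_one]
  have hχo : ∀ m, (M ψ) (2 * m + 1) = z⁻¹ ^ m * u (2 * m + 1) := fun m => by
    rw [((hM ψ).2 m).1, ho, show 2 * m + 2 = 2 * (m + 1) by ring, he,
      show 2 * (m + 1) = 2 * m + 1 + 1 by ring]
    linear_combination z⁻¹ ^ (m + 1) * hu (2 * m + 1) + u (2 * m + 1) * hzm m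
  have hχe : ∀ m, (M ψ) (2 * m) = z⁻¹ ^ m * v (2 * m) := fun m => by
    rcases m with _ | m
    · rw [Nat.mul_zero, (hM ψ).1, pow_zero, one_mul, ← h0]
      simpa using he 0
    · change (M ψ) (2 * m + 2) = _
      rw [((hM ψ).2 m).2, ho, show 2 * m + 2 = 2 * (m + 1) by ring, he,
        show 2 * (m + 1) = 2 * m + 1 + 1 by ring]
      refine mul_left_cancel₀ (rhoN_ne_zero hα (2 * m + 1)) ?_
      linear_combination z⁻¹ ^ (m + 1) * v (2 * m + 1) * rhoN_sq hα (2 * m + 1)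
        - z⁻¹ ^ (m + 1) * α (2 * m + 1) * hu (2 * m + 1) - z⁻¹ ^ (m + 1) * hv (2 * m + 1)
  refine ⟨ψ, lp.ext (funext (eq_of_even_odd fun m => ?_)), fun n => by rw [hψ, hwn]⟩
  rw [(hL _ m).1, (hL _ m).2, hχe, hχo, lp.coeFn_smul, Pi.smul_apply, Pi.smul_apply, he, ho,
    smul_eq_mul, smul_eq_mul]
  constructor
  · linear_combination z⁻¹ ^ m * hu (2 * m)
  · refine mul_left_cancel₀ (rhoN_ne_zero hα (2 * m)) ?_
    linear_combination z⁻¹ ^ m * v (2 * m) * rhoN_sq hα (2 * m)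
      - z⁻¹ ^ m * α (2 * m) * hu (2 * m) - z⁻¹ ^ m * hv (2 * m)
      - rhoN α (2 * m) * v (2 * m + 1) * hzm m

lemma orthogonal_eigenvectors_eq_bot {ι : Type*} {s : ι → lp (fun _ : ℕ => ℂ) 2} {z : ι → ℂ}
    (hz : ∀ i, ‖z i‖ = 1) (hs : ∀ i, L (M (s i)) = z i • s i) (hzi : Function.Injective z)
    (h0 : ∀ i, ‖s i 0‖ = 1) (h1 : 1 ≤ ∑' i, (‖s i‖ ^ 2)⁻¹) :
    (Submodule.span ℂ (Set.range s))ᗮ = ⊥ := by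
  have hmem : ∀ x, x ∈ (Submodule.span ℂ (Set.range s))ᗮ ↔ ∀ i, inner ℂ (s i) x = 0 := by
    intro x
    rw [← Submodule.span_singleton_le_iff_mem, ← Submodule.isOrtho_iff_le,
      Submodule.isOrtho_comm, Submodule.isOrtho_span]
    simp
  refine (Submodule.eq_bot_iff _).2 (eq_zero_of_invariant hα hL hM
    (W := ((Submodule.span ℂ (Set.range s))ᗮ : Submodule ℂ _)) (fun x => ?_) fun x hx => ?_)
  · rw [SetLike.mem_coe, SetLike.mem_coe, hmem, hmem]
    refine forall_congr' fun i => ?_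
    have h2 := inner_cmv hα hL hM (s i) x
    rw [hs, inner_smul_left] at h2
    rw [← h2, mul_eq_zero, or_iff_right]
    exact (map_ne_zero _).2 (norm_pos_iff.1 (by rw [hz]; norm_num))
  · exact apply_zero_eq_zero_of_orthogonal h0 (fun i j hij =>
      inner_eq_zero_of_eigen hα hL hM (hs i) (hs j) (hz i) (hzi.ne hij)) h1 ((hmem x).1 hx)
end

lemma not_finite_lp : ¬ Module.Finite ℂ (lp (fun _ : ℕ => ℂ) 2) := by
  intro h
  have h1 : Orthonormal ℂ fun n : ℕ => (lp.single 2 n (1 : ℂ) : lp (fun _ : ℕ => ℂ) 2) := by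
    refine ⟨fun n => by rw [lp.norm_single (by norm_num), norm_one], fun i j hij => ?_⟩
    change inner ℂ (lp.single 2 i (1 : ℂ)) (lp.single 2 j (1 : ℂ) : lp (fun _ : ℕ => ℂ) 2) = 0
    rw [lp.inner_single_left, lp.single_apply_ne _ _ _ hij]
    simp
  have := h1.linearIndependent.finite
  exact not_finite ℕ

lemma infinite_of_span_orthogonal_eq_bot {ι : Type*} {s : ι → lp (fun _ : ℕ => ℂ) 2}
    (h : (Submodule.span ℂ (Set.range s))ᗮ = ⊥) : Infinite ι := by
  by_contra hfin
  rw [not_infinite_iff_finite] at hfin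
  have : FiniteDimensional ℂ (Submodule.span ℂ (Set.range s)) :=
    FiniteDimensional.span_of_finite ℂ (Set.finite_range s)
  rw [Submodule.orthogonal_eq_bot_iff] at h
  exact not_finite_lp ⟨h ▸ Submodule.fg_span (Set.finite_range s)⟩

section
variable {α : ℕ → ℂ} (hα : ∀ n, ‖α n‖ < 1)
variable {L M : lp (fun _ : ℕ => ℂ) 2 →L[ℂ] lp (fun _ : ℕ => ℂ) 2}
  (hL : IsEvenFactor α L) (hM : IsOddFactor α M)
include hα hL hM

lemma exists_hilbertBasis_of_eigenvectors {J : Set ℕ} {s : J → lp (fun _ : ℕ => ℂ) 2} {z : J → ℂ}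
    (hz : ∀ i, ‖z i‖ = 1) (hs : ∀ i, L (M (s i)) = z i • s i) (hzi : Function.Injective z)
    (h0 : ∀ i, ‖s i 0‖ = 1) (h1 : 1 ≤ ∑' i, (‖s i‖ ^ 2)⁻¹) :
    ∃ b : HilbertBasis ℕ ℂ (lp (fun _ : ℕ => ℂ) 2), ∀ i, ∃ μ : ℂ, (L.comp M) (b i) = μ • b i := by
  classical
  have hbot := orthogonal_eigenvectors_eq_bot hα hL hM hz hs hzi h0 h1
  have hinf := infinite_of_span_orthogonal_eq_bot hbot
  have g : ℕ ≃ J := (Nat.Subtype.orderIsoOfNat J).toEquiv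
  have hon := (orthonormal_normalize h0 fun i j hij =>
    inner_eq_zero_of_eigen hα hL hM (hs i) (hs j) (hz i) (hzi.ne hij)).comp g g.injective
  have hspan : (Submodule.span ℂ (Set.range
      ((fun i => ((‖s i‖⁻¹ : ℝ) : ℂ) • s i) ∘ g)))ᗮ = ⊥ := by
    rw [eq_bot_iff, ← hbot]
    refine Submodule.orthogonal_le (Submodule.span_le.2 ?_)
    rintro _ ⟨i, rfl⟩
    have h2 : s i = (‖s i‖ : ℂ) • (((‖s i‖⁻¹ : ℝ) : ℂ) • s i) := by
      have := (norm_pos_of_apply_zero h0 i).ne'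
      rw [smul_smul, ← Complex.ofReal_mul, mul_inv_cancel₀ this, Complex.ofReal_one, one_smul]
    rw [h2]
    exact Submodule.smul_mem _ _ (Submodule.subset_span ⟨g.symm i, by simp⟩)
  refine ⟨HilbertBasis.mkOfOrthogonalEqBot hon hspan, fun i => ⟨z (g i), ?_⟩⟩
  rw [HilbertBasis.coe_mkOfOrthogonalEqBot, Function.comp_apply, ContinuousLinearMap.comp_apply,
    map_smul, map_smul, hs, smul_comm]
end

/-- For Verblunsky coefficients `α_{x,n} = e(x) λ e(ω n^k)` with
`0 < |λ| < 1`, `ω` irrational and `k ≥ 2`, for Lebesgue-a.e. `x ∈ [0,1)` the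
associated half-line CMV operator admits a Hilbert basis of eigenvectors. -/
theorem stmt1 (lam : ℂ) (hlam0 : lam ≠ 0) (hlam1 : ‖lam‖ < 1)
    (ω : ℝ) (hω : Irrational ω) (k : ℕ) (hk : 2 ≤ k) :
    ∀ᵐ x ∂(MeasureTheory.volume.restrict (Set.Ico (0 : ℝ) 1)),
      ∀ α : ℕ → ℂ, (∀ n : ℕ, α n = e x * (lam * e (ω * (n : ℝ) ^ k))) →
      ∀ L M : lp (fun _ : ℕ => ℂ) 2 →L[ℂ] lp (fun _ : ℕ => ℂ) 2,
      (∀ (ψ : lp (fun _ : ℕ => ℂ) 2) (m : ℕ),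
        (L ψ) (2 * m) = conj (α (2 * m)) * ψ (2 * m) + rhoN α (2 * m) * ψ (2 * m + 1) ∧
        (L ψ) (2 * m + 1) = rhoN α (2 * m) * ψ (2 * m) - α (2 * m) * ψ (2 * m + 1)) →
      (∀ ψ : lp (fun _ : ℕ => ℂ) 2, (M ψ) 0 = ψ 0) →
      (∀ (ψ : lp (fun _ : ℕ => ℂ) 2) (m : ℕ),
        (M ψ) (2 * m + 1)
          = conj (α (2 * m + 1)) * ψ (2 * m + 1) + rhoN α (2 * m + 1) * ψ (2 * m + 2) ∧
        (M ψ) (2 * m + 2)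
          = rhoN α (2 * m + 1) * ψ (2 * m + 1) - α (2 * m + 1) * ψ (2 * m + 2)) →
      ∃ b : HilbertBasis ℕ ℂ (lp (fun _ : ℕ => ℂ) 2),
        ∀ i : ℕ, ∃ μ : ℂ, (L.comp M) (b i) = μ • b i := by
  obtain ⟨w, rfl⟩ := Nat.exists_eq_add_of_le' hk
  have hβ := norm_powSeq lam ω (w + 2)
  filter_upwards [ae_exists_phases hβ hlam1 (ae_exists_summable_szegoVec hlam0 hlam1 hω w)]
    with x hx α hα L M hL hM0 hM1
  obtain ⟨J, t, hinj, ht, hmem, hsum⟩ := hx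
  have hM : IsOddFactor α M := fun ψ => ⟨hM0 ψ, hM1 ψ⟩
  have hαβ : ∀ n, α n = e x * powSeq lam ω (w + 2) n := hα
  have hαn : ∀ n, ‖α n‖ = ‖lam‖ := fun n => by
    rw [hαβ, norm_mul, norm_e, one_mul, hβ]
  have hα1 : ∀ n, ‖α n‖ < 1 := fun n => (hαn n).trans_lt hlam1
  have hxx : e x * e (-x) = 1 := by rw [mul_comm]; exact e_neg_mul_self x
  have hrho : ∀ n, rhoN α n = (√(1 - ‖lam‖ ^ 2) : ℂ) := fun n => by rw [rhoN, hαn]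
  have hex : ∀ i, ∃ ψ : lp (fun _ : ℕ => ℂ) 2, L (M ψ) = e (t i) • ψ ∧
      ∀ n, ‖ψ n‖ = ‖normVec (powSeq lam ω (w + 2)) ‖lam‖ (t i) x 0 n‖ := by
    intro i
    refine exists_eigenvector hα1 hL hM
      (v := fun n => e x * normVec (powSeq lam ω (w + 2)) ‖lam‖ (t i) x 1 n)
      (norm_e _) (fun n => ?_) (fun n => ?_) ?_ (fun n => ?_) (hmem i)
    · rw [hrho, (normVec_succ hβ hlam1 (t i) x n).1, hαβ, map_mul, conj_e]
      linear_combination conj (powSeq lam ω (w + 2) n)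
        * normVec (powSeq lam ω (w + 2)) ‖lam‖ (t i) x 1 n * hxx
    · rw [hrho, hαβ]
      linear_combination e x * (normVec_succ hβ hlam1 (t i) x n).2
    · rw [(normVec_zero _ _ _ _).1, (normVec_zero _ _ _ _).2, hxx]
    · rw [norm_mul, norm_e, one_mul, norm_normVec_zero_eq_one]
  choose s hs hsn using hex
  have hnorm : ∀ i, ‖s i‖ ^ 2 = ‖solVec (powSeq lam ω (w + 2)) ‖lam‖ (t i) x‖ ^ 2 := fun i => by
    rw [← (norm_sq_lp (s i)).tsum_eq, ← (norm_sq_lp (solVec _ _ _ _)).tsum_eq]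
    exact tsum_congr fun n => by rw [hsn, solVec_apply (hmem i)]
  refine exists_hilbertBasis_of_eigenvectors hα1 hL hM (s := s) (z := fun i => e (t i))
    (fun i => norm_e _) hs (fun i j hij => ?_) (fun i => ?_) ?_
  · by_contra hne
    refine e_sub_ne_one (ht i) (ht j) (hinj.ne hne) ?_
    have hij' : e (t i) = e (t j) := hij
    rw [sub_eq_add_neg, e_add, hij', mul_comm, e_neg_mul_self]
  · rw [hsn, (normVec_zero _ _ _ _).1, norm_one]
  · simpa only [hnorm] using hsum
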